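/- Lipschitz Theorem: For every κ > 0 there is a constant C = C(κ) > 0 such that the following holds for all f in the class C(κ) and all real x ≥ C. Let t₁ be any real number with |t₁| ≤ (log x)^κ at which the maximum of |F(1+1/log x+it)| over |t| ≤ (log x)^κ is attained. Then for all real w with 1 ≤ w ≤ x^{1/3} one has | x^{−(1+it₁)}·∑_{n ≤ x} f(n) − (x/w)^{−(1+it₁)}·∑_{n ≤ x/w} f(n) | ≤ C · ( (log w + (log log x)²)/log x )^{min(κ(1−2/π), 1)} · (log x)^{κ−1} · log( log x / log(e·w) ). Moreover, if in addition f(n) is a nonnegative real number for every n, then the same bound holds with the improved exponent min(κ(1−1/π), 1) in place of min(κ(1−2/π), 1). -/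

import Mathlib

open Complex MeasureTheory
open scoped Classical

noncomputable section

/-- Membership of `f` in the class `C(κ)`, witnessed by `Λf`. -/
structure IsHalaszClass (κ : ℝ) (f : ℕ → ℂ) (Λf : ℕ → ℂ) : Prop where
  map_one : f 1 = 1
  mult : ∀ m n : ℕ, Nat.Coprime m n → f (m * n) = f m * f n
  supp : ∀ n : ℕ, ¬ IsPrimePow n → Λf n = 0
  bound : ∀ n : ℕ, 1 ≤ n → ‖Λf n‖ ≤ κ * ArithmeticFunction.vonMangoldt n
  conv : ∀ n : ℕ, 1 ≤ n →
    f n * (Real.log n : ℂ) = ∑ d ∈ n.divisors, Λf d * f (n / d)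
  abs_conv : ∀ σ : ℝ, 1 < σ → Summable (fun n : ℕ => ‖f n‖ / (n : ℝ) ^ σ)

/-- The Dirichlet series `F(s) = ∑ f(n) n^{-s}`. -/
def Fser (f : ℕ → ℂ) (s : ℂ) : ℂ := ∑' n : ℕ, f n / (n : ℂ) ^ s

section Selberg

open Finset ArithmeticFunction Chebyshev

theorem sum_Icc_sum_divisors {M : Type*} [AddCommMonoid M] (φ : ℕ → ℕ → M) (N : ℕ) :
    ∑ k ∈ Icc 1 N, ∑ d ∈ k.divisors, φ d (k / d) =
      ∑ d ∈ Icc 1 N, ∑ m ∈ Icc 1 (N / d), φ d m := by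
  rw [Finset.sum_sigma', Finset.sum_sigma']
  refine Finset.sum_bij' (fun p _ => ⟨p.2, p.1 / p.2⟩) (fun p _ => ⟨p.1 * p.2, p.1⟩) ?_ ?_ ?_ ?_ ?_
  · rintro ⟨k, d⟩ h
    simp only [mem_sigma, mem_Icc, Nat.mem_divisors] at h ⊢
    obtain ⟨⟨h1, h2⟩, h3, h4⟩ := h
    have hd : 0 < d := Nat.pos_of_dvd_of_pos h3 h1
    exact ⟨⟨hd, (Nat.le_of_dvd h1 h3).trans h2⟩, Nat.div_pos (Nat.le_of_dvd h1 h3) hd,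
      Nat.div_le_div_right h2⟩
  · rintro ⟨d, m⟩ h
    simp only [mem_sigma, mem_Icc, Nat.mem_divisors] at h ⊢
    obtain ⟨⟨h1, h2⟩, h3, h4⟩ := h
    have := (Nat.le_div_iff_mul_le h1).1 h4
    refine ⟨⟨Nat.mul_pos h1 h3, by rw [mul_comm]; exact this⟩, dvd_mul_right _ _, by positivity⟩
  · rintro ⟨k, d⟩ h
    simp only [mem_sigma, mem_Icc, Nat.mem_divisors] at h ⊢
    rw [Nat.mul_div_cancel' h.2.1]
  · rintro ⟨d, m⟩ h
    simp only [mem_sigma, mem_Icc] at h ⊢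
    rw [Nat.mul_div_cancel_left _ h.1.1]
  · rintro ⟨k, d⟩ h
    rfl

theorem psi_eq_sum_Icc_one (x : ℝ) : psi x = ∑ n ∈ Icc 1 ⌊x⌋₊, Λ n := by
  rw [psi]; rfl

theorem sum_psi_div (x : ℝ) :
    ∑ n ∈ Icc 1 ⌊x⌋₊, psi (x / n) = ∑ k ∈ Icc 1 ⌊x⌋₊, Real.log k := by
  simp_rw [← vonMangoldt_sum]
  have := sum_Icc_sum_divisors (fun _ m => Λ m) ⌊x⌋₊
  have h2 : ∀ k : ℕ, ∑ d ∈ k.divisors, Λ (k / d) = ∑ d ∈ k.divisors, Λ d := fun k =>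
    Nat.sum_div_divisors k (fun m => Λ m)
  simp_rw [h2] at this
  rw [this]
  refine Finset.sum_congr rfl fun n _ => ?_
  rw [psi_eq_sum_Icc_one, Nat.floor_div_natCast]

theorem sum_log_eq (N : ℕ) (hN : 1 ≤ N) :
    N * Real.log N - N ≤ ∑ k ∈ Icc 1 N, Real.log k ∧
      ∑ k ∈ Icc 1 N, Real.log k ≤ N * Real.log N - N + 1 + Real.log N := by
  induction N, hN using Nat.le_induction with
  | base => simp
  | succ N hN ih =>
    have hN0 : (0:ℝ) < N := by exact_mod_cast hN
    rw [Finset.sum_Icc_succ_top (by omega)]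
    push_cast
    have h1 : Real.log (N + 1) - Real.log N ≤ 1 / N := by
      rw [← Real.log_div (by positivity) (by positivity)]
      have := Real.log_le_sub_one_of_pos (x := ((N:ℝ) + 1) / N) (by positivity)
      refine this.trans (le_of_eq ?_)
      field_simp
      ring
    have h2 : 1 / ((N:ℝ) + 1) ≤ Real.log (N + 1) - Real.log N := by
      rw [← Real.log_div (by positivity) (by positivity)]
      have := Real.one_sub_inv_le_log_of_pos (x := ((N:ℝ) + 1) / N) (by positivity)
      refine le_trans (le_of_eq ?_) this
      field_simp
      ring
    have h3 : N * (Real.log (N + 1) - Real.log N) ≤ 1 := by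
      calc N * (Real.log (N + 1) - Real.log N) ≤ N * (1 / (N:ℝ)) := by gcongr
        _ = 1 := by field_simp
    have h4 : 1 ≤ ((N:ℝ) + 1) * (Real.log (N + 1) - Real.log N) := by
      calc 1 = ((N:ℝ) + 1) * (1 / ((N:ℝ) + 1)) := by field_simp
        _ ≤ _ := by gcongr
    constructor
    · nlinarith [ih.1]
    · nlinarith [ih.2]

theorem exists_harmonic_bound : ∃ γ : ℝ, 0 ≤ γ ∧ γ ≤ 1 ∧ ∀ N : ℕ, 1 ≤ N →
    Real.log N + γ ≤ ∑ k ∈ Icc 1 N, (1 / (k:ℝ)) ∧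
      ∑ k ∈ Icc 1 N, (1 / (k:ℝ)) ≤ Real.log N + γ + 1 / N := by
  refine ⟨Real.eulerMascheroniConstant, ?_, ?_, fun N hN => ?_⟩
  · linarith [Real.one_half_lt_eulerMascheroniConstant]
  · linarith [Real.eulerMascheroniConstant_lt_two_thirds]
  have hN0 : (0:ℝ) < N := by exact_mod_cast hN
  have hH : ∑ k ∈ Icc 1 N, (1 / (k:ℝ)) = (harmonic N : ℝ) := by
    rw [harmonic_eq_sum_Icc]; push_cast; simp
  rw [hH]
  have h1 := Real.eulerMascheroniSeq_lt_eulerMascheroniConstant N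
  have h2 := Real.eulerMascheroniConstant_lt_eulerMascheroniSeq' N
  rw [Real.eulerMascheroniSeq] at h1
  rw [Real.eulerMascheroniSeq', if_neg (by omega)] at h2
  have h3 : Real.log (N + 1) - Real.log N ≤ 1 / N := by
    rw [← Real.log_div (by positivity) (by positivity)]
    have := Real.log_le_sub_one_of_pos (x := ((N:ℝ) + 1) / N) (by positivity)
    refine this.trans (le_of_eq ?_)
    field_simp
    ring
  constructor <;> linarith

theorem floor_bounds {x : ℝ} (hx : 1 ≤ x) :
    1 ≤ ⌊x⌋₊ ∧ (⌊x⌋₊ : ℝ) ≤ x ∧ x ≤ ⌊x⌋₊ + 1 ∧ x ≤ 2 * ⌊x⌋₊ ∧ Real.log x - 1 / ⌊x⌋₊ ≤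
        Real.log ⌊x⌋₊ ∧
      Real.log ⌊x⌋₊ ≤ Real.log x := by
  have h1 : 1 ≤ ⌊x⌋₊ := Nat.one_le_floor_iff _ |>.2 hx
  have h2 : (⌊x⌋₊ : ℝ) ≤ x := Nat.floor_le (by linarith)
  have h3 := (Nat.lt_floor_add_one x).le
  have h1' : (1:ℝ) ≤ ⌊x⌋₊ := by exact_mod_cast h1
  refine ⟨h1, h2, h3, by linarith, ?_, Real.log_le_log (by linarith) h2⟩
  have : Real.log x - Real.log ⌊x⌋₊ ≤ 1 / ⌊x⌋₊ := by
    rw [← Real.log_div (by positivity) (by positivity)]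
    refine (Real.log_le_sub_one_of_pos (by positivity)).trans ?_
    rw [sub_le_iff_le_add, div_le_iff₀ (by positivity)]
    field_simp
    linarith
  linarith

theorem sum_log_floor {x : ℝ} (hx : 1 ≤ x) :
    |∑ k ∈ Icc 1 ⌊x⌋₊, Real.log k - (x * Real.log x - x)| ≤ 3 + 2 * Real.log x := by
  obtain ⟨h1, h2, h3, h4, h5, h6⟩ := floor_bounds hx
  obtain ⟨h7, h8⟩ := sum_log_eq _ h1
  have hN : (1:ℝ) ≤ (⌊x⌋₊ : ℝ) := by exact_mod_cast h1
  set N : ℝ := (⌊x⌋₊ : ℝ)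
  have hL := Real.log_nonneg hx
  have hLN := Real.log_nonneg hN
  have h9 : N * Real.log x - 1 ≤ N * Real.log N := by
    have := mul_le_mul_of_nonneg_left h5 (by linarith : 0 ≤ N)
    have e : N * (1 / N) = 1 := by field_simp
    nlinarith
  have h10 : N * Real.log N ≤ x * Real.log x := by gcongr
  rw [abs_le]
  constructor
  · nlinarith
  · nlinarith

theorem exists_sum_vonMangoldt_div : ∃ C : ℝ, 0 < C ∧ ∀ x : ℝ, 1 ≤ x →
    |∑ n ∈ Icc 1 ⌊x⌋₊, Λ n / n - Real.log x| ≤ C := by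
  refine ⟨Real.log 4 + 4 + 6, by positivity, fun x hx => ?_⟩
  have hx0 : 0 < x := by linarith
  have hfl : ∑ k ∈ Icc 1 ⌊x⌋₊, Real.log k = ∑ d ∈ Icc 1 ⌊x⌋₊, Λ d * (⌊x⌋₊ / d : ℕ) := by
    simp_rw [← vonMangoldt_sum]
    rw [sum_Icc_sum_divisors (fun d _ => Λ d)]
    simp [mul_comm]
  have hA := abs_le.1 (sum_log_floor hx)
  have hpsi := psi_le_const_mul_self hx0.le
  rw [psi_eq_sum_Icc_one] at hpsi
  have hup : ∑ d ∈ Icc 1 ⌊x⌋₊, Λ d * (⌊x⌋₊ / d : ℕ) ≤ x * ∑ n ∈ Icc 1 ⌊x⌋₊, Λ n / n := by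
    rw [Finset.mul_sum]
    refine Finset.sum_le_sum fun d hd => ?_
    rw [mem_Icc] at hd
    have hd0 : (0:ℝ) < d := by exact_mod_cast hd.1
    have : ((⌊x⌋₊ / d : ℕ) : ℝ) ≤ x / d := by
      rw [← Nat.floor_div_natCast]; exact Nat.floor_le (by positivity)
    calc Λ d * (⌊x⌋₊ / d : ℕ) ≤ Λ d * (x / d) := by gcongr
      _ = _ := by ring
  have hlo : x * ∑ n ∈ Icc 1 ⌊x⌋₊, Λ n / n ≤
      ∑ d ∈ Icc 1 ⌊x⌋₊, Λ d * (⌊x⌋₊ / d : ℕ) + ∑ d ∈ Icc 1 ⌊x⌋₊, Λ d := by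
    rw [Finset.mul_sum, ← Finset.sum_add_distrib]
    refine Finset.sum_le_sum fun d hd => ?_
    rw [mem_Icc] at hd
    have hd0 : (0:ℝ) < d := by exact_mod_cast hd.1
    have : x / d ≤ ((⌊x⌋₊ / d : ℕ) : ℝ) + 1 := by
      rw [← Nat.floor_div_natCast]; exact (Nat.lt_floor_add_one _).le
    calc x * (Λ d / d) = Λ d * (x / d) := by ring
      _ ≤ Λ d * ((⌊x⌋₊ / d : ℕ) + 1) := by gcongr
      _ = _ := by ring
  rw [← hfl] at hup hlo
  have hlx : Real.log x ≤ x := (Real.log_le_sub_one_of_pos hx0).trans (by linarith)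
  set T := ∑ n ∈ Icc 1 ⌊x⌋₊, Λ n / n
  have e1 : x * (T - Real.log x) ≤ x * (Real.log 4 + 4 + 6) := by nlinarith
  have e2 : x * -(Real.log 4 + 4 + 6) ≤ x * (T - Real.log x) := by
    have : 0 ≤ Real.log 4 := Real.log_nonneg (by norm_num)
    nlinarith
  rw [abs_le]
  exact ⟨le_of_mul_le_mul_left e2 hx0, le_of_mul_le_mul_left e1 hx0⟩

theorem tatuzawa_iseki (G : ℝ → ℝ) {x : ℝ} (hx : 1 ≤ x) :
    ∑ n ∈ Icc 1 ⌊x⌋₊, (moebius n : ℝ) * Real.log (x / n) *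
        ∑ m ∈ Icc 1 ⌊x / n⌋₊, G (x / n / m) =
      G x * Real.log x + ∑ n ∈ Icc 1 ⌊x⌋₊, Λ n * G (x / n) := by
  have hx0 : 0 < x := by linarith
  have h1 : ∀ n ∈ Icc 1 ⌊x⌋₊, (moebius n : ℝ) * Real.log (x / n) *
        ∑ m ∈ Icc 1 ⌊x / n⌋₊, G (x / n / m) =
      ∑ m ∈ Icc 1 (⌊x⌋₊ / n), (moebius n : ℝ) * Real.log (x / n) * G (x / ((n * m : ℕ) : ℝ)) := by
    intro n _
    rw [Nat.floor_div_natCast, Finset.mul_sum]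
    refine Finset.sum_congr rfl fun m _ => ?_
    push_cast
    rw [div_div]
  rw [Finset.sum_congr rfl h1,
    ← sum_Icc_sum_divisors (fun n m => (moebius n : ℝ) * Real.log (x / n) *
      G (x / ((n * m : ℕ) : ℝ)))]
  have h2 : ∀ k ∈ Icc 1 ⌊x⌋₊, ∑ d ∈ k.divisors,
      (moebius d : ℝ) * Real.log (x / d) * G (x / ((d * (k / d) : ℕ) : ℝ)) =
      (if k = 1 then G x * Real.log x else 0) + Λ k * G (x / k) := by
    intro k hk
    rw [mem_Icc] at hk
    have h3 : ∀ d ∈ k.divisors, (moebius d : ℝ) * Real.log (x / d) *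
        G (x / ((d * (k / d) : ℕ) : ℝ)) =
        ((moebius d : ℝ) * Real.log x - (moebius d : ℝ) * Real.log d) * G (x / k) := by
      intro d hd
      have hd' := Nat.dvd_of_mem_divisors hd
      have hd0 : 0 < d := Nat.pos_of_mem_divisors hd
      rw [Nat.mul_div_cancel' hd', Real.log_div hx0.ne' (by positivity)]
      ring
    rw [Finset.sum_congr rfl h3, ← Finset.sum_mul, Finset.sum_sub_distrib, ← Finset.sum_mul]
    have h4 := sum_moebius_mul_log_eq (n := k)
    simp only [log_apply] at h4
    rw [h4]
    have h5 : ∑ d ∈ k.divisors, (moebius d : ℝ) = if k = 1 then 1 else 0 := by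
      have := congrArg (fun F : ArithmeticFunction ℤ => F k) moebius_mul_coe_zeta
      simp only [coe_mul_zeta_apply, one_apply] at this
      exact_mod_cast this
    rw [h5]
    split_ifs with hk1
    · subst hk1; simp; ring
    · ring
  rw [Finset.sum_congr rfl h2, Finset.sum_add_distrib]
  congr 1
  rw [Finset.sum_ite_eq' (Icc 1 ⌊x⌋₊) 1, if_pos]
  simp only [mem_Icc, le_refl, true_and]
  exact (floor_bounds hx).1

theorem log_mul_le_sqrt {y : ℝ} (hy : 1 ≤ y) : Real.log y * (1 + Real.log y) ≤ 20 * √y := by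
  have hy0 : 0 < y := by linarith
  have h1 : Real.log y ≤ 4 * y ^ (1 / 4 : ℝ) := by
    have := Real.log_le_rpow_div hy0.le (ε := 1 / 4) (by norm_num)
    linarith
  have h2 : (1:ℝ) ≤ y ^ (1 / 4 : ℝ) := Real.one_le_rpow hy (by norm_num)
  have h3 : √y = y ^ (1 / 4 : ℝ) * y ^ (1 / 4 : ℝ) := by
    rw [← Real.rpow_add hy0, Real.sqrt_eq_rpow]; norm_num
  have h4 := Real.log_nonneg hy
  rw [h3]
  calc Real.log y * (1 + Real.log y) ≤
      (4 * y ^ (1 / 4 : ℝ)) * (y ^ (1 / 4 : ℝ) + 4 * y ^ (1 / 4 : ℝ)) := by gcongr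
    _ = _ := by ring

theorem sum_inv_sqrt_le (N : ℕ) : ∑ n ∈ Icc 1 N, 1 / √(n:ℝ) ≤ 2 * √(N:ℝ) := by
  induction N with
  | zero => simp
  | succ N ih =>
    rw [Finset.sum_Icc_succ_top (by omega)]
    have h0 : (0:ℝ) ≤ N := Nat.cast_nonneg N
    have h1 : 0 < √((N+1 : ℕ) : ℝ) := Real.sqrt_pos.2 (by positivity)
    have h2 : √((N+1 : ℕ) : ℝ) * √((N+1 : ℕ) : ℝ) = N + 1 := by
      rw [Real.mul_self_sqrt (by positivity)]; push_cast; ring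
    have h3 : √(N:ℝ) * √(N:ℝ) = N := Real.mul_self_sqrt h0
    have h4 : 1 / √((N+1 : ℕ) : ℝ) ≤ 2 * √((N+1 : ℕ) : ℝ) - 2 * √(N:ℝ) := by
      rw [div_le_iff₀ h1]
      nlinarith [sq_nonneg (√((N+1 : ℕ) : ℝ) - √(N:ℝ))]
    linarith

theorem sum_sqrt_div_le {x : ℝ} (hx : 1 ≤ x) : ∑ n ∈ Icc 1 ⌊x⌋₊, √(x / n) ≤ 2 * x := by
  obtain ⟨h1, h2, -⟩ := floor_bounds hx
  have h : ∀ n : ℕ, √(x / n) = √x * (1 / √(n:ℝ)) := fun n => by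
    rw [Real.sqrt_div (by linarith)]; ring
  simp_rw [h]
  rw [← Finset.mul_sum]
  calc √x * ∑ n ∈ Icc 1 ⌊x⌋₊, 1 / √(n:ℝ) ≤ √x * (2 * √x) := by
        gcongr
        exact (sum_inv_sqrt_le _).trans (by gcongr)
    _ = 2 * (√x * √x) := by ring
    _ = 2 * x := by rw [Real.mul_self_sqrt (by linarith)]

theorem selberg_formula : ∃ C : ℝ, 0 < C ∧ ∀ x : ℝ, 1 ≤ x →
    |psi x * Real.log x + ∑ n ∈ Icc 1 ⌊x⌋₊, Λ n * psi (x / n) - 2 * x * Real.log x| ≤ C * x := by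
  obtain ⟨γ, hγ0, hγ1, hγ⟩ := exists_harmonic_bound
  obtain ⟨C1, hC1, hM⟩ := exists_sum_vonMangoldt_div
  have hl4 : 0 ≤ Real.log 4 := Real.log_nonneg (by norm_num)
  refine ⟨400 + C1 + 2 + 2 * (Real.log 4 + 4), by positivity, fun x hx => ?_⟩
  have hx0 : 0 < x := by linarith
  set G : ℝ → ℝ := fun y => psi y - y + (γ + 1) with hG
  have hF : ∀ y : ℝ, 1 ≤ y → |∑ m ∈ Icc 1 ⌊y⌋₊, G (y / m)| ≤ 10 * (1 + Real.log y) := by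
    intro y hy
    have hy0 : 0 < y := by linarith
    have e : ∑ m ∈ Icc 1 ⌊y⌋₊, G (y / m) = ∑ k ∈ Icc 1 ⌊y⌋₊, Real.log k -
        y * ∑ k ∈ Icc 1 ⌊y⌋₊, (1 / (k:ℝ)) + (γ + 1) * ⌊y⌋₊ := by
      rw [← sum_psi_div, Finset.mul_sum, ← Finset.sum_sub_distrib]
      simp only [hG, Finset.sum_add_distrib, Finset.sum_const, Nat.card_Icc, nsmul_eq_mul]
      congr 1
      · refine Finset.sum_congr rfl fun n _ => by ring
      · simp; ring
    rw [e]
    obtain ⟨h1, h2, h3, h4, h5, h6⟩ := floor_bounds hy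
    obtain ⟨h7, h8⟩ := hγ _ h1
    have h9 := abs_le.1 (sum_log_floor hy)
    have hN : (1:ℝ) ≤ (⌊y⌋₊ : ℝ) := by exact_mod_cast h1
    set N : ℝ := (⌊y⌋₊ : ℝ)
    set H := ∑ k ∈ Icc 1 ⌊y⌋₊, (1 / (k:ℝ))
    have hL := Real.log_nonneg hy
    have h10 : y * (1 / N) ≤ 2 := by
      rw [mul_one_div, div_le_iff₀ (by linarith)]; linarith
    have h11 : y * (Real.log y + γ) - 2 ≤ y * H := by
      have : y * (Real.log y - 1 / N + γ) ≤ y * H := by gcongr; linarith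
      nlinarith
    have h12 : y * H ≤ y * (Real.log y + γ) + 2 := by
      have : y * H ≤ y * (Real.log y + γ + 1 / N) := by gcongr; linarith
      nlinarith
    rw [abs_le]
    constructor
    · nlinarith
    · nlinarith
  have hTI := tatuzawa_iseki G hx
  have hb : |∑ n ∈ Icc 1 ⌊x⌋₊, (moebius n : ℝ) * Real.log (x / n) *
        ∑ m ∈ Icc 1 ⌊x / n⌋₊, G (x / n / m)| ≤ 400 * x := by
    refine (Finset.abs_sum_le_sum_abs _ _).trans ?_
    calc _ ≤ ∑ n ∈ Icc 1 ⌊x⌋₊, 200 * √(x / n) := by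
          refine Finset.sum_le_sum fun n hn => ?_
          rw [mem_Icc] at hn
          have hn0 : (0:ℝ) < n := by exact_mod_cast hn.1
          have hy : 1 ≤ x / n := by
            rw [le_div_iff₀ hn0, one_mul]
            exact (Nat.cast_le.2 hn.2).trans (Nat.floor_le hx0.le)
          have h1 := hF _ hy
          have h2 := log_mul_le_sqrt hy
          have hL := Real.log_nonneg hy
          have hmu : |(moebius n : ℝ)| ≤ 1 := by exact_mod_cast abs_moebius_le_one
          rw [abs_mul, abs_mul, abs_of_nonneg hL]
          calc _ ≤ 1 * Real.log (x / n) * (10 * (1 + Real.log (x / n))) := by gcongr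
            _ ≤ _ := by nlinarith
      _ = 200 * ∑ n ∈ Icc 1 ⌊x⌋₊, √(x / n) := by rw [Finset.mul_sum]
      _ ≤ 200 * (2 * x) := by gcongr; exact sum_sqrt_div_le hx
      _ = _ := by ring
  rw [hTI] at hb
  have e2 : G x * Real.log x + ∑ n ∈ Icc 1 ⌊x⌋₊, Λ n * G (x / n) =
      psi x * Real.log x + ∑ n ∈ Icc 1 ⌊x⌋₊, Λ n * psi (x / n) - x * Real.log x
        - x * ∑ n ∈ Icc 1 ⌊x⌋₊, Λ n / n + (γ + 1) * Real.log x + (γ + 1) * psi x := by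
    rw [psi_eq_sum_Icc_one x, Finset.mul_sum, Finset.mul_sum]
    have : ∑ n ∈ Icc 1 ⌊x⌋₊, Λ n * G (x / n) = ∑ n ∈ Icc 1 ⌊x⌋₊, Λ n * psi (x / n)
        - ∑ n ∈ Icc 1 ⌊x⌋₊, x * (Λ n / n) + ∑ n ∈ Icc 1 ⌊x⌋₊, (γ + 1) * Λ n := by
      rw [← Finset.sum_sub_distrib, ← Finset.sum_add_distrib]
      refine Finset.sum_congr rfl fun n _ => ?_
      simp only [hG]; ring
    rw [this]
    simp only [hG]
    rw [psi_eq_sum_Icc_one x]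
    ring
  rw [e2] at hb
  have hM' := abs_le.1 (hM x hx)
  have hpsi := psi_le_const_mul_self hx0.le
  have hpsi0 := psi_nonneg x
  have hlx : Real.log x ≤ x := (Real.log_le_sub_one_of_pos hx0).trans (by linarith)
  have hL := Real.log_nonneg hx
  have hb' := abs_le.1 hb
  set T := ∑ n ∈ Icc 1 ⌊x⌋₊, Λ n / n
  have q1 : x * T ≤ x * (Real.log x + C1) := by gcongr; linarith
  have q2 : x * (Real.log x - C1) ≤ x * T := by gcongr; linarith
  have q3 : 0 ≤ (γ + 1) * Real.log x := by positivity
  have q4 : (γ + 1) * Real.log x ≤ 2 * x := by nlinarith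
  have q5 : 0 ≤ (γ + 1) * psi x := by positivity
  have q6 : (γ + 1) * psi x ≤ 2 * ((Real.log 4 + 4) * x) := by nlinarith
  have q7 : 0 ≤ Real.log 4 * x := by positivity
  rw [abs_le]
  constructor
  · nlinarith
  · nlinarith

/-- A Brun–Titchmarsh type bound on intervals `(exp √j, exp √(j+1)]`. -/
theorem exists_psi_sub_psi_le : ∃ C : ℝ, 0 < C ∧ ∀ j : ℕ, 1 ≤ j →
    psi (Real.exp √((j:ℝ) + 1)) - psi (Real.exp √(j:ℝ)) ≤ C * Real.exp √(j:ℝ) / √(j:ℝ) := by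
  obtain ⟨C, hC, hS⟩ := selberg_formula
  refine ⟨12 + 6 * C, by positivity, fun j hj => ?_⟩
  have hj' : (1:ℝ) ≤ j := by exact_mod_cast hj
  set a := √(j:ℝ)
  set b := √((j:ℝ) + 1)
  have ha : 1 ≤ a := Real.one_le_sqrt.2 hj'
  have hab : a ≤ b := Real.sqrt_le_sqrt (by linarith)
  have ha2 : a * a = j := Real.mul_self_sqrt (by linarith)
  have hb2 : b * b = j + 1 := Real.mul_self_sqrt (by linarith)
  have hba : b - a ≤ 1 / (2 * a) := by
    rw [le_div_iff₀ (by positivity)]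
    nlinarith
  have hba1 : b - a ≤ 1 / 2 := hba.trans (by
    rw [div_le_div_iff₀ (by positivity) (by positivity)]; linarith)
  have hza : 1 ≤ Real.exp a := Real.one_le_exp (by linarith)
  have hzb : 1 ≤ Real.exp b := Real.one_le_exp (by linarith)
  have hzab : Real.exp a ≤ Real.exp b := Real.exp_le_exp.2 hab
  have h1 := abs_le.1 (hS _ hza)
  have h2 := abs_le.1 (hS _ hzb)
  rw [Real.log_exp] at h1 h2
  have hmono : ∑ n ∈ Icc 1 ⌊Real.exp a⌋₊, Λ n * psi (Real.exp a / n) ≤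
      ∑ n ∈ Icc 1 ⌊Real.exp b⌋₊, Λ n * psi (Real.exp b / n) := by
    calc _ ≤ ∑ n ∈ Icc 1 ⌊Real.exp a⌋₊, Λ n * psi (Real.exp b / n) := by
          refine Finset.sum_le_sum fun n _ => ?_
          gcongr
      _ ≤ _ := by
          refine Finset.sum_le_sum_of_subset_of_nonneg ?_ fun n _ _ => by
            have := psi_nonneg (Real.exp b / n)
            positivity
          exact Finset.Icc_subset_Icc le_rfl (Nat.floor_mono hzab)
  have hexp : Real.exp b ≤ Real.exp a * (1 + 2 * (b - a)) := by
    have : Real.exp b = Real.exp a * Real.exp (b - a) := by rw [← Real.exp_add]; ring_nf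
    rw [this]
    gcongr
    have h0 : 0 ≤ b - a := by linarith
    have := Real.abs_exp_sub_one_sub_id_le (x := b - a) (by rw [abs_of_nonneg h0]; linarith)
    have := (abs_le.1 this).2
    nlinarith
  have hexp2 : Real.exp b ≤ 2 * Real.exp a := by nlinarith
  have hpsi : psi (Real.exp b) * a ≤ psi (Real.exp b) * b := by
    have := psi_nonneg (Real.exp b)
    gcongr
  have key : (psi (Real.exp b) - psi (Real.exp a)) * a ≤
      2 * (Real.exp b * b - Real.exp a * a) + C * Real.exp b + C * Real.exp a := by nlinarith
  have haa : a * (b - a) ≤ 1 / 2 := by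
    calc a * (b - a) ≤ a * (1 / (2 * a)) := by gcongr
      _ = 1 / 2 := by field_simp
  have h3 : Real.exp b * b - Real.exp a * a ≤ 3 * Real.exp a := by
    have e1 : Real.exp b * b ≤ Real.exp a * (1 + 2 * (b - a)) * b := by gcongr
    have e2 : (1 + 2 * (b - a)) * b - a ≤ 3 := by nlinarith
    nlinarith
  rw [le_div_iff₀ (by positivity)]
  nlinarith

end Selberg

section Trivial

open Finset ArithmeticFunction Chebyshev LSeries

/-- The Dirichlet series of a real sequence at a real point. -/
def realDirichlet (a : ℕ → ℝ) (σ : ℝ) : ℝ := ∑' n : ℕ, if n = 0 then 0 else a n / (n : ℝ) ^ σ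

theorem term_ofReal (a : ℕ → ℝ) (σ : ℝ) (n : ℕ) :
    term (fun n => (a n : ℂ)) (σ : ℂ) n = ((if n = 0 then 0 else a n / (n : ℝ) ^ σ : ℝ) : ℂ) := by
  rw [term_def]
  split_ifs with h
  · simp
  · rw [ofReal_div, ofReal_cpow (Nat.cast_nonneg n)]; simp

theorem LSeries_ofReal (a : ℕ → ℝ) (σ : ℝ) :
    LSeries (fun n => (a n : ℂ)) (σ : ℂ) = (realDirichlet a σ : ℂ) := by
  rw [LSeries, realDirichlet, ofReal_tsum]
  exact tsum_congr fun n => term_ofReal a σ n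

theorem LSeriesSummable_ofReal_iff (a : ℕ → ℝ) (σ : ℝ) :
    LSeriesSummable (fun n => (a n : ℂ)) (σ : ℂ) ↔
      Summable fun n : ℕ => if n = 0 then 0 else a n / (n : ℝ) ^ σ := by
  rw [LSeriesSummable, ← Complex.summable_ofReal]
  exact summable_congr fun n => term_ofReal a σ n

theorem LSeriesSummable.ofReal_iff_norm {f : ℕ → ℂ} {s : ℂ} :
    LSeriesSummable (fun n => ((‖f n‖ : ℝ) : ℂ)) s ↔ LSeriesSummable f s := by
  rw [LSeriesSummable, LSeriesSummable, ← summable_norm_iff, ← summable_norm_iff (f := term f s)]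
  refine summable_congr fun n => ?_
  rw [norm_term_eq, norm_term_eq]
  simp

theorem realDirichlet_one_le {σ : ℝ} (hσ : 1 < σ) : realDirichlet 1 σ ≤ σ / (σ - 1) := by
  have h := ZetaAsymptotics.termTSum_of_lt hσ
  have h0 : 0 ≤ ZetaAsymptotics.termTSum σ := tsum_nonneg fun n => by
    exact ZetaAsymptotics.term_nonneg _ _
  have h1 : ∑' n : ℕ, 1 / ((n:ℝ) + 1) ^ σ = realDirichlet 1 σ := by
    rw [realDirichlet, ((LSeriesSummable_ofReal_iff (1 : ℕ → ℝ) σ).1 ?_).tsum_eq_zero_add]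
    · simp
    · have := LSeriesSummable_one_iff (s := (σ:ℂ)).2 (by simpa using hσ)
      convert this using 2
      simp
  rw [h, h1] at h0
  have h2 : 0 < σ := by linarith
  have : 1 / σ * realDirichlet 1 σ ≤ 1 / (σ - 1) := by linarith
  calc realDirichlet 1 σ = σ * (1 / σ * realDirichlet 1 σ) := by field_simp
    _ ≤ σ * (1 / (σ - 1)) := by gcongr
    _ = _ := by ring

theorem realDirichlet_one_le_one_add {σ : ℝ} (hσ : 0 < σ) :
    realDirichlet 1 (1 + σ) ≤ 1 + 1 / σ := by
  refine (realDirichlet_one_le (by linarith)).trans (le_of_eq ?_)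
  rw [add_sub_cancel_left, add_div, div_self hσ.ne', add_comm]

theorem one_le_realDirichlet {a : ℕ → ℝ} (ha : ∀ n, 0 ≤ a n) (ha1 : a 1 = 1) {σ : ℝ}
    (hs : LSeriesSummable (fun n => (a n : ℂ)) σ) : 1 ≤ realDirichlet a σ := by
  rw [LSeriesSummable_ofReal_iff] at hs
  have := hs.le_tsum 1 (fun n _ => by split_ifs; · exact le_rfl
                                      · have := ha n; positivity)
  simp only [one_ne_zero, if_false, Nat.cast_one, Real.one_rpow, ha1, div_one] at this
  exact this

theorem realDirichlet_hasDerivAt {a : ℕ → ℝ}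
    (hs : ∀ σ : ℝ, 1 < σ → LSeriesSummable (fun n => (a n : ℂ)) σ) {σ : ℝ} (hσ : 1 < σ) :
    LSeriesSummable (fun n : ℕ => ((Real.log n * a n : ℝ) : ℂ)) σ ∧
    HasDerivAt (realDirichlet a) (- realDirichlet (fun n : ℕ => Real.log n * a n) σ) σ := by
  have habs : abscissaOfAbsConv (fun n => (a n : ℂ)) ≤ ((1:ℝ) : EReal) :=
    abscissaOfAbsConv_le_of_forall_lt_LSeriesSummable hs
  have hlt : abscissaOfAbsConv (fun n => (a n : ℂ)) < ((σ:ℂ).re : EReal) :=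
    habs.trans_lt (by rw [ofReal_re]; exact_mod_cast hσ)
  have hlog : logMul (fun n => (a n : ℂ)) = fun n : ℕ => ((Real.log n * a n : ℝ) : ℂ) := by
    ext n; simp [logMul]
  have h := LSeries_hasDerivAt hlt
  constructor
  · rw [← hlog]
    refine LSeriesSummable_of_abscissaOfAbsConv_lt_re ?_
    rw [abscissaOfAbsConv_logMul]; exact hlt
  rw [hlog, LSeries_ofReal] at h
  have := h.real_of_complex
  simpa [LSeries_ofReal] using this

theorem realDirichlet_le_rpow {κ : ℝ} {a : ℕ → ℝ} (ha : ∀ n, 0 ≤ a n) (ha1 : a 1 = 1)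
    (hs : ∀ σ : ℝ, 1 < σ → LSeriesSummable (fun n => (a n : ℂ)) σ)
    (hrec : ∀ n, 1 ≤ n → a n * Real.log n ≤ κ * ∑ d ∈ n.divisors, Λ d * a (n / d))
    {σ : ℝ} (hσ : 1 < σ) : realDirichlet a σ ≤ realDirichlet 1 σ ^ κ := by
  have hone : ∀ σ : ℝ, 1 < σ → LSeriesSummable (fun n => ((1 : ℕ → ℝ) n : ℂ)) σ := fun σ hσ => by
    have := LSeriesSummable_one_iff (s := (σ:ℂ)).2 (by simpa using hσ)
    convert this using 2
    simp
  have hZ1 : ∀ σ : ℝ, 1 < σ → 1 ≤ realDirichlet 1 σ := fun σ hσ =>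
    one_le_realDirichlet (by simp) (by simp) (hone σ hσ)
  have hA1 : ∀ σ : ℝ, 1 < σ → 1 ≤ realDirichlet a σ := fun σ hσ =>
    one_le_realDirichlet ha ha1 (hs σ hσ)
  have key1 : ∀ σ : ℝ, 1 < σ → realDirichlet (fun n : ℕ => Real.log n * a n) σ ≤
      κ * (realDirichlet (fun n => Λ n) σ * realDirichlet a σ) := by
    intro σ hσ
    have hΛ := LSeriesSummable_vonMangoldt (s := (σ:ℂ)) (by simpa using hσ)
    have hconv := LSeriesHasSum.convolution hΛ.LSeriesHasSum (hs σ hσ).LSeriesHasSum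
    have hcoe : convolution (fun n => ((Λ n : ℝ) : ℂ)) (fun n => (a n : ℂ)) =
        fun n => ((∑ d ∈ n.divisors, Λ d * a (n / d) : ℝ) : ℂ) := by
      ext n
      rw [LSeries.convolution_def]
      beta_reduce
      rw [Nat.sum_divisorsAntidiagonal (fun d e => ((Λ d : ℝ) : ℂ) * (a e : ℂ))]
      push_cast; rfl
    rw [hcoe] at hconv
    have h1 : realDirichlet (fun n => Λ n) σ * realDirichlet a σ =
        realDirichlet (fun n => ∑ d ∈ n.divisors, Λ d * a (n / d)) σ := by
      have := hconv.LSeries_eq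
      rw [LSeries_ofReal, LSeries_ofReal, LSeries_ofReal] at this
      exact_mod_cast this.symm
    rw [h1, realDirichlet, realDirichlet, ← tsum_mul_left]
    refine Summable.tsum_le_tsum (fun n => ?_) ?_ ?_
    · split_ifs with hn
      · simp
      · have := hrec n (Nat.pos_of_ne_zero hn)
        rw [← mul_div_assoc]
        exact div_le_div_of_nonneg_right (by linarith) (by positivity)
    · exact (LSeriesSummable_ofReal_iff _ σ).1 (realDirichlet_hasDerivAt hs hσ).1
    · exact ((LSeriesSummable_ofReal_iff _ σ).1 hconv.LSeriesSummable).mul_left κ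
  have key2 : ∀ σ : ℝ, 1 < σ → realDirichlet (fun n : ℕ => Real.log n * (1 : ℕ → ℝ) n) σ =
      realDirichlet (fun n => Λ n) σ * realDirichlet 1 σ := by
    intro σ hσ
    have hΛ := LSeriesSummable_vonMangoldt (s := (σ:ℂ)) (by simpa using hσ)
    have hconv := LSeriesHasSum.convolution hΛ.LSeriesHasSum (hone σ hσ).LSeriesHasSum
    have hcoe : convolution (fun n => ((Λ n : ℝ) : ℂ)) (fun n => ((1 : ℕ → ℝ) n : ℂ)) =
        fun n : ℕ => ((Real.log n * (1 : ℕ → ℝ) n : ℝ) : ℂ) := by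
      ext n
      rw [LSeries.convolution_def]
      beta_reduce
      rw [Nat.sum_divisorsAntidiagonal (fun d e => ((Λ d : ℝ) : ℂ) * ((1 : ℕ → ℝ) e : ℂ))]
      rw [← vonMangoldt_sum]
      simp
    rw [hcoe] at hconv
    have := hconv.LSeries_eq
    rw [LSeries_ofReal, LSeries_ofReal, LSeries_ofReal] at this
    exact_mod_cast this
  set Ψ : ℝ → ℝ := fun σ => Real.log (realDirichlet a σ) - κ * Real.log (realDirichlet 1 σ) with hΨ
  have hd : ∀ σ : ℝ, 1 < σ → ∃ d, 0 ≤ d ∧ HasDerivAt Ψ d σ := by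
    intro σ hσ
    have hA := (realDirichlet_hasDerivAt hs hσ).2
    have hZ := (realDirichlet_hasDerivAt hone hσ).2
    have hA0 : 0 < realDirichlet a σ := by linarith [hA1 σ hσ]
    have hZ0 : 0 < realDirichlet 1 σ := by linarith [hZ1 σ hσ]
    refine ⟨_, ?_, (hA.log hA0.ne').sub ((hZ.log hZ0.ne').const_mul κ)⟩
    rw [key2 σ hσ, neg_div, neg_div, mul_div_assoc, div_self hZ0.ne']
    have := key1 σ hσ
    rw [← mul_assoc, ← div_le_iff₀ hA0] at this
    linarith
  have hmono : MonotoneOn Ψ (Set.Ioi 1) := by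
    refine monotoneOn_of_deriv_nonneg (convex_Ioi 1) ?_ ?_ ?_
    · intro x hx
      obtain ⟨d, -, h⟩ := hd x hx
      exact h.continuousAt.continuousWithinAt
    · intro x hx
      rw [interior_Ioi] at hx
      obtain ⟨d, -, h⟩ := hd x hx
      exact h.differentiableAt.differentiableWithinAt
    · intro x hx
      rw [interior_Ioi] at hx
      obtain ⟨d, hd0, h⟩ := hd x hx
      rw [h.deriv]; exact hd0
  have hlim1 : ∀ b : ℕ → ℝ, b 1 = 1 → (∀ σ : ℝ, 1 < σ → LSeriesSummable (fun n => (b n : ℂ)) σ) →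
      Filter.Tendsto (realDirichlet b) Filter.atTop (nhds 1) := by
    intro b hb1 hb
    have habs : abscissaOfAbsConv (fun n => (b n : ℂ)) ≤ ((1:ℝ) : EReal) :=
      abscissaOfAbsConv_le_of_forall_lt_LSeriesSummable hb
    have := LSeries.tendsto_atTop (f := fun n => (b n : ℂ)) (habs.trans_lt (EReal.coe_lt_top 1))
    simp only [LSeries_ofReal, hb1] at this
    exact Filter.tendsto_ofReal_iff.1 this
  have hlim : Filter.Tendsto Ψ Filter.atTop (nhds 0) := by
    have h1 := (hlim1 a ha1 hs).log one_ne_zero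
    have h2 := (hlim1 1 (by simp) hone).log one_ne_zero
    simpa using h1.sub (h2.const_mul κ)
  have hle : Ψ σ ≤ 0 := by
    refine ge_of_tendsto hlim ?_
    filter_upwards [Filter.eventually_ge_atTop σ] with τ hτ
    exact hmono hσ (show 1 < τ by linarith) hτ
  have hA0 : 0 < realDirichlet a σ := by linarith [hA1 σ hσ]
  have hZ0 : 0 < realDirichlet 1 σ := by linarith [hZ1 σ hσ]
  rw [Real.rpow_def_of_pos hZ0, ← Real.log_le_iff_le_exp hA0]
  simp only [hΨ] at hle
  linarith

theorem sum_vonMangoldt_div_sqrt_le (N : ℕ) :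
    ∑ d ∈ Icc 1 N, Λ d / √(d:ℝ) ≤ psi N / √(N:ℝ) + (Real.log 4 + 4) * √(N:ℝ) := by
  have hl4 : 0 ≤ Real.log 4 := Real.log_nonneg (by norm_num)
  induction N with
  | zero => simp
  | succ N ih =>
    rw [Finset.sum_Icc_succ_top (by omega)]
    have hpsi : psi ((N + 1 : ℕ) : ℝ) = psi N + Λ (N + 1) := by
      rw [psi_eq_sum_Icc_one, psi_eq_sum_Icc_one, Nat.floor_natCast, Nat.floor_natCast,
        Finset.sum_Icc_succ_top (by omega)]
    rw [hpsi, add_div]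
    set b := √((N + 1 : ℕ) : ℝ) with hb
    have hb0 : 0 < b := Real.sqrt_pos.2 (by positivity)
    have hab : √(N:ℝ) ≤ b := Real.sqrt_le_sqrt (by push_cast; linarith)
    rcases Nat.eq_zero_or_pos N with rfl | hN
    · simp at ih ⊢; positivity
    have hN0 : (0:ℝ) < N := by exact_mod_cast hN
    set a := √(N:ℝ) with ha
    have ha0 : 0 < a := Real.sqrt_pos.2 hN0
    have ha2 : a * a = N := Real.mul_self_sqrt hN0.le
    have h1 := psi_le_const_mul_self hN0.le
    have h2 : psi N / a - psi N / b ≤ (Real.log 4 + 4) * (b - a) := by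
      have : psi N / a - psi N / b = psi N * ((b - a) / (a * b)) := by field_simp
      rw [this]
      calc psi N * ((b - a) / (a * b)) ≤ ((Real.log 4 + 4) * (a * a)) * ((b - a) / (a * b)) := by
            rw [ha2]; gcongr
        _ = (Real.log 4 + 4) * ((b - a) * (a / b)) := by field_simp
        _ ≤ (Real.log 4 + 4) * ((b - a) * 1) := by
            gcongr
            rw [div_le_one hb0]; exact hab
        _ = _ := by ring
    linarith

theorem sum_vonMangoldt_mul_sqrt_le {y : ℝ} (hy : 0 ≤ y) :
    ∑ d ∈ Icc 1 ⌊y⌋₊, Λ d * √(y / d) ≤ 2 * (Real.log 4 + 4) * y := by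
  have hl4 : 0 ≤ Real.log 4 := Real.log_nonneg (by norm_num)
  rcases lt_or_ge y 1 with h | h
  · rw [Nat.floor_eq_zero.2 h]; simp; positivity
  obtain ⟨h1, h2, -⟩ := floor_bounds h
  have hN : (1:ℝ) ≤ (⌊y⌋₊ : ℝ) := by exact_mod_cast h1
  have h3 := sum_vonMangoldt_div_sqrt_le ⌊y⌋₊
  have h4 : psi (⌊y⌋₊ : ℝ) / √(⌊y⌋₊:ℝ) ≤ (Real.log 4 + 4) * √(⌊y⌋₊:ℝ) := by
    rw [div_le_iff₀ (Real.sqrt_pos.2 (by linarith)), mul_assoc, Real.mul_self_sqrt (by linarith)]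
    exact psi_le_const_mul_self (by linarith)
  calc ∑ d ∈ Icc 1 ⌊y⌋₊, Λ d * √(y / d) = √y * ∑ d ∈ Icc 1 ⌊y⌋₊, Λ d / √(d:ℝ) := by
        rw [Finset.mul_sum]
        refine Finset.sum_congr rfl fun d _ => ?_
        rw [Real.sqrt_div hy]; ring
    _ ≤ √y * (2 * (Real.log 4 + 4) * √y) := by
        gcongr
        have : √(⌊y⌋₊:ℝ) ≤ √y := Real.sqrt_le_sqrt h2
        nlinarith
    _ = 2 * (Real.log 4 + 4) * (√y * √y) := by ring
    _ = _ := by rw [Real.mul_self_sqrt hy]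

/-- A nonnegative arithmetic function dominated by the `κ`-fold divisor function in the sense that
`a log ≤ κ (Λ * a)`. -/
structure IsDominated (κ : ℝ) (a : ℕ → ℝ) : Prop where
  nonneg : ∀ n, 0 ≤ a n
  map_one : a 1 = 1
  summable : ∀ σ : ℝ, 1 < σ → LSeriesSummable (fun n => (a n : ℂ)) σ
  rec_le : ∀ n, 1 ≤ n → a n * Real.log n ≤ κ * ∑ d ∈ n.divisors, Λ d * a (n / d)

theorem IsDominated.dirichlet_le {κ : ℝ} (hκ : 0 ≤ κ) {a : ℕ → ℝ} (h : IsDominated κ a) {σ : ℝ}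
    (hσ : 0 < σ) : realDirichlet a (1 + σ) ≤ (1 + 1 / σ) ^ κ := by
  refine (realDirichlet_le_rpow h.nonneg h.map_one h.summable h.rec_le (by linarith)).trans ?_
  refine Real.rpow_le_rpow ?_ (realDirichlet_one_le_one_add hσ) hκ
  refine tsum_nonneg fun n => ?_
  split_ifs
  · exact le_rfl
  · simp only [Pi.one_apply]; positivity

theorem IsDominated.sum_div_le {κ : ℝ} (hκ : 0 ≤ κ) {a : ℕ → ℝ} (h : IsDominated κ a) {x : ℝ}
    (hx : 1 ≤ x) : ∑ n ∈ Icc 1 ⌊x⌋₊, a n / n ≤ Real.exp 1 * 2 ^ κ * (1 + Real.log x) ^ κ := by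
  have hL := Real.log_nonneg hx
  set ℓ := 1 + Real.log x with hℓ
  have hℓ1 : 1 ≤ ℓ := by linarith
  have hσ : 0 < 1 / ℓ := by positivity
  have hsum := (LSeriesSummable_ofReal_iff a (1 + 1 / ℓ)).1 (h.summable _ (by linarith))
  have h1 : ∑ n ∈ Icc 1 ⌊x⌋₊, a n / n ≤ Real.exp 1 * realDirichlet a (1 + 1 / ℓ) := by
    rw [realDirichlet]
    refine le_trans ?_ (mul_le_mul_of_nonneg_left (hsum.sum_le_tsum (Icc 1 ⌊x⌋₊) fun n _ => ?_)
      (Real.exp_pos 1).le)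
    · rw [Finset.mul_sum]
      refine Finset.sum_le_sum fun n hn => ?_
      rw [mem_Icc] at hn
      have hn0 : (0:ℝ) < n := by exact_mod_cast hn.1
      have hnx : (n:ℝ) ≤ x := (Nat.cast_le.2 hn.2).trans (Nat.floor_le (by linarith))
      rw [if_neg (by omega), Real.rpow_add hn0, Real.rpow_one, ← div_div, ← mul_div_assoc,
        le_div_iff₀ (by positivity), mul_comm]
      have h0 : 0 ≤ a n / n := div_nonneg (h.nonneg n) hn0.le
      refine mul_le_mul_of_nonneg_right ?_ h0
      rw [Real.rpow_def_of_pos hn0]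
      refine Real.exp_le_exp.2 ?_
      rw [mul_one_div, div_le_one (by linarith)]
      have := Real.log_le_log hn0 hnx
      linarith
    · split_ifs
      · exact le_rfl
      · exact div_nonneg (h.nonneg n) (by positivity)
  calc _ ≤ _ := h1
    _ ≤ Real.exp 1 * (1 + 1 / (1 / ℓ)) ^ κ := by gcongr; exact h.dirichlet_le hκ hσ
    _ ≤ Real.exp 1 * (2 * ℓ) ^ κ := by
        gcongr
        rw [one_div_one_div]; linarith
    _ = _ := by rw [Real.mul_rpow (by norm_num) (by linarith)]; ring

theorem exists_sum_mul_sqrt_le {κ : ℝ} (hκ : 0 ≤ κ) : ∃ K : ℝ, 0 < K ∧ ∀ a : ℕ → ℝ,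
    IsDominated κ a →
    ∀ u : ℝ, 1 ≤ u → ∑ n ∈ Icc 1 ⌊u⌋₊, a n * √(u / n) ≤ K * u * (1 + Real.log u) ^ (κ - 1) := by
  have hl4 : 0 ≤ Real.log 4 := Real.log_nonneg (by norm_num)
  refine ⟨(κ * (2 * (Real.log 4 + 4)) + 3) * (Real.exp 1 * 2 ^ κ), by positivity,
    fun a ha u hu => ?_⟩
  have hu0 : 0 < u := by linarith
  have hL := Real.log_nonneg hu
  set W := ∑ n ∈ Icc 1 ⌊u⌋₊, a n * √(u / n) with hW
  set D := ∑ n ∈ Icc 1 ⌊u⌋₊, a n / n with hD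
  have hmem : ∀ n ∈ Icc 1 ⌊u⌋₊, (0:ℝ) < n ∧ 1 ≤ u / n := fun n hn => by
    rw [mem_Icc] at hn
    have hn0 : (0:ℝ) < n := by exact_mod_cast hn.1
    refine ⟨hn0, ?_⟩
    rw [le_div_iff₀ hn0, one_mul]
    exact (Nat.cast_le.2 hn.2).trans (Nat.floor_le hu0.le)
  have h1 : ∑ n ∈ Icc 1 ⌊u⌋₊, a n * Real.log n * √(u / n) ≤ κ * (2 * (Real.log 4 + 4)) * u * D := by
    calc _ ≤ ∑ n ∈ Icc 1 ⌊u⌋₊, κ * ∑ d ∈ n.divisors, Λ d *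
        a (n / d) * √(u / (d * (n / d) : ℕ)) := by
          refine Finset.sum_le_sum fun n hn => ?_
          have hn1 : 1 ≤ n := (mem_Icc.1 hn).1
          have : ∑ d ∈ n.divisors, Λ d * a (n / d) * √(u / (d * (n / d) : ℕ)) =
              (∑ d ∈ n.divisors, Λ d * a (n / d)) * √(u / n) := by
            rw [Finset.sum_mul]
            refine Finset.sum_congr rfl fun d hd => ?_
            rw [Nat.mul_div_cancel' (Nat.dvd_of_mem_divisors hd)]
          rw [this, ← mul_assoc]
          exact mul_le_mul_of_nonneg_right (ha.rec_le n hn1) (Real.sqrt_nonneg _)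
      _ = κ * ∑ m ∈ Icc 1 ⌊u⌋₊, a m * ∑ d ∈ Icc 1 ⌊u / m⌋₊, Λ d * √(u / m / d) := by
          rw [← Finset.mul_sum]
          congr 1
          have := sum_Icc_sum_divisors (fun m d => Λ d * a m * √(u / (d * m : ℕ))) ⌊u⌋₊
          have h2 : ∀ k : ℕ, ∑ d ∈ k.divisors, Λ (k / d) * a d * √(u / ((k / d) * d : ℕ)) =
              ∑ d ∈ k.divisors, Λ d * a (k / d) * √(u / (d * (k / d) : ℕ)) := fun k => by
            rw [← Nat.sum_divisorsAntidiagonal (fun d e => Λ d * a e * √(u / (d * e : ℕ))),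
              ← Nat.sum_divisorsAntidiagonal' (fun d e => Λ d * a e * √(u / (d * e : ℕ)))]
          simp_rw [h2] at this
          rw [this]
          refine Finset.sum_congr rfl fun m _ => ?_
          rw [Nat.floor_div_natCast, Finset.mul_sum]
          refine Finset.sum_congr rfl fun d _ => ?_
          push_cast
          rw [div_div, mul_comm (m:ℝ)]
          ring
      _ ≤ κ * ∑ m ∈ Icc 1 ⌊u⌋₊, a m * (2 * (Real.log 4 + 4) * (u / m)) := by
          gcongr with m hm
          · exact ha.nonneg m
          · exact sum_vonMangoldt_mul_sqrt_le (by positivity)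
      _ = _ := by
          rw [hD, Finset.mul_sum, Finset.mul_sum]
          refine Finset.sum_congr rfl fun m _ => by ring
  have h2 : ∑ n ∈ Icc 1 ⌊u⌋₊, a n * Real.log (u / n) * √(u / n) ≤ 2 * u * D := by
    rw [hD, Finset.mul_sum]
    refine Finset.sum_le_sum fun n hn => ?_
    obtain ⟨hn0, hy⟩ := hmem n hn
    have h3 : Real.log (u / n) ≤ 2 * √(u / n) := by
      have := Real.log_le_rpow_div (x := u / n) (by positivity) (ε := 1 / 2) (by norm_num)
      rw [Real.sqrt_eq_rpow]; linarith
    calc a n * Real.log (u / n) * √(u / n) ≤ a n * (2 * √(u / n)) * √(u / n) := by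
          gcongr; exact ha.nonneg n
      _ = a n * 2 * (√(u / n) * √(u / n)) := by ring
      _ = a n * 2 * (u / n) := by rw [Real.mul_self_sqrt (by positivity)]
      _ = _ := by ring
  have h3 : W ≤ u * D := by
    rw [hW, hD, Finset.mul_sum]
    refine Finset.sum_le_sum fun n hn => ?_
    obtain ⟨hn0, hy⟩ := hmem n hn
    have : √(u / n) ≤ u / n := by
      rw [Real.sqrt_le_iff]; exact ⟨by positivity, by nlinarith⟩
    calc a n * √(u / n) ≤ a n * (u / n) := by gcongr; exact ha.nonneg n
      _ = _ := by ring
  have h4 : W * Real.log u = ∑ n ∈ Icc 1 ⌊u⌋₊, a n * Real.log n * √(u / n) +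
      ∑ n ∈ Icc 1 ⌊u⌋₊, a n * Real.log (u / n) * √(u / n) := by
    rw [hW, Finset.sum_mul, ← Finset.sum_add_distrib]
    refine Finset.sum_congr rfl fun n hn => ?_
    obtain ⟨hn0, hy⟩ := hmem n hn
    rw [Real.log_div hu0.ne' hn0.ne']; ring
  have h5 : W * (1 + Real.log u) ≤ (κ * (2 * (Real.log 4 + 4)) + 3) * u * D := by
    nlinarith
  have h6 := ha.sum_div_le hκ hu
  rw [Real.rpow_sub_one (by linarith), ← mul_div_assoc, le_div_iff₀ (by linarith)]
  calc _ ≤ _ := h5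
    _ ≤ (κ * (2 * (Real.log 4 + 4)) + 3) * u * (Real.exp 1 * 2 ^ κ * (1 + Real.log u) ^ κ) := by
        gcongr
    _ = _ := by ring

theorem IsHalaszClass.isDominated {κ : ℝ} {f Λf : ℕ → ℂ} (h : IsHalaszClass κ f Λf) :
    IsDominated κ (fun n => ‖f n‖) where
  nonneg n := norm_nonneg _
  map_one := by simp [h.map_one]
  summable σ hσ := by
    rw [LSeriesSummable_ofReal_iff]
    refine Summable.of_nonneg_of_le (fun n => ?_) (fun n => ?_) (h.abs_conv σ hσ)
    · split_ifs <;> positivity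
    · split_ifs
      · positivity
      · exact le_rfl
  rec_le n hn := by
    have h1 : ‖f n‖ * Real.log n = ‖f n * (Real.log n : ℂ)‖ := by
      rw [norm_mul, norm_real, Real.norm_of_nonneg (Real.log_natCast_nonneg n)]
    rw [h1, h.conv n hn, Finset.mul_sum]
    refine (norm_sum_le _ _).trans (Finset.sum_le_sum fun d hd => ?_)
    rw [norm_mul, ← mul_assoc]
    gcongr
    exact h.bound d (Nat.pos_of_mem_divisors hd)

end Trivial

section Convolution

open Finset ArithmeticFunction Chebyshev

theorem sum_Icc_one_sub {M : Type*} [AddCommGroup M] (g : ℕ → M) {m n : ℕ} (h : m ≤ n) :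
    ∑ k ∈ Icc 1 n, g k - ∑ k ∈ Icc 1 m, g k = ∑ k ∈ Ioc m n, g k := by
  have h1 : ∀ N : ℕ, Icc 1 N = Ioc 0 N := fun N => by ext k; simp; omega
  rw [h1, h1, sub_eq_iff_eq_add', ← Finset.sum_Ioc_consecutive g (Nat.zero_le m) h]

theorem sum_weighted_blocks_le {a : ℕ → ℝ} (ha : ∀ n, 0 ≤ a n) {y : ℝ} (hy : 1 ≤ y) (J : ℕ) :
    ∑ j ∈ range J, (∑ n ∈ Icc 1 ⌊y / Real.exp √(j + 1)⌋₊, a n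
        - ∑ n ∈ Icc 1 ⌊y / Real.exp √(j + 2)⌋₊, a n) * (Real.exp √(j + 1) / √(j + 1)) ≤
      3 * y * ∑ n ∈ Icc 1 ⌊y⌋₊, a n / (n * (1 + Real.log (y / n))) := by
  set b : ℕ → ℝ := fun n => a n / (n * (1 + Real.log (y / n))) with hb
  have hb0 : ∀ n ∈ Icc 1 ⌊y⌋₊, 0 ≤ b n := fun n hn => by
    obtain ⟨h1, h2⟩ := Finset.mem_Icc.1 hn
    have h2' : (n:ℝ) ≤ y := (Nat.le_floor_iff (by linarith)).1 h2
    have h1' : (0:ℝ) < n := by exact_mod_cast h1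
    have : 0 ≤ Real.log (y / n) := Real.log_nonneg ((one_le_div h1').2 h2')
    have := ha n
    positivity
  have hfl : ∀ s t : ℝ, 0 ≤ s → s ≤ t → ⌊y / Real.exp t⌋₊ ≤ ⌊y / Real.exp s⌋₊ := by
    intro s t _ hst; gcongr
  have hfl1 : ∀ s : ℝ, 0 ≤ s → ⌊y / Real.exp s⌋₊ ≤ ⌊y⌋₊ := by
    intro s hs
    exact Nat.floor_le_floor (div_le_self (by linarith) (Real.one_le_exp hs))
  set B : ℕ → ℝ := fun j => ∑ n ∈ Icc 1 ⌊y / Real.exp √(j + 1)⌋₊, b n with hB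
  have key : ∀ j ∈ range J, (∑ n ∈ Icc 1 ⌊y / Real.exp √(j + 1)⌋₊, a n
        - ∑ n ∈ Icc 1 ⌊y / Real.exp √(j + 2)⌋₊, a n) * (Real.exp √(j + 1) / √(j + 1)) ≤
        3 * y * (B j - B (j + 1)) := by
    intro j _
    have hs : √((j:ℝ) + 1) ≤ √((j:ℝ) + 2) := Real.sqrt_le_sqrt (by linarith)
    have hle := hfl √((j:ℝ) + 1) √((j:ℝ) + 2) (by positivity) hs
    have e2 : ((j + 1 : ℕ) : ℝ) + 1 = j + 2 := by push_cast; ring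
    simp only [hB, e2]
    rw [sum_Icc_one_sub _ hle, sum_Icc_one_sub _ hle, Finset.sum_mul, Finset.mul_sum]
    refine Finset.sum_le_sum fun n hn => ?_
    obtain ⟨h1, h2⟩ := Finset.mem_Ioc.1 hn
    have hn0 : 0 < n := by omega
    have hn0' : (0:ℝ) < n := by exact_mod_cast hn0
    have h1' : y / Real.exp √((j:ℝ) + 2) < n := (Nat.floor_lt (by positivity)).1 h1
    have h2' : (n:ℝ) ≤ y / Real.exp √((j:ℝ) + 1) := (Nat.le_floor_iff (by positivity)).1 h2
    rw [div_lt_iff₀ (Real.exp_pos _)] at h1'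
    rw [le_div_iff₀ (Real.exp_pos _)] at h2'
    set r := √((j:ℝ) + 1) with hr
    have hr1 : 1 ≤ r := Real.one_le_sqrt.2 (by linarith [(Nat.cast_nonneg j : (0:ℝ) ≤ j)])
    have hrr : √((j:ℝ) + 2) ≤ 2 * r := by
      rw [Real.sqrt_le_left (by positivity), mul_pow, hr, Real.sq_sqrt (by positivity)]
      linarith [(Nat.cast_nonneg j : (0:ℝ) ≤ j)]
    have hlog : Real.log (y / n) ≤ 2 * r := by
      refine le_trans ?_ hrr
      rw [← Real.log_exp √((j:ℝ) + 2)]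
      refine Real.log_le_log (by positivity) ?_
      rw [div_le_iff₀ hn0', mul_comm]; exact h1'.le
    have hlog0 : 0 ≤ Real.log (y / n) := by
      refine Real.log_nonneg ((one_le_div hn0').2 ?_)
      have := Real.one_le_exp (by linarith : 0 ≤ r)
      nlinarith
    simp only [hb]
    rw [← mul_div_assoc, ← mul_div_assoc, div_le_div_iff₀ (by linarith) (by positivity)]
    have hA := ha n
    calc a n * Real.exp r * (n * (1 + Real.log (y / n)))
        = a n * (n * Real.exp r) * (1 + Real.log (y / n)) := by ring
      _ ≤ a n * y * (3 * r) := by gcongr; linarith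
      _ = 3 * y * a n * r := by ring
  refine (Finset.sum_le_sum key).trans ?_
  rw [← Finset.mul_sum, Finset.sum_range_sub']
  gcongr
  have h0 : B 0 ≤ ∑ n ∈ Icc 1 ⌊y⌋₊, b n :=
    Finset.sum_le_sum_of_subset_of_nonneg
      (Finset.Icc_subset_Icc_right (hfl1 _ (by positivity))) fun n hn _ => hb0 n hn
  have hJ : 0 ≤ B J := Finset.sum_nonneg fun n hn => hb0 n
    (Finset.Icc_subset_Icc_right (hfl1 _ (by positivity)) hn)
  linarith

theorem exists_sum_div_log_le {κ : ℝ} (hκ : 0 ≤ κ) : ∃ K : ℝ, 0 < K ∧ ∀ a : ℕ → ℝ,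
    IsDominated κ a → ∀ y : ℝ, 1 ≤ y →
    ∑ n ∈ Icc 1 ⌊y⌋₊, a n / (n * (1 + Real.log (y / n))) ≤
      K * (1 + Real.log y) ^ (κ - 1) * (1 + Real.log (1 + Real.log y)) := by
  obtain ⟨K, hK, hS⟩ := exists_sum_mul_sqrt_le hκ
  set c : ℝ := max 1 (2 ^ (1 - κ)) with hc
  have hc1 : 1 ≤ c := le_max_left _ _
  refine ⟨2 * (Real.exp 1 * 2 ^ κ) + Real.exp 1 * K * c, by positivity, fun a ha y hy => ?_⟩
  set Y := 1 + Real.log y with hY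
  have hl0 : 0 ≤ Real.log y := Real.log_nonneg hy
  have hY1 : 1 ≤ Y := by linarith
  have hlY : 0 ≤ Real.log Y := Real.log_nonneg hY1
  set N := ⌊Real.log y / 2⌋₊ with hN
  have hNle : (N:ℝ) ≤ Real.log y / 2 := Nat.floor_le (by positivity)
  have hpt : ∀ n ∈ Icc 1 ⌊y⌋₊, a n / (n * (1 + Real.log (y / n))) ≤ (2 / Y) * (a n / n) +
      ∑ k ∈ range (N + 1), (Real.exp (k + 1) / (y * (k + 1))) *
        (if n ∈ Icc 1 ⌊y / Real.exp k⌋₊ then a n else 0) := by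
    intro n hn
    obtain ⟨h1, h2⟩ := Finset.mem_Icc.1 hn
    have h2' : (n:ℝ) ≤ y := (Nat.le_floor_iff (by linarith)).1 h2
    have h1' : (0:ℝ) < n := by exact_mod_cast h1
    have hl : 0 ≤ Real.log (y / n) := Real.log_nonneg ((one_le_div h1').2 h2')
    have hA := ha.nonneg n
    have hsum0 : ∀ k ∈ range (N + 1), 0 ≤ (Real.exp (k + 1) / (y * (k + 1))) *
        (if n ∈ Icc 1 ⌊y / Real.exp k⌋₊ then a n else 0) := by
      intro k _
      have : 0 < y := by linarith
      split_ifs <;> positivity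
    by_cases hk : Real.log y / 2 ≤ Real.log (y / n)
    · refine le_add_of_le_of_nonneg ?_ (Finset.sum_nonneg hsum0)
      rw [div_mul_div_comm, div_le_div_iff₀ (by positivity) (by positivity)]
      calc a n * (Y * n) ≤ a n * ((2 * (1 + Real.log (y / n))) * n) := by gcongr; linarith
        _ = _ := by ring
    · push Not at hk
      set k := ⌊Real.log (y / n)⌋₊ with hkdef
      have hk1 : (k:ℝ) ≤ Real.log (y / n) := Nat.floor_le hl
      have hk2 : Real.log (y / n) < k + 1 := Nat.lt_floor_add_one _
      have hkN : k ∈ range (N + 1) := by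
        rw [Finset.mem_range, Nat.lt_succ_iff]; exact Nat.floor_le_floor hk.le
      have hy0 : 0 < y := by linarith
      refine le_add_of_nonneg_of_le (by positivity) ?_
      refine le_trans ?_ (Finset.single_le_sum hsum0 hkN)
      have hmem : n ∈ Icc 1 ⌊y / Real.exp k⌋₊ := by
        refine Finset.mem_Icc.2 ⟨h1, (Nat.le_floor_iff (by positivity)).2 ?_⟩
        rw [le_div_iff₀ (Real.exp_pos _), mul_comm, ← le_div_iff₀ h1']
        exact (Real.le_log_iff_exp_le (by positivity)).1 hk1
      rw [if_pos hmem, div_mul_eq_mul_div, div_le_div_iff₀ (by positivity) (by positivity)]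
      have hyn : y ≤ Real.exp (k + 1) * n := by
        rw [← div_le_iff₀ h1']
        exact ((Real.log_lt_iff_lt_exp (by positivity)).1 hk2).le
      calc a n * (y * (k + 1)) ≤ a n * ((Real.exp (k + 1) * n) * (Real.log (y / n) + 1)) := by
            gcongr
        _ = _ := by ring
  refine (Finset.sum_le_sum hpt).trans ?_
  rw [Finset.sum_add_distrib, ← Finset.mul_sum, Finset.sum_comm]
  have hfirst : (2 / Y) * ∑ n ∈ Icc 1 ⌊y⌋₊, a n / n ≤
      2 * (Real.exp 1 * 2 ^ κ) * Y ^ (κ - 1) := by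
    refine (mul_le_mul_of_nonneg_left (ha.sum_div_le hκ hy) (by positivity)).trans (le_of_eq ?_)
    rw [Real.rpow_sub_one (by positivity)]
    ring
  have hsecond : ∑ k ∈ range (N + 1), ∑ n ∈ Icc 1 ⌊y⌋₊, (Real.exp (k + 1) / (y * (k + 1))) *
        (if n ∈ Icc 1 ⌊y / Real.exp k⌋₊ then a n else 0) ≤
      Real.exp 1 * K * c * Y ^ (κ - 1) * (1 + Real.log Y) := by
    have hterm : ∀ k ∈ range (N + 1), ∑ n ∈ Icc 1 ⌊y⌋₊, (Real.exp (k + 1) / (y * (k + 1))) *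
        (if n ∈ Icc 1 ⌊y / Real.exp k⌋₊ then a n else 0) ≤
        Real.exp 1 * K * c * Y ^ (κ - 1) * ((k:ℝ) + 1)⁻¹ := by
      intro k hk
      have hkN : (k:ℝ) ≤ N := by exact_mod_cast Nat.lt_succ_iff.1 (Finset.mem_range.1 hk)
      have hy0 : 0 < y := by linarith
      have hyk : 1 ≤ y / Real.exp k := by
        rw [one_le_div (Real.exp_pos _), ← Real.le_log_iff_exp_le hy0]; linarith
      have hlk : Real.log (y / Real.exp k) = Real.log y - k := by
        rw [Real.log_div hy0.ne' (Real.exp_pos _).ne', Real.log_exp]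
      rw [← Finset.mul_sum, ← Finset.sum_filter]
      have hA : ∑ n ∈ (Icc 1 ⌊y⌋₊) with n ∈ Icc 1 ⌊y / Real.exp k⌋₊, a n ≤
          K * (y / Real.exp k) * (c * Y ^ (κ - 1)) := by
        calc _ ≤ ∑ n ∈ Icc 1 ⌊y / Real.exp k⌋₊, a n :=
              Finset.sum_le_sum_of_subset_of_nonneg (fun n hn => (Finset.mem_filter.1 hn).2)
                fun n _ _ => ha.nonneg n
          _ ≤ ∑ n ∈ Icc 1 ⌊y / Real.exp k⌋₊, a n * √(y / Real.exp k / n) := by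
              refine Finset.sum_le_sum fun n hn => le_mul_of_one_le_right (ha.nonneg n) ?_
              obtain ⟨h1, h2⟩ := Finset.mem_Icc.1 hn
              have h1' : (0:ℝ) < n := by exact_mod_cast h1
              exact Real.one_le_sqrt.2 ((one_le_div h1').2
                ((Nat.le_floor_iff (by positivity)).1 h2))
          _ ≤ K * (y / Real.exp k) * (1 + Real.log (y / Real.exp k)) ^ (κ - 1) := hS a ha _ hyk
          _ ≤ K * (y / Real.exp k) * (c * Y ^ (κ - 1)) := by
              gcongr
              rw [hlk]
              have hpos : Y / 2 ≤ 1 + (Real.log y - k) := by linarith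
              rcases le_or_gt 1 κ with h | h
              · calc (1 + (Real.log y - k)) ^ (κ - 1) ≤ Y ^ (κ - 1) := by
                      refine Real.rpow_le_rpow (by linarith) ?_ (by linarith)
                      linarith [(Nat.cast_nonneg k : (0:ℝ) ≤ k)]
                  _ ≤ c * Y ^ (κ - 1) := le_mul_of_one_le_left (by positivity) hc1
              · calc (1 + (Real.log y - k)) ^ (κ - 1) ≤ (Y / 2) ^ (κ - 1) :=
                      Real.rpow_le_rpow_of_nonpos (by positivity) hpos (by linarith)
                  _ = 2 ^ (1 - κ) * Y ^ (κ - 1) := by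
                      rw [Real.div_rpow (by positivity) (by norm_num),
                        show 1 - κ = -(κ - 1) by ring, Real.rpow_neg (by norm_num)]
                      ring
                  _ ≤ c * Y ^ (κ - 1) := by gcongr; exact le_max_right _ _
      refine (mul_le_mul_of_nonneg_left hA (by positivity)).trans (le_of_eq ?_)
      rw [Real.exp_add]
      field_simp
    refine (Finset.sum_le_sum hterm).trans ?_
    rw [← Finset.mul_sum]
    gcongr
    have h := harmonic_le_one_add_log (N + 1)
    have e : ((harmonic (N + 1) : ℚ) : ℝ) = ∑ k ∈ range (N + 1), ((k:ℝ) + 1)⁻¹ := by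
      simp [harmonic]
    rw [← e]
    refine h.trans ?_
    gcongr
    push_cast; linarith
  have : Y ^ (κ - 1) ≤ Y ^ (κ - 1) * (1 + Real.log Y) :=
    le_mul_of_one_le_right (by positivity) (by linarith)
  calc _ ≤ _ := add_le_add hfirst hsecond
    _ ≤ 2 * (Real.exp 1 * 2 ^ κ) * (Y ^ (κ - 1) * (1 + Real.log Y)) +
      Real.exp 1 * K * c * Y ^ (κ - 1) * (1 + Real.log Y) := by gcongr
    _ = _ := by ring

end Convolution

section Convolution

open Finset ArithmeticFunction Chebyshev

theorem rpow_le_rpow_abs_mul {y z c p : ℝ} (hy : 0 < y) (hc : 1 ≤ c) (h1 : y ≤ c * z)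
    (h2 : z ≤ c * y) : z ^ p ≤ c ^ |p| * y ^ p := by
  have hz : 0 < z := by
    by_contra h; push Not at h; nlinarith
  rcases le_or_gt 0 p with h | h
  · rw [abs_of_nonneg h, ← Real.mul_rpow (by linarith) hy.le]
    exact Real.rpow_le_rpow hz.le h2 h
  · rw [abs_of_neg h, Real.rpow_neg (by linarith), ← div_eq_inv_mul,
      ← Real.div_rpow hy.le (by linarith)]
    refine Real.rpow_le_rpow_of_nonpos (by positivity) ?_ h.le
    rw [div_le_iff₀ (by linarith)]; linarith

theorem exists_sum_le {κ : ℝ} (hκ : 0 ≤ κ) : ∃ K : ℝ, 0 < K ∧ ∀ a : ℕ → ℝ, IsDominated κ a →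
    ∀ u : ℝ, 1 ≤ u → ∑ n ∈ Icc 1 ⌊u⌋₊, a n ≤ K * u * (1 + Real.log u) ^ (κ - 1) := by
  obtain ⟨K, hK, hS⟩ := exists_sum_mul_sqrt_le hκ
  refine ⟨K, hK, fun a ha u hu => le_trans ?_ (hS a ha u hu)⟩
  refine Finset.sum_le_sum fun n hn => le_mul_of_one_le_right (ha.nonneg n) ?_
  obtain ⟨h1, h2⟩ := Finset.mem_Icc.1 hn
  have h1' : (0:ℝ) < n := by exact_mod_cast h1
  exact Real.one_le_sqrt.2 ((one_le_div h1').2 ((Nat.le_floor_iff (by linarith)).1 h2))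

/-- The summatory function of `f`. -/
def summatory {M : Type*} [AddCommMonoid M] (f : ℕ → M) (u : ℝ) : M := ∑ n ∈ Icc 1 ⌊u⌋₊, f n

theorem measurable_summatory {M : Type*} [AddCommMonoid M] [MeasurableSpace M] (f : ℕ → M) :
    Measurable (summatory f) :=
  (measurable_from_nat (f := fun N => ∑ n ∈ Icc 1 N, f n)).comp Nat.measurable_floor

theorem summatory_of_lt_one {M : Type*} [AddCommMonoid M] (f : ℕ → M) {u : ℝ} (hu : u < 1) :
    summatory f u = 0 := by
  simp [summatory, Nat.floor_eq_zero.2 hu]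

theorem summatory_mono {a : ℕ → ℝ} (ha : ∀ n, 0 ≤ a n) : Monotone (summatory a) := by
  intro u v huv
  exact Finset.sum_le_sum_of_subset_of_nonneg
    (Finset.Icc_subset_Icc_right (Nat.floor_le_floor huv)) fun n _ _ => ha n

theorem summatory_nonneg {a : ℕ → ℝ} (ha : ∀ n, 0 ≤ a n) (u : ℝ) : 0 ≤ summatory a u :=
  Finset.sum_nonneg fun n _ => ha n

theorem norm_summatory_le (f : ℕ → ℂ) (u : ℝ) :
    ‖summatory f u‖ ≤ summatory (fun n => ‖f n‖) u := norm_sum_le _ _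

theorem norm_summatory_sub_le (f : ℕ → ℂ) {a b u v : ℝ} (hu : u ∈ Set.Icc a b)
    (hv : v ∈ Set.Icc a b) : ‖summatory f u - summatory f v‖ ≤
      summatory (fun n => ‖f n‖) b - summatory (fun n => ‖f n‖) a := by
  wlog h : v ≤ u generalizing u v
  · rw [norm_sub_rev]; exact this hv hu (le_of_not_ge h)
  have hm := summatory_mono (a := fun n => ‖f n‖) (fun n => norm_nonneg _)
  calc ‖summatory f u - summatory f v‖
      ≤ summatory (fun n => ‖f n‖) u - summatory (fun n => ‖f n‖) v := by
        simp only [summatory]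
        rw [sum_Icc_one_sub _ (Nat.floor_le_floor h), sum_Icc_one_sub _ (Nat.floor_le_floor h)]
        exact norm_sum_le _ _
    _ ≤ _ := sub_le_sub (hm hu.2) (hm hv.1)

/-- The twisted increment of the summatory function between `u / w` and `u`. -/
def incr (f : ℕ → ℂ) (c : ℂ) (w u : ℝ) : ℂ := summatory f u - c * summatory f (u / w)

theorem measurable_incr (f : ℕ → ℂ) (c : ℂ) (w : ℝ) : Measurable (incr f c w) :=
  (measurable_summatory f).sub
    (((measurable_summatory f).comp (measurable_id.div_const w)).const_mul c)

theorem norm_incr_le (f : ℕ → ℂ) {c : ℂ} {w u x : ℝ} (hw : 1 ≤ w) (hc : ‖c‖ = w) (hux : u ≤ x) :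
    ‖incr f c w u‖ ≤
      summatory (fun n => ‖f n‖) x + w * summatory (fun n => ‖f n‖) (x / w) := by
  have hm := summatory_mono (a := fun n => ‖f n‖) (fun n => norm_nonneg _)
  refine (norm_sub_le _ _).trans (add_le_add ((norm_summatory_le f u).trans (hm hux)) ?_)
  rw [norm_mul, hc]
  gcongr
  exact (norm_summatory_le f _).trans (hm (by gcongr))

theorem incr_of_lt_one (f : ℕ → ℂ) (c : ℂ) {w u : ℝ} (hw : 1 ≤ w) (hu : u < 1) :
    incr f c w u = 0 := by
  have : u / w < 1 := by rw [div_lt_one (by linarith)]; linarith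
  simp [incr, summatory_of_lt_one _ hu, summatory_of_lt_one _ this]

theorem norm_incr_sub_le (f : ℕ → ℂ) {c : ℂ} {w a b u v : ℝ} (hw : 1 ≤ w) (hc : ‖c‖ = w)
    (hu : u ∈ Set.Icc a b) (hv : v ∈ Set.Icc a b) : ‖incr f c w u - incr f c w v‖ ≤
      (summatory (fun n => ‖f n‖) b - summatory (fun n => ‖f n‖) a) +
      w * (summatory (fun n => ‖f n‖) (b / w) - summatory (fun n => ‖f n‖) (a / w)) := by
  have e : incr f c w u - incr f c w v = (summatory f u - summatory f v) -
      c * (summatory f (u / w) - summatory f (v / w)) := by simp only [incr]; ring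
  rw [e]
  refine (norm_sub_le _ _).trans (add_le_add (norm_summatory_sub_le f hu hv) ?_)
  rw [norm_mul, hc]
  have hw0 : 0 < w := by linarith
  gcongr
  refine norm_summatory_sub_le f ⟨?_, ?_⟩ ⟨?_, ?_⟩
  exacts [div_le_div_of_nonneg_right hu.1 hw0.le, div_le_div_of_nonneg_right hu.2 hw0.le,
    div_le_div_of_nonneg_right hv.1 hw0.le, div_le_div_of_nonneg_right hv.2 hw0.le]

theorem intervalIntegrable_exp_mul_incr (f : ℕ → ℂ) {c : ℂ} {w x : ℝ} (hw : 1 ≤ w) (hc : ‖c‖ = w)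
    (hx : 0 ≤ x) (a b : ℝ) :
    IntervalIntegrable (fun v => Real.exp v * ‖incr f c w (x * Real.exp (-v))‖) volume a b := by
  rw [intervalIntegrable_iff]
  refine Measure.integrableOn_of_bounded (M := Real.exp (max a b) *
    (summatory (fun n => ‖f n‖) (x * Real.exp (-(min a b))) +
      w * summatory (fun n => ‖f n‖) (x * Real.exp (-(min a b)) / w)))
    (by simp [Set.uIoc]) ?_ ?_
  · refine Measurable.aestronglyMeasurable ?_
    exact Real.measurable_exp.mul
      ((measurable_incr f c w).comp (by fun_prop)).norm
  · refine (ae_restrict_iff' measurableSet_uIoc).2 (ae_of_all _ fun v hv => ?_)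
    rw [Real.norm_of_nonneg (by positivity)]
    have h1 : v ≤ max a b := hv.2
    have h2 : min a b ≤ v := hv.1.le
    gcongr
    exact norm_incr_le f hw hc (by gcongr)

theorem integral_exp_mul_incr_le (f : ℕ → ℂ) {c : ℂ} {w x : ℝ} (hw : 1 ≤ w) (hc : ‖c‖ = w)
    (hx : 1 ≤ x) (b : ℝ) :
    ∫ v in (0:ℝ)..b, Real.exp v * ‖incr f c w (x * Real.exp (-v))‖ ≤
      x * ∫ v in (0:ℝ)..Real.log x, Real.exp (-v) * ‖incr f c w (Real.exp v)‖ := by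
  have hx0 : 0 < x := by linarith
  have hL : 0 ≤ Real.log x := Real.log_nonneg hx
  have hint := intervalIntegrable_exp_mul_incr f hw hc hx0.le
  have e1 : x * ∫ v in (0:ℝ)..Real.log x, Real.exp (-v) * ‖incr f c w (Real.exp v)‖ =
      ∫ v in (0:ℝ)..Real.log x, Real.exp v * ‖incr f c w (x * Real.exp (-v))‖ := by
    have := intervalIntegral.integral_comp_sub_left (a := 0) (b := Real.log x)
      (fun v => Real.exp v * ‖incr f c w (x * Real.exp (-v))‖) (Real.log x)
    rw [sub_self, sub_zero] at this
    rw [← this, ← intervalIntegral.integral_const_mul]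
    refine intervalIntegral.integral_congr fun v _ => ?_
    rw [Real.exp_sub, Real.exp_log hx0, neg_sub, Real.exp_sub, Real.exp_log hx0, Real.exp_neg,
      mul_div_cancel₀ _ hx0.ne']
    ring
  rw [e1, ← intervalIntegral.integral_add_adjacent_intervals (hint 0 (Real.log x))
    (hint (Real.log x) b)]
  rw [add_le_iff_nonpos_right]
  rcases le_total b (Real.log x) with h | h
  · rw [intervalIntegral.integral_symm, neg_nonpos]
    exact intervalIntegral.integral_nonneg h fun v _ => by positivity
  · refine le_of_eq ?_
    refine intervalIntegral.integral_zero_ae (ae_of_all _ fun v hv => ?_)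
    rw [Set.uIoc_of_le h] at hv
    rw [incr_of_lt_one f c hw, norm_zero, mul_zero]
    rw [Real.exp_neg, ← div_eq_mul_inv, div_lt_one (Real.exp_pos _)]
    exact (Real.log_lt_iff_lt_exp hx0).1 hv.1

theorem sum_block_le {M : ℝ} (f : ℕ → ℂ) {c : ℂ} {w x : ℝ} (hw : 1 ≤ w) (hc : ‖c‖ = w)
    (hx : 0 < x) {s t : ℝ} (hst : s < t)
    (hM : psi (Real.exp t) - psi (Real.exp s) ≤ M) :
    ∑ d ∈ Ioc ⌊Real.exp s⌋₊ ⌊Real.exp t⌋₊, Λ d * ‖incr f c w (x / d)‖ ≤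
      M * ((summatory (fun n => ‖f n‖) (x / Real.exp s) -
              summatory (fun n => ‖f n‖) (x / Real.exp t)) +
        w * (summatory (fun n => ‖f n‖) (x / w / Real.exp s) -
              summatory (fun n => ‖f n‖) (x / w / Real.exp t)) +
        (∫ v in s..t, Real.exp v * ‖incr f c w (x * Real.exp (-v))‖) /
          (Real.exp s * (t - s))) := by
  set V' := (summatory (fun n => ‖f n‖) (x / Real.exp s) -
              summatory (fun n => ‖f n‖) (x / Real.exp t)) +
        w * (summatory (fun n => ‖f n‖) (x / w / Real.exp s) -
              summatory (fun n => ‖f n‖) (x / w / Real.exp t)) with hV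
  set J := ∫ v in s..t, Real.exp v * ‖incr f c w (x * Real.exp (-v))‖ with hJ
  have hJ0 : 0 ≤ J := intervalIntegral.integral_nonneg hst.le fun v _ => by positivity
  have hts : 0 < t - s := by linarith
  have hV0 : 0 ≤ V' := by
    have hm := summatory_mono (a := fun n => ‖f n‖) (fun n => norm_nonneg _)
    have h1 := hm (show x / Real.exp t ≤ x / Real.exp s by gcongr)
    have h2 := hm (show x / w / Real.exp t ≤ x / w / Real.exp s by gcongr)
    have : 0 ≤ w * (summatory (fun n => ‖f n‖) (x / w / Real.exp s) -
              summatory (fun n => ‖f n‖) (x / w / Real.exp t)) :=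
      mul_nonneg (by linarith) (by linarith)
    linarith
  have hfl : ⌊Real.exp s⌋₊ ≤ ⌊Real.exp t⌋₊ := by gcongr
  have hpt : ∀ d ∈ Ioc ⌊Real.exp s⌋₊ ⌊Real.exp t⌋₊,
      ‖incr f c w (x / d)‖ ≤ V' + J / (Real.exp s * (t - s)) := by
    intro d hd
    obtain ⟨h1, h2⟩ := Finset.mem_Ioc.1 hd
    have h1' : Real.exp s < d := (Nat.floor_lt (Real.exp_pos _).le).1 h1
    have h2' : (d:ℝ) ≤ Real.exp t := (Nat.le_floor_iff (Real.exp_pos _).le).1 h2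
    have hd0 : (0:ℝ) < d := (Real.exp_pos s).trans h1'
    have hlow : ∀ v ∈ Set.Icc s t, Real.exp s * (‖incr f c w (x / d)‖ - V') ≤
        Real.exp v * ‖incr f c w (x * Real.exp (-v))‖ := by
      intro v hv
      have hmem1 : x / d ∈ Set.Icc (x / Real.exp t) (x / Real.exp s) :=
        ⟨by gcongr, by gcongr⟩
      have hmem2 : x * Real.exp (-v) ∈ Set.Icc (x / Real.exp t) (x / Real.exp s) := by
        rw [Real.exp_neg, ← div_eq_mul_inv]
        have := hv.1
        have := hv.2
        exact ⟨by gcongr, by gcongr⟩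
      have h := norm_incr_sub_le f hw hc hmem1 hmem2
      rw [div_right_comm x _ w, div_right_comm x _ w, ← hV] at h
      have h' : ‖incr f c w (x / d)‖ - V' ≤ ‖incr f c w (x * Real.exp (-v))‖ := by
        linarith [norm_sub_norm_le (incr f c w (x / d)) (incr f c w (x * Real.exp (-v)))]
      calc Real.exp s * (‖incr f c w (x / d)‖ - V')
          ≤ Real.exp s * ‖incr f c w (x * Real.exp (-v))‖ := by gcongr
        _ ≤ _ := by gcongr; exact hv.1
    have hI : (Real.exp s * (‖incr f c w (x / d)‖ - V')) * (t - s) ≤ J := by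
      have := intervalIntegral.integral_mono_on (μ := volume) hst.le
        (intervalIntegrable_const (c := Real.exp s * (‖incr f c w (x / d)‖ - V')))
        (intervalIntegrable_exp_mul_incr f hw hc hx.le s t) hlow
      rw [intervalIntegral.integral_const, smul_eq_mul, mul_comm] at this
      exact this
    have hp : 0 < Real.exp s * (t - s) := by positivity
    have : ‖incr f c w (x / d)‖ - V' ≤ J / (Real.exp s * (t - s)) := by
      rw [le_div_iff₀ hp]; linarith
    linarith
  calc _ ≤ ∑ d ∈ Ioc ⌊Real.exp s⌋₊ ⌊Real.exp t⌋₊, Λ d * (V' + J / (Real.exp s * (t - s))) :=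
        Finset.sum_le_sum fun d hd => mul_le_mul_of_nonneg_left (hpt d hd) vonMangoldt_nonneg
    _ = (psi (Real.exp t) - psi (Real.exp s)) * (V' + J / (Real.exp s * (t - s))) := by
        rw [← Finset.sum_mul, ← sum_Icc_one_sub _ hfl, psi_eq_sum_Icc_one, psi_eq_sum_Icc_one]
    _ ≤ _ := by
        gcongr

set_option maxHeartbeats 1000000 in
theorem exists_sum_vonMangoldt_mul_incr_le {κ : ℝ} (hκ : 0 ≤ κ) : ∃ C : ℝ, 0 < C ∧
    ∀ f : ℕ → ℂ, IsDominated κ (fun n => ‖f n‖) → ∀ x w : ℝ, 1 ≤ w → w ^ 2 ≤ x →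
    ∀ c : ℂ, ‖c‖ = w →
    ∑ d ∈ Icc 1 ⌊x⌋₊, Λ d * ‖incr f c w (x / d)‖ ≤
      C * x * ((∫ v in (0:ℝ)..Real.log x, Real.exp (-v) * ‖incr f c w (Real.exp v)‖) +
        (1 + Real.log x) ^ (κ - 1) * (1 + Real.log (1 + Real.log x))) := by
  obtain ⟨C₁, hC₁, hψ⟩ := exists_psi_sub_psi_le
  obtain ⟨K₁, hK₁, hT⟩ := exists_sum_div_log_le hκ
  obtain ⟨K₂, hK₂, hA⟩ := exists_sum_le hκ
  set q : ℝ := 1 + 2 ^ |κ - 1| with hq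
  refine ⟨psi (Real.exp 1) * K₂ * q + C₁ * (3 * K₁ * q) + 4 * C₁, ?_,
    fun f hf x w hw hwx c hc => ?_⟩
  · have := psi_nonneg (Real.exp 1); positivity
  have hx1 : 1 ≤ x := by nlinarith
  have hx0 : 0 < x := by linarith
  have hw0 : 0 < w := by linarith
  set L := Real.log x with hL
  have hL0 : 0 ≤ L := Real.log_nonneg hx1
  set a : ℕ → ℝ := fun n => ‖f n‖ with ha
  set I := ∫ v in (0:ℝ)..L, Real.exp (-v) * ‖incr f c w (Real.exp v)‖ with hI
  have hI0 : 0 ≤ I := intervalIntegral.integral_nonneg hL0 fun v _ => by positivity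
  set R := (1 + L) ^ (κ - 1) with hR
  have hR0 : 0 < R := by positivity
  set ℓ := 1 + Real.log (1 + L) with hℓ
  have hℓ1 : 1 ≤ ℓ := by have := Real.log_nonneg (show 1 ≤ 1 + L by linarith); linarith
  have hxw : 1 ≤ x / w := by rw [one_le_div hw0]; nlinarith
  have hlogxw : Real.log (x / w) = L - Real.log w := Real.log_div hx0.ne' hw0.ne'
  have hlw0 : 0 ≤ Real.log w := Real.log_nonneg hw
  have hlw : 2 * Real.log w ≤ L := by
    have := Real.log_le_log (by positivity) hwx
    rwa [Real.log_pow] at this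
  have hRw : (1 + Real.log (x / w)) ^ (κ - 1) ≤ 2 ^ |κ - 1| * R :=
    rpow_le_rpow_abs_mul (by linarith) (by norm_num) (by linarith) (by linarith)
  have hℓw : 1 + Real.log (1 + Real.log (x / w)) ≤ ℓ := by
    have : 0 ≤ Real.log (x / w) := Real.log_nonneg hxw
    have := Real.log_le_log (by linarith : 0 < 1 + Real.log (x / w))
      (by linarith : 1 + Real.log (x / w) ≤ 1 + L)
    linarith
  set J := ⌈L ^ 2⌉₊ with hJ
  set G : ℕ → ℝ := fun d => Λ d * ‖incr f c w (x / d)‖ with hG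
  have hG0 : ∀ d, 0 ≤ G d := fun d => mul_nonneg vonMangoldt_nonneg (norm_nonneg _)
  set T : ℕ → ℝ := fun j => ∑ d ∈ Icc 1 ⌊Real.exp √((j:ℝ) + 1)⌋₊, G d with hTdef
  have hstart : T 0 ≤ psi (Real.exp 1) * K₂ * q * (x * R) := by
    have hb : ∀ d : ℕ, 1 ≤ d → ‖incr f c w (x / d)‖ ≤ K₂ * q * (x * R) := by
      intro d hd
      have hd' : (1:ℝ) ≤ d := by exact_mod_cast hd
      refine (norm_incr_le f hw hc (div_le_self hx0.le hd')).trans ?_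
      calc _ ≤ K₂ * x * R + w * (K₂ * (x / w) * (2 ^ |κ - 1| * R)) := by
            refine add_le_add (hA a hf x hx1) ?_
            gcongr
            refine (hA a hf _ hxw).trans ?_
            gcongr
        _ = K₂ * q * (x * R) := by rw [hq]; field_simp
    simp only [hTdef, Nat.cast_zero, zero_add, Real.sqrt_one]
    rw [psi_eq_sum_Icc_one, Finset.sum_mul, Finset.sum_mul, Finset.sum_mul]
    refine Finset.sum_le_sum fun d hd => ?_
    calc G d ≤ Λ d * (K₂ * q * (x * R)) :=
          mul_le_mul_of_nonneg_left (hb d (Finset.mem_Icc.1 hd).1) vonMangoldt_nonneg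
      _ = _ := by ring
  have hend : ∑ d ∈ Icc 1 ⌊x⌋₊, G d ≤ T J := by
    refine Finset.sum_le_sum_of_subset_of_nonneg (Finset.Icc_subset_Icc_right ?_)
      fun n _ _ => hG0 n
    refine Nat.floor_le_floor ?_
    rw [← Real.log_le_iff_le_exp hx0]
    refine Real.le_sqrt_of_sq_le ?_
    have := Nat.le_ceil (L ^ 2)
    linarith
  set D : ℝ → ℕ → ℝ := fun y j =>
    summatory a (y / Real.exp √((j:ℝ) + 1)) - summatory a (y / Real.exp √((j:ℝ) + 2)) with hD
  set Φ : ℝ → ℝ := fun v => Real.exp v * ‖incr f c w (x * Real.exp (-v))‖ with hΦ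
  have hint := intervalIntegrable_exp_mul_incr f hw hc hx0.le
  have hblock : ∀ j ∈ range J, T (j + 1) - T j ≤
      C₁ * (D x j * (Real.exp √((j:ℝ) + 1) / √((j:ℝ) + 1))) +
      C₁ * w * (D (x / w) j * (Real.exp √((j:ℝ) + 1) / √((j:ℝ) + 1))) +
      4 * C₁ * ∫ v in √((j:ℝ) + 1)..√(((j + 1 : ℕ):ℝ) + 1), Φ v := by
    intro j _
    have hj0 : (0:ℝ) ≤ j := Nat.cast_nonneg j
    have e2 : ((j + 1 : ℕ) : ℝ) + 1 = j + 2 := by push_cast; ring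
    set s := √((j:ℝ) + 1) with hs
    set t := √((j:ℝ) + 2) with ht
    have hs1 : 1 ≤ s := Real.one_le_sqrt.2 (by linarith)
    have hst : s < t := Real.sqrt_lt_sqrt (by linarith) (by linarith)
    have hss : s ^ 2 = j + 1 := Real.sq_sqrt (by linarith)
    have htt : t ^ 2 = j + 2 := Real.sq_sqrt (by linarith)
    have hts : 1 / (4 * s) ≤ t - s := by
      rw [div_le_iff₀ (by linarith)]
      nlinarith
    have hM : psi (Real.exp t) - psi (Real.exp s) ≤ C₁ * Real.exp s / s := by
      have := hψ (j + 1) (by omega)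
      push_cast at this
      rw [show (j:ℝ) + 1 + 1 = j + 2 by ring] at this
      exact this
    have hfl : ⌊Real.exp s⌋₊ ≤ ⌊Real.exp t⌋₊ := by gcongr
    have hb := sum_block_le (M := C₁ * Real.exp s / s) f hw hc hx0 hst hM
    simp only [hTdef, e2]
    rw [← hs, ← ht, sum_Icc_one_sub _ hfl]
    refine hb.trans ?_
    have hJ0 : 0 ≤ ∫ v in s..t, Φ v :=
      intervalIntegral.integral_nonneg hst.le fun v _ => by simp only [hΦ]; positivity
    have hlast : C₁ * Real.exp s / s * ((∫ v in s..t, Φ v) / (Real.exp s * (t - s))) ≤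
        4 * C₁ * ∫ v in s..t, Φ v := by
      have hts0 : 0 < t - s := by linarith
      have h1 : 1 ≤ 4 * s * (t - s) := by
        rw [div_le_iff₀ (by linarith)] at hts; linarith
      have e : C₁ * Real.exp s / s * ((∫ v in s..t, Φ v) / (Real.exp s * (t - s))) =
          C₁ * (∫ v in s..t, Φ v) / (s * (t - s)) := by
        field_simp
      rw [e, div_le_iff₀ (by positivity)]
      have hC0 : 0 ≤ C₁ * (∫ v in s..t, Φ v) := by positivity
      have := le_mul_of_one_le_right hC0 h1
      linarith
    rw [mul_add]
    refine add_le_add (le_of_eq ?_) hlast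
    simp only [hD]
    rw [← hs, ← ht]
    ring
  have hsum := Finset.sum_le_sum hblock
  rw [Finset.sum_range_sub, Finset.sum_add_distrib, Finset.sum_add_distrib, ← Finset.mul_sum,
    ← Finset.mul_sum, ← Finset.mul_sum] at hsum
  have hD1 : ∑ j ∈ range J, D x j * (Real.exp √((j:ℝ) + 1) / √((j:ℝ) + 1)) ≤
      3 * x * (K₁ * R * ℓ) := by
    refine (sum_weighted_blocks_le (fun n => norm_nonneg (f n)) hx1 J).trans ?_
    gcongr
    exact hT a hf x hx1
  have hD2 : ∑ j ∈ range J, D (x / w) j * (Real.exp √((j:ℝ) + 1) / √((j:ℝ) + 1)) ≤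
      3 * (x / w) * (K₁ * (2 ^ |κ - 1| * R) * ℓ) := by
    refine (sum_weighted_blocks_le (fun n => norm_nonneg (f n)) hxw J).trans ?_
    have h0 : 0 ≤ Real.log (x / w) := Real.log_nonneg hxw
    have h1 : 0 ≤ Real.log (1 + Real.log (x / w)) := Real.log_nonneg (by linarith)
    gcongr
    refine (hT a hf _ hxw).trans ?_
    gcongr
  have hintsum : ∑ j ∈ range J, ∫ v in √((j:ℝ) + 1)..√(((j + 1 : ℕ):ℝ) + 1), Φ v ≤ x * I := by
    rw [intervalIntegral.sum_integral_adjacent_intervals (a := fun j : ℕ => √((j:ℝ) + 1))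
      (fun k _ => hint _ _)]
    refine le_trans ?_ (integral_exp_mul_incr_le f hw hc hx1 √((J:ℝ) + 1))
    simp only [Nat.cast_zero, zero_add, Real.sqrt_one]
    rw [← intervalIntegral.integral_add_adjacent_intervals (hint 0 1) (hint 1 _)]
    have : 0 ≤ ∫ v in (0:ℝ)..1, Real.exp v * ‖incr f c w (x * Real.exp (-v))‖ :=
      intervalIntegral.integral_nonneg zero_le_one fun v _ => by positivity
    linarith
  have e3 : C₁ * w * (3 * (x / w) * (K₁ * (2 ^ |κ - 1| * R) * ℓ)) =
      C₁ * (3 * x * (K₁ * (2 ^ |κ - 1| * R) * ℓ)) := by field_simp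
  have hRℓ : R ≤ R * ℓ := le_mul_of_one_le_right hR0.le hℓ1
  have hψ0 := psi_nonneg (Real.exp 1)
  have hq0 : 0 < q := by positivity
  calc ∑ d ∈ Icc 1 ⌊x⌋₊, G d ≤ T J := hend
    _ ≤ T 0 + (C₁ * (3 * x * (K₁ * R * ℓ)) + C₁ * w * (3 * (x / w) *
          (K₁ * (2 ^ |κ - 1| * R) * ℓ)) + 4 * C₁ * (x * I)) := by
        have h1 := mul_le_mul_of_nonneg_left hD1 hC₁.le
        have h2 := mul_le_mul_of_nonneg_left hD2 (by positivity : 0 ≤ C₁ * w)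
        have h3 := mul_le_mul_of_nonneg_left hintsum (by positivity : 0 ≤ 4 * C₁)
        linarith
    _ ≤ psi (Real.exp 1) * K₂ * q * (x * (R * ℓ)) + C₁ * (3 * K₁ * q) * (x * (R * ℓ)) +
          4 * C₁ * (x * I) := by
        rw [e3]
        have : psi (Real.exp 1) * K₂ * q * (x * R) ≤ psi (Real.exp 1) * K₂ * q * (x * (R * ℓ)) := by
          gcongr
        have e4 : C₁ * (3 * x * (K₁ * R * ℓ)) + C₁ * (3 * x * (K₁ * (2 ^ |κ - 1| * R) * ℓ)) =
          C₁ * (3 * K₁ * q) * (x * (R * ℓ)) := by rw [hq]; ring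
        linarith
    _ ≤ _ := by
        have h1 : 0 ≤ (psi (Real.exp 1) * K₂ * q + C₁ * (3 * K₁ * q)) * (x * I) := by positivity
        have h2 : 0 ≤ 4 * C₁ * (x * (R * ℓ)) := by positivity
        nlinarith

end Convolution

section Plancherel

open scoped FourierTransform SchwartzMap ContDiff

theorem fourier_continuous_of_integrable {u : ℝ → ℂ} (h1 : Integrable u) : Continuous (𝓕 u) :=
  VectorFourier.fourierIntegral_continuous Real.continuous_fourierChar continuous_inner h1

/-- Plancherel's identity for a function in `L¹ ∩ L²`. -/
theorem integrable_and_integral_norm_fourier_sq {u : ℝ → ℂ} (h1 : Integrable u) (h2 : MemLp u 2) :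
    Integrable (fun ξ => ‖𝓕 u ξ‖ ^ 2) ∧ ∫ ξ, ‖𝓕 u ξ‖ ^ 2 = ∫ v, ‖u v‖ ^ 2 := by
  set U : Lp ℂ 2 (volume : Measure ℝ) := h2.toLp u with hU
  set W : Lp ℂ 2 (volume : Measure ℝ) := 𝓕 U with hW
  have hcont := fourier_continuous_of_integrable h1
  have hae : ∀ᵐ ξ, W ξ = 𝓕 u ξ := by
    refine ae_eq_of_integral_contDiff_smul_eq ((Lp.memLp W).locallyIntegrable (by norm_num))
      hcont.locallyIntegrable fun g hg hgc => ?_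
    have hg₁ : HasCompactSupport (Complex.ofRealCLM ∘ g) := hgc.comp_left rfl
    have hg₂ : ContDiff ℝ ∞ (Complex.ofRealCLM ∘ g) := by fun_prop
    set φ : 𝓢(ℝ, ℂ) := hg₁.toSchwartzMap hg₂ with hφ
    have e1 : ∫ x, g x • W x = (Lp.toTemperedDistribution W) φ := by
      rw [Lp.toTemperedDistribution_apply]
      refine integral_congr_ae (ae_of_all _ fun x => ?_)
      simp [hφ]
    rw [e1, hW, ← Lp.fourier_toTemperedDistribution_eq, TemperedDistribution.fourier_apply,
      Lp.toTemperedDistribution_apply]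
    have e2 : ∫ x, (𝓕 φ) x • U x = ∫ x, (𝓕 (φ : ℝ → ℂ)) x • u x := by
      refine integral_congr_ae ?_
      filter_upwards [h2.coeFn_toLp] with x hx
      rw [hU, hx, SchwartzMap.fourier_coe]
    rw [e2]
    have e3 := VectorFourier.integral_fourierIntegral_smul_eq_flip (μ := volume) (ν := volume)
      (L := innerₗ ℝ) Real.continuous_fourierChar continuous_inner φ.integrable h1
    rw [flip_innerₗ] at e3
    refine e3.trans (integral_congr_ae (ae_of_all _ fun x => ?_))
    simp only [hφ, HasCompactSupport.toSchwartzMap_toFun, Function.comp_apply, ofRealCLM_apply,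
        real_smul]
    rfl
  have hmem : MemLp (𝓕 u) 2 := (memLp_congr_ae hae).1 (Lp.memLp W)
  refine ⟨hmem.integrable_norm_pow (by norm_num), ?_⟩
  have hn : eLpNorm (𝓕 u) 2 volume = eLpNorm u 2 volume := by
    rw [← eLpNorm_congr_ae hae, ← eLpNorm_congr_ae h2.coeFn_toLp, ← hU]
    have := Lp.norm_fourier_eq U
    rw [Lp.norm_def, Lp.norm_def] at this
    exact (ENNReal.toReal_eq_toReal_iff' (Lp.eLpNorm_ne_top _) (Lp.eLpNorm_ne_top _)).1 this
  have key : ∀ {w : ℝ → ℂ}, MemLp w 2 → ∫ v, ‖w v‖ ^ 2 = (eLpNorm w 2 volume).toReal ^ 2 := by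
    intro w hw
    rw [hw.eLpNorm_eq_integral_rpow_norm (by norm_num) (by norm_num), ENNReal.toReal_ofReal
      (by positivity)]
    simp only [ENNReal.toReal_ofNat, Real.rpow_two]
    rw [← Real.rpow_natCast, ← Real.rpow_mul (integral_nonneg fun v => by positivity)]
    norm_num
  rw [key hmem, key h2, hn]

end Plancherel

section Damped

open Finset ArithmeticFunction Chebyshev
open scoped FourierTransform

/-- The summatory function in the exponential variable, damped by `e^{-(1+σ)v}`. -/
def damped (b : ℕ → ℂ) (σ v : ℝ) : ℂ :=
  summatory b (Real.exp v) * ((Real.exp (-(1 + σ) * v) : ℝ) : ℂ)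

theorem exists_norm_summatory_le_rpow {b : ℕ → ℂ} {r : ℝ} (hr : 0 ≤ r) (hb : LSeriesSummable b r) :
    ∃ K : ℝ, 0 ≤ K ∧ ∀ u : ℝ, 0 ≤ u → ‖summatory b u‖ ≤ K * u ^ r := by
  have hs := hb.norm
  refine ⟨∑' n, ‖LSeries.term b r n‖, tsum_nonneg fun n => norm_nonneg _, fun u hu => ?_⟩
  refine (norm_sum_le _ _).trans ?_
  calc ∑ n ∈ Icc 1 ⌊u⌋₊, ‖b n‖ ≤ ∑ n ∈ Icc 1 ⌊u⌋₊, ‖LSeries.term b r n‖ * u ^ r := by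
        refine Finset.sum_le_sum fun n hn => ?_
        obtain ⟨h1, h2⟩ := Finset.mem_Icc.1 hn
        have h2' : (n:ℝ) ≤ u := (Nat.le_floor_iff hu).1 h2
        have h1' : (0:ℝ) < n := by exact_mod_cast h1
        rw [LSeries.norm_term_eq, if_neg (by omega), ofReal_re, div_mul_eq_mul_div,
          le_div_iff₀ (by positivity)]
        gcongr
    _ = (∑ n ∈ Icc 1 ⌊u⌋₊, ‖LSeries.term b r n‖) * u ^ r := by rw [Finset.sum_mul]
    _ ≤ _ := by
        gcongr
        exact hs.sum_le_tsum _ fun n _ => norm_nonneg _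

theorem measurable_damped (b : ℕ → ℂ) (σ : ℝ) : Measurable (damped b σ) :=
  ((measurable_summatory b).comp Real.measurable_exp).mul
    (measurable_ofReal.comp (by fun_prop))

theorem damped_of_neg (b : ℕ → ℂ) (σ : ℝ) {v : ℝ} (hv : v < 0) : damped b σ v = 0 := by
  rw [damped, summatory_of_lt_one _ (Real.exp_lt_one_iff.2 hv), zero_mul]

theorem norm_damped (b : ℕ → ℂ) (σ v : ℝ) :
    ‖damped b σ v‖ = ‖summatory b (Real.exp v)‖ * Real.exp (-(1 + σ) * v) := by
  rw [damped, norm_mul, norm_real, Real.norm_of_nonneg (Real.exp_pos _).le]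

theorem exists_norm_damped_le {b : ℕ → ℂ} (hb : ∀ σ : ℝ, 1 < σ → LSeriesSummable b σ) {σ : ℝ}
    (hσ : 0 < σ) : ∃ K : ℝ, 0 ≤ K ∧ ∀ v, ‖damped b σ v‖ ≤
      (Set.Ici (0:ℝ)).indicator (fun v => K * Real.exp (-(σ / 2) * v)) v := by
  obtain ⟨K, hK, h⟩ := exists_norm_summatory_le_rpow (r := 1 + σ / 2) (by linarith)
    (hb (1 + σ / 2) (by linarith))
  refine ⟨K, hK, fun v => ?_⟩
  rcases lt_or_ge v 0 with hv | hv
  · rw [damped_of_neg b σ hv, norm_zero, Set.indicator_of_notMem (by simpa using hv)]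
  · rw [Set.indicator_of_mem (by simpa using hv), norm_damped]
    calc _ ≤ K * Real.exp v ^ (1 + σ / 2) * Real.exp (-(1 + σ) * v) := by
          gcongr; exact h _ (Real.exp_pos v).le
      _ = _ := by
          rw [← Real.exp_mul, mul_assoc, ← Real.exp_add]; ring_nf

theorem integrable_damped {b : ℕ → ℂ} (hb : ∀ σ : ℝ, 1 < σ → LSeriesSummable b σ) {σ : ℝ}
    (hσ : 0 < σ) : Integrable (damped b σ) := by
  obtain ⟨K, hK, h⟩ := exists_norm_damped_le hb hσ
  refine Integrable.mono' ?_ (measurable_damped b σ).aestronglyMeasurable (ae_of_all _ h)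
  rw [integrable_indicator_iff measurableSet_Ici, integrableOn_Ici_iff_integrableOn_Ioi]
  exact (exp_neg_integrableOn_Ioi 0 (by linarith : 0 < σ / 2)).const_mul K

theorem memLp_damped {b : ℕ → ℂ} (hb : ∀ σ : ℝ, 1 < σ → LSeriesSummable b σ) {σ : ℝ}
    (hσ : 0 < σ) : MemLp (damped b σ) 2 := by
  obtain ⟨K, hK, h⟩ := exists_norm_damped_le hb hσ
  rw [memLp_two_iff_integrable_sq_norm (measurable_damped b σ).aestronglyMeasurable]
  refine Integrable.mono' ((integrable_damped hb hσ).norm.const_mul K)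
    ((measurable_damped b σ).norm.pow_const 2).aestronglyMeasurable (ae_of_all _ fun v => ?_)
  have h1 : ‖damped b σ v‖ ≤ K := by
    refine (h v).trans (Set.indicator_le' (fun w hw => ?_) (fun w _ => hK) v)
    refine mul_le_of_le_one_right hK (Real.exp_le_one_iff.2 ?_)
    have : (0:ℝ) ≤ w := hw
    nlinarith
  rw [Real.norm_of_nonneg (by positivity), sq]
  gcongr

theorem fourier_damped {b : ℕ → ℂ} (hb : ∀ σ : ℝ, 1 < σ → LSeriesSummable b σ) {σ : ℝ}
    (hσ : 0 < σ) (ξ : ℝ) : 𝓕 (damped b σ) ξ =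
      LSeries b ((1 + σ : ℝ) + (2 * Real.pi * ξ : ℝ) * I) /
        ((1 + σ : ℝ) + (2 * Real.pi * ξ : ℝ) * I) := by
  set s : ℂ := (1 + σ : ℝ) + (2 * Real.pi * ξ : ℝ) * I with hs
  have hre : s.re = 1 + σ := by
    rw [hs, add_re, re_ofReal_mul, ofReal_re]; simp
  have hs0 : s ≠ 0 := fun h => by rw [h, zero_re] at hre; linarith
  have hsum : LSeriesSummable b s := (hb (1 + σ) (by linarith)).of_re_le_re (by simp [hre])
  obtain ⟨K, hK, h⟩ := exists_norm_summatory_le_rpow (r := 1 + σ / 2) (by linarith)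
    (hb (1 + σ / 2) (by linarith))
  have hO : (fun n : ℕ => ∑ k ∈ Icc 1 n, b k) =O[Filter.atTop] fun n => (n:ℝ) ^ (1 + σ / 2) := by
    refine Asymptotics.IsBigO.of_bound K (Filter.Eventually.of_forall fun n => ?_)
    have := h n (Nat.cast_nonneg n)
    rw [summatory, Nat.floor_natCast] at this
    rwa [Real.norm_of_nonneg (by positivity)]
  rw [LSeries_eq_mul_integral b (r := 1 + σ / 2) (by linarith) (by rw [hre]; linarith) hsum hO,
    mul_div_cancel_left₀ _ hs0]
  have himg : Real.exp '' Set.Ioi 0 = Set.Ioi 1 := by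
    ext t; constructor
    · rintro ⟨v, hv, rfl⟩; exact Real.one_lt_exp_iff.2 hv
    · intro ht
      exact ⟨Real.log t, Real.log_pos ht, Real.exp_log (zero_lt_one.trans ht)⟩
  rw [← himg, integral_image_eq_integral_abs_deriv_smul measurableSet_Ioi
    (fun v _ => (Real.hasDerivAt_exp v).hasDerivWithinAt) Real.exp_injective.injOn,
    Real.fourier_eq', ← integral_Ici_eq_integral_Ioi,
        ← setIntegral_eq_integral_of_forall_compl_eq_zero
      (s := Set.Ici (0:ℝ))]
  · refine setIntegral_congr_fun measurableSet_Ici fun v _ => ?_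
    simp only [damped, summatory]
    rw [abs_of_pos (Real.exp_pos v), smul_eq_mul, real_smul]
    have e1 : ((Real.exp v : ℝ) : ℂ) ^ (-(s + 1)) = cexp (-(s + 1) * v) := by
      rw [cpow_def_of_ne_zero (by exact_mod_cast (Real.exp_pos v).ne'), ← ofReal_log
        (Real.exp_pos v).le, Real.log_exp, mul_comm]
    rw [e1]
    have e2 : ((Real.exp v : ℝ) : ℂ) * cexp (-(s + 1) * v) =
        cexp (((-2 * Real.pi * inner ℝ v ξ : ℝ) : ℂ) * I) *
          ((Real.exp (-(1 + σ) * v) : ℝ) : ℂ) := by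
      rw [ofReal_exp, ofReal_exp, ← Complex.exp_add, ← Complex.exp_add]
      congr 1
      rw [hs, show (inner ℝ v ξ : ℝ) = v * ξ by simp [mul_comm]]
      push_cast
      ring
    linear_combination (∑ k ∈ Icc 1 ⌊Real.exp v⌋₊, b k) * (-e2)
  · intro v hv
    rw [damped_of_neg b σ (by simpa using hv), smul_zero]

end Damped

section MeanValue

open Finset ArithmeticFunction Chebyshev
open scoped FourierTransform

/-- The point `1 + σ + it`. -/
def vline (σ t : ℝ) : ℂ := ((1 + σ : ℝ) : ℂ) + (t : ℂ) * I

theorem vline_re (σ t : ℝ) : (vline σ t).re = 1 + σ := by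
  rw [vline, add_re, re_ofReal_mul, ofReal_re]; simp

theorem vline_im (σ t : ℝ) : (vline σ t).im = t := by
  rw [vline, add_im, im_ofReal_mul, ofReal_im]; simp

theorem vline_ne_zero {σ : ℝ} (hσ : 0 < σ) (t : ℝ) : vline σ t ≠ 0 := fun h => by
  have := vline_re σ t
  rw [h, zero_re] at this; linarith

theorem sq_norm_vline (σ t : ℝ) : ‖vline σ t‖ ^ 2 = (1 + σ) ^ 2 + t ^ 2 := by
  rw [← normSq_eq_norm_sq, normSq_apply, vline_re, vline_im]; ring

theorem Fser_eq_LSeries (f : ℕ → ℂ) {s : ℂ} (hs : s ≠ 0) : Fser f s = LSeries f s := by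
  refine tsum_congr fun n => ?_
  rw [LSeries.term_def]
  split_ifs with h
  · simp [h, hs]
  · rfl

theorem integrable_sq_LSeries_div {b : ℕ → ℂ} (hb : ∀ σ : ℝ, 1 < σ → LSeriesSummable b σ) {σ : ℝ}
    (hσ : 0 < σ) :
    Integrable (fun ξ : ℝ => ‖LSeries b (vline σ (2 * Real.pi * ξ)) /
      vline σ (2 * Real.pi * ξ)‖ ^ 2) ∧
    ∫ ξ : ℝ, ‖LSeries b (vline σ (2 * Real.pi * ξ)) / vline σ (2 * Real.pi * ξ)‖ ^ 2 =
      ∫ v, ‖damped b σ v‖ ^ 2 := by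
  have h := integrable_and_integral_norm_fourier_sq (integrable_damped hb hσ) (memLp_damped hb hσ)
  simp only [fourier_damped hb hσ] at h
  exact h

theorem continuous_LSeries_vline {b : ℕ → ℂ} (hb : ∀ σ : ℝ, 1 < σ → LSeriesSummable b σ) {σ : ℝ}
    (hσ : 0 < σ) : Continuous fun ξ : ℝ => LSeries b (vline σ (2 * Real.pi * ξ)) := by
  have h := fourier_continuous_of_integrable (integrable_damped hb hσ)
  have e : (fun ξ : ℝ => LSeries b (vline σ (2 * Real.pi * ξ))) =
      fun ξ => 𝓕 (damped b σ) ξ * vline σ (2 * Real.pi * ξ) := by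
    ext ξ
    rw [fourier_damped hb hσ]
    exact (div_mul_cancel₀ _ (vline_ne_zero hσ _)).symm
  rw [e]
  refine h.mul ?_
  unfold vline
  fun_prop

variable {κ : ℝ} {a : ℕ → ℂ}

theorem LSeriesSummable_of_le_vonMangoldt (ha : ∀ n, 1 ≤ n → ‖a n‖ ≤ κ * Λ n) {σ : ℝ} (hσ : 1 < σ) :
    LSeriesSummable a σ := by
  have h := (LSeriesSummable_vonMangoldt (s := (σ:ℂ)) (by simpa using hσ)).norm.mul_left κ
  refine Summable.of_norm_bounded h fun n => ?_
  rw [LSeries.norm_term_eq, LSeries.norm_term_eq]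
  split_ifs with h0
  · simp
  · rw [← mul_div_assoc]
    gcongr
    rw [norm_real, Real.norm_of_nonneg vonMangoldt_nonneg]
    exact ha n (by omega)

theorem integral_sq_damped_le (hκ : 0 ≤ κ) (ha : ∀ n, 1 ≤ n → ‖a n‖ ≤ κ * Λ n)
    {σ : ℝ} (hσ : 0 < σ) :
    ∫ v, ‖damped a σ v‖ ^ 2 ≤ (κ * (Real.log 4 + 4)) ^ 2 / (2 * σ) := by
  have hpt : ∀ v, ‖damped a σ v‖ ^ 2 ≤ (Set.Ici (0:ℝ)).indicator
      (fun v => (κ * (Real.log 4 + 4)) ^ 2 * Real.exp (-(2 * σ) * v)) v := by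
    intro v
    rcases lt_or_ge v 0 with hv | hv
    · rw [damped_of_neg a σ hv, norm_zero, Set.indicator_of_notMem (by simpa using hv)]; norm_num
    · rw [Set.indicator_of_mem (by simpa using hv), norm_damped]
      have h1 : ‖summatory a (Real.exp v)‖ ≤ κ * ((Real.log 4 + 4) * Real.exp v) := by
        calc _ ≤ ∑ n ∈ Icc 1 ⌊Real.exp v⌋₊, ‖a n‖ := norm_sum_le _ _
          _ ≤ ∑ n ∈ Icc 1 ⌊Real.exp v⌋₊, κ * Λ n :=
              Finset.sum_le_sum fun n hn => ha n (Finset.mem_Icc.1 hn).1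
          _ = κ * psi (Real.exp v) := by rw [psi_eq_sum_Icc_one, Finset.mul_sum]
          _ ≤ _ := by
              gcongr
              exact psi_le_const_mul_self (Real.exp_pos v).le
      calc (‖summatory a (Real.exp v)‖ * Real.exp (-(1 + σ) * v)) ^ 2
          ≤ (κ * ((Real.log 4 + 4) * Real.exp v) * Real.exp (-(1 + σ) * v)) ^ 2 := by gcongr
        _ = (κ * (Real.log 4 + 4)) ^ 2 * (Real.exp v * Real.exp (-(1 + σ) * v)) ^ 2 := by ring
        _ = _ := by
            rw [← Real.exp_add, ← Real.exp_nat_mul]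
            congr 2; push_cast; ring
  have hI : IntegrableOn (fun v : ℝ => (κ * (Real.log 4 + 4)) ^ 2 * Real.exp (-(2 * σ) * v))
      (Set.Ici 0) := by
    rw [integrableOn_Ici_iff_integrableOn_Ioi]
    exact (exp_neg_integrableOn_Ioi 0 (by linarith)).const_mul _
  calc _ ≤ ∫ v, (Set.Ici (0:ℝ)).indicator
          (fun v => (κ * (Real.log 4 + 4)) ^ 2 * Real.exp (-(2 * σ) * v)) v := by
        refine integral_mono_of_nonneg (ae_of_all _ fun v => ?_)
          ((integrable_indicator_iff measurableSet_Ici).2 hI) (ae_of_all _ hpt)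
        exact sq_nonneg _
    _ = _ := by
        rw [integral_indicator measurableSet_Ici, integral_Ici_eq_integral_Ioi,
          integral_const_mul, integral_exp_mul_Ioi (by linarith)]
        simp
        field_simp

theorem LSeries_twist (σ t y : ℝ) :
    LSeries a (vline σ (t + y)) = LSeries (fun n => a n * (n:ℂ) ^ (-((y:ℂ) * I))) (vline σ t) := by
  refine tsum_congr fun n => ?_
  rw [LSeries.term_def, LSeries.term_def]
  split_ifs with h
  · rfl
  · have hn : (n:ℂ) ≠ 0 := by exact_mod_cast h
    have : vline σ (t + y) = vline σ t + (y:ℂ) * I := by simp only [vline]; push_cast; ring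
    rw [this, cpow_add _ _ hn, cpow_neg]
    have h1 : (n:ℂ) ^ (vline σ t) ≠ 0 := by simp [cpow_eq_zero_iff, hn]
    have h2 : (n:ℂ) ^ ((y:ℂ) * I) ≠ 0 := by simp [cpow_eq_zero_iff, hn]
    field_simp

theorem integral_sq_LSeries_unit_le (hκ : 0 ≤ κ) (ha : ∀ n, 1 ≤ n → ‖a n‖ ≤ κ * Λ n) {σ : ℝ}
    (hσ : 0 < σ) (hσ1 : σ ≤ 1) (y : ℝ) :
    ∫ ξ in y..(y + 1), ‖LSeries a (vline σ (2 * Real.pi * ξ))‖ ^ 2 ≤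
      50 * ((κ * (Real.log 4 + 4)) ^ 2 / (2 * σ)) := by
  set a' : ℕ → ℂ := fun n => a n * (n:ℂ) ^ (-(((2 * Real.pi * y : ℝ):ℂ) * I)) with ha'def
  have ha' : ∀ n, 1 ≤ n → ‖a' n‖ ≤ κ * Λ n := by
    intro n hn
    have hn0 : 0 < n := by omega
    rw [ha'def]
    simp only [norm_mul]
    rw [norm_natCast_cpow_of_pos hn0]
    simpa using ha n hn
  have hsum : ∀ σ : ℝ, 1 < σ → LSeriesSummable a' σ := fun σ hσ =>
    LSeriesSummable_of_le_vonMangoldt ha' hσ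
  obtain ⟨hI, hE⟩ := integrable_sq_LSeries_div hsum hσ
  have e1 : ∫ ξ in y..(y + 1), ‖LSeries a (vline σ (2 * Real.pi * ξ))‖ ^ 2 =
      ∫ ξ in (0:ℝ)..1, ‖LSeries a' (vline σ (2 * Real.pi * ξ))‖ ^ 2 := by
    have := intervalIntegral.integral_comp_add_right (a := 0) (b := 1)
      (fun ξ : ℝ => ‖LSeries a (vline σ (2 * Real.pi * ξ))‖ ^ 2) y
    rw [zero_add, add_comm 1 y] at this
    rw [← this]
    refine intervalIntegral.integral_congr fun ξ _ => ?_
    simp only [mul_add]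
    rw [LSeries_twist]
  rw [e1]
  calc _ ≤ ∫ ξ in (0:ℝ)..1, 50 * ‖LSeries a' (vline σ (2 * Real.pi * ξ)) /
        vline σ (2 * Real.pi * ξ)‖ ^ 2 := by
        refine intervalIntegral.integral_mono_on zero_le_one ?_ ?_ ?_
        · exact ((continuous_LSeries_vline hsum hσ).norm.pow 2).intervalIntegrable _ _
        · exact (hI.const_mul 50).intervalIntegrable
        · intro ξ hξ
          rw [norm_div, div_pow, mul_div_assoc', le_div_iff₀ (by
            have := vline_ne_zero hσ (2 * Real.pi * ξ); positivity), sq_norm_vline, mul_comm]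
          gcongr
          have hpi : Real.pi < 3.15 := Real.pi_lt_d2
          have hpi0 := Real.pi_pos
          have h1 : 2 * Real.pi * ξ ≤ 6.3 := by nlinarith [hξ.1, hξ.2]
          have h0 : 0 ≤ 2 * Real.pi * ξ := by have := hξ.1; positivity
          nlinarith
    _ ≤ ∫ ξ, 50 * ‖LSeries a' (vline σ (2 * Real.pi * ξ)) / vline σ (2 * Real.pi * ξ)‖ ^ 2 := by
        rw [intervalIntegral.integral_of_le zero_le_one]
        exact setIntegral_le_integral (hI.const_mul 50) (ae_of_all _ fun ξ => by positivity)
    _ ≤ _ := by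
        rw [integral_const_mul, hE]
        gcongr
        exact integral_sq_damped_le hκ ha' hσ

theorem integral_Ioi_le_of_unit_le {Φ Ψ : ℝ → ℝ} {D X : ℝ} (hΦ0 : ∀ ξ, 0 ≤ Φ ξ) (hΦ : Continuous Φ)
    (hD : ∀ y, ∫ ξ in y..(y + 1), Φ ξ ≤ D) (hX : 1 ≤ X) (hΨ : Integrable Ψ)
    (hle : ∀ ξ, X < ξ → Ψ ξ ≤ Φ ξ / ξ ^ 2) : ∫ ξ in Set.Ioi X, Ψ ξ ≤ 2 * D / X := by
  have hD0 : 0 ≤ D := le_trans (intervalIntegral.integral_nonneg (by linarith)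
    (fun v _ => hΦ0 v)) (hD 0)
  have hb : ∀ N : ℕ, ∫ ξ in X..(X + N), Ψ ξ ≤ 2 * D * (1 / X - 1 / (X + N)) := by
    intro N
    induction N with
    | zero => simp
    | succ N ih =>
      have hXN : 1 ≤ X + N := by linarith [(Nat.cast_nonneg N : (0:ℝ) ≤ N)]
      have h1 : ∫ ξ in (X + N)..(X + N + 1), Ψ ξ ≤ D / (X + N) ^ 2 := by
        calc _ ≤ ∫ ξ in (X + N)..(X + N + 1), Φ ξ * (1 / (X + N) ^ 2) := by
              refine intervalIntegral.integral_mono_on_of_le_Ioo (by linarith)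
                hΨ.intervalIntegrable ((hΦ.mul continuous_const).intervalIntegrable _ _) ?_
              intro ξ hξ
              refine (hle ξ (by linarith [hξ.1, (Nat.cast_nonneg N : (0:ℝ) ≤ N)])).trans ?_
              rw [mul_one_div]
              have := hΦ0 ξ
              gcongr
              exact hξ.1.le
          _ ≤ _ := by
              rw [intervalIntegral.integral_mul_const, mul_one_div]
              gcongr
              exact hD _
      have h2 : D / (X + N) ^ 2 ≤ 2 * D * (1 / (X + N) - 1 / (X + N + 1)) := by
        have e : 2 * D * (1 / (X + N) - 1 / (X + N + 1)) = 2 * D / ((X + N) * (X + N + 1)) := by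
          field_simp; ring
        rw [e, div_le_div_iff₀ (by positivity) (by positivity)]
        have : 0 ≤ D * (X + N) * ((X + N) - 1) := by
          have : 0 ≤ X + N - 1 := by linarith
          positivity
        nlinarith
      rw [← intervalIntegral.integral_add_adjacent_intervals (b := X + N)
        hΨ.intervalIntegrable hΨ.intervalIntegrable]
      push_cast
      rw [← add_assoc]
      linarith
  have ht := intervalIntegral_tendsto_integral_Ioi X (hΨ.integrableOn (s := Set.Ioi X))
    (Filter.tendsto_atTop_add_const_left _ X tendsto_natCast_atTop_atTop)
  refine le_of_tendsto' ht fun N => (hb N).trans ?_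
  have : 0 ≤ 1 / (X + N) := by positivity
  have h2 : 0 ≤ 2 * D * (1 / (X + N)) := by positivity
  have e : 2 * D / X = 2 * D * (1 / X) := by ring
  rw [e]; linarith

theorem integral_abs_gt_le (hκ : 0 ≤ κ) (ha : ∀ n, 1 ≤ n → ‖a n‖ ≤ κ * Λ n) {σ : ℝ}
    (hσ : 0 < σ) (hσ1 : σ ≤ 1) {X : ℝ} (hX : 1 ≤ X) :
    ∫ ξ in {ξ : ℝ | X < |ξ|}, ‖LSeries a (vline σ (2 * Real.pi * ξ)) /
        vline σ (2 * Real.pi * ξ)‖ ^ 2 ≤ 100 * (κ * (Real.log 4 + 4)) ^ 2 / (σ * X) := by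
  set D := 50 * ((κ * (Real.log 4 + 4)) ^ 2 / (2 * σ)) with hDdef
  have hsum : ∀ σ : ℝ, 1 < σ → LSeriesSummable a σ := fun σ hσ =>
    LSeriesSummable_of_le_vonMangoldt ha hσ
  obtain ⟨hI, -⟩ := integrable_sq_LSeries_div hsum hσ
  set Ψ : ℝ → ℝ := fun ξ => ‖LSeries a (vline σ (2 * Real.pi * ξ)) /
    vline σ (2 * Real.pi * ξ)‖ ^ 2 with hΨ
  set Φ : ℝ → ℝ := fun ξ => ‖LSeries a (vline σ (2 * Real.pi * ξ))‖ ^ 2 with hΦ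
  have hΦc : Continuous Φ := (continuous_LSeries_vline hsum hσ).norm.pow 2
  have hΦ0 : ∀ ξ, 0 ≤ Φ ξ := fun ξ => by positivity
  have hD : ∀ y, ∫ ξ in y..(y + 1), Φ ξ ≤ D := integral_sq_LSeries_unit_le hκ ha hσ hσ1
  have hle : ∀ ξ, X < |ξ| → Ψ ξ ≤ Φ ξ / ξ ^ 2 := by
    intro ξ hξ
    simp only [hΨ, hΦ, norm_div, div_pow]
    have h0 : 0 < ξ ^ 2 := by
      rw [← sq_abs]; have : 0 < |ξ| := by linarith
      positivity
    refine div_le_div_of_nonneg_left (sq_nonneg _) h0 ?_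
    rw [sq_norm_vline]
    have : 1 ≤ (2 * Real.pi) ^ 2 := by nlinarith [Real.pi_gt_three]
    nlinarith [sq_nonneg (1 + σ)]
  have hset : {ξ : ℝ | X < |ξ|} = Set.Ioi X ∪ Set.Iio (-X) := by
    ext ξ
    simp only [Set.mem_ofPred_eq, Set.mem_union, Set.mem_Ioi, Set.mem_Iio, lt_abs, lt_neg]
  have hdisj : Disjoint (Set.Ioi X) (Set.Iio (-X)) := by
    rw [Set.disjoint_left]; intro ξ h1 h2
    simp only [Set.mem_Ioi, Set.mem_Iio] at h1 h2; linarith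
  rw [hset, setIntegral_union hdisj measurableSet_Iio hI.integrableOn hI.integrableOn]
  have hpos := integral_Ioi_le_of_unit_le hΦ0 hΦc hD hX hI
    (fun ξ hξ => hle ξ (hξ.trans_le (le_abs_self ξ)))
  have hneg : ∫ ξ in Set.Iio (-X), Ψ ξ ≤ 2 * D / X := by
    rw [← integral_Iic_eq_integral_Iio, ← integral_comp_neg_Ioi X Ψ]
    refine integral_Ioi_le_of_unit_le (Φ := fun ξ => Φ (-ξ)) (fun ξ => hΦ0 _)
      (hΦc.comp continuous_neg)
      (fun y => ?_) hX hI.comp_neg (fun ξ hξ => ?_)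
    · have := intervalIntegral.integral_comp_neg (a := y) (b := y + 1) Φ
      rw [this]
      have := hD (-(y + 1))
      rwa [show -(y + 1) + 1 = -y by ring] at this
    · have := hle (-ξ) (by rw [abs_neg]; exact hξ.trans_le (le_abs_self ξ))
      rwa [neg_sq] at this
  calc _ ≤ 2 * D / X + 2 * D / X := add_le_add hpos hneg
    _ = _ := by rw [hDdef]; field_simp; ring

end MeanValue

section BlockBound

open Finset ArithmeticFunction Chebyshev
open scoped FourierTransform

variable {κ : ℝ} {f Λf : ℕ → ℂ}

theorem IsHalaszClass.nonneg_kappa (h : IsHalaszClass κ f Λf) : 0 ≤ κ := by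
  have h2 := (norm_nonneg _).trans (h.bound 2 (by norm_num))
  have h3 : 0 < Λ 2 := by
    rw [vonMangoldt_apply_prime Nat.prime_two]; exact Real.log_pos (by norm_num)
  exact nonneg_of_mul_nonneg_left h2 h3

theorem IsHalaszClass.summable (h : IsHalaszClass κ f Λf) {s : ℂ} (hs : 1 < s.re) :
    LSeriesSummable f s := by
  have h1 := LSeriesSummable.ofReal_iff_norm.1 (h.isDominated.summable s.re hs)
  exact h1.of_re_le_re (by simp)

theorem IsHalaszClass.summable_vonMangoldt (h : IsHalaszClass κ f Λf) {s : ℂ} (hs : 1 < s.re) :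
    LSeriesSummable Λf s :=
  (LSeriesSummable_of_le_vonMangoldt h.bound hs).of_re_le_re (by simp)

theorem IsHalaszClass.mul_log_eq_convolution (h : IsHalaszClass κ f Λf) :
    (fun n : ℕ => f n * (Real.log n : ℂ)) = LSeries.convolution Λf f := by
  ext n
  rcases Nat.eq_zero_or_pos n with rfl | hn
  · simp [LSeries.convolution_map_zero]
  · rw [h.conv n hn, LSeries.convolution_def]
    exact (Nat.sum_divisorsAntidiagonal (fun a b => Λf a * f b)).symm

theorem IsHalaszClass.summable_mul_log (h : IsHalaszClass κ f Λf) {s : ℂ} (hs : 1 < s.re) :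
    LSeriesSummable (fun n : ℕ => f n * (Real.log n : ℂ)) s := by
  rw [h.mul_log_eq_convolution]
  exact ((h.summable_vonMangoldt hs).LSeriesHasSum.convolution
    (h.summable hs).LSeriesHasSum).LSeriesSummable

theorem IsHalaszClass.LSeries_mul_log (h : IsHalaszClass κ f Λf) {s : ℂ} (hs : 1 < s.re) :
    LSeries (fun n : ℕ => f n * (Real.log n : ℂ)) s = LSeries Λf s * LSeries f s := by
  rw [h.mul_log_eq_convolution, LSeries_convolution' (h.summable_vonMangoldt hs) (h.summable hs)]

theorem IsHalaszClass.norm_LSeries_le (h : IsHalaszClass κ f Λf) {σ : ℝ} (hσ : 0 < σ) (t : ℝ) :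
    ‖LSeries f (vline σ t)‖ ≤ (1 + 1 / σ) ^ κ := by
  refine le_trans ?_ (h.isDominated.dirichlet_le h.nonneg_kappa hσ)
  have hs : LSeriesSummable f (vline σ t) := h.summable (by rw [vline_re]; linarith)
  refine (norm_tsum_le_tsum_norm hs.norm).trans (le_of_eq ?_)
  refine tsum_congr fun n => ?_
  rw [LSeries.norm_term_eq, vline_re]

theorem damped_incr_eq (b : ℕ → ℂ) (c : ℂ) {w : ℝ} (hw : 0 < w) (σ v : ℝ) :
    incr b c w (Real.exp v) * ((Real.exp (-(1 + σ) * v) : ℝ) : ℂ) =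
      damped b σ v - c * cexp (-(1 + σ) * Real.log w) * damped b σ (v + -Real.log w) := by
  have e : Real.exp (v + -Real.log w) = Real.exp v / w := by
    rw [Real.exp_add, Real.exp_neg, Real.exp_log hw]; rfl
  rw [incr, damped, damped, e]
  have e2 : ((Real.exp (-(1 + σ) * v) : ℝ) : ℂ) = cexp (-(1 + σ) * Real.log w) *
      ((Real.exp (-(1 + σ) * (v + -Real.log w)) : ℝ) : ℂ) := by
    rw [ofReal_exp, ofReal_exp, ← Complex.exp_add]
    congr 1; push_cast; ring
  linear_combination (-c * summatory b (Real.exp v / w)) * e2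

theorem fourier_damped_incr {b : ℕ → ℂ} (hb : ∀ σ : ℝ, 1 < σ → LSeriesSummable b σ) (t₁ : ℝ) {w : ℝ}
    (hw : 0 < w) {σ : ℝ} (hσ : 0 < σ) (ξ : ℝ) :
    𝓕 (fun v => incr b (cexp ((1 + t₁ * I) * Real.log w)) w (Real.exp v) *
      ((Real.exp (-(1 + σ) * v) : ℝ) : ℂ)) ξ =
    LSeries b (vline σ (2 * Real.pi * ξ)) / vline σ (2 * Real.pi * ξ) *
      (1 - cexp (-(σ + (2 * Real.pi * ξ - t₁ : ℝ) * I) * Real.log w)) := by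
  set c := cexp ((1 + t₁ * I) * Real.log w) with hc
  have hd := integrable_damped hb hσ
  have hshift : 𝓕 (fun v => damped b σ (v + -Real.log w)) ξ =
      Real.fourierChar (-Real.log w * ξ) • 𝓕 (damped b σ) ξ := by
    have := congrFun (Fourier.fourierIntegral_comp_add_right Real.fourierChar volume (damped b σ)
      (-Real.log w)) ξ
    simpa [Real.fourier_real_eq, Fourier.fourierIntegral, VectorFourier.fourierIntegral,
      Function.comp_def] using this
  have hfun : (fun v => incr b c w (Real.exp v) * ((Real.exp (-(1 + σ) * v) : ℝ) : ℂ)) =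
      fun v => damped b σ v - c * cexp (-(1 + σ) * Real.log w) * damped b σ (v + -Real.log w) :=
    funext fun v => damped_incr_eq b c hw σ v
  have hlin : 𝓕 (fun v => damped b σ v - c * cexp (-(1 + σ) * Real.log w) *
      damped b σ (v + -Real.log w)) ξ = 𝓕 (damped b σ) ξ - c * cexp (-(1 + σ) * Real.log w) *
        𝓕 (fun v => damped b σ (v + -Real.log w)) ξ := by
    have hd2 : Integrable fun v => damped b σ (v + -Real.log w) := hd.comp_add_right _
    rw [Real.fourier_real_eq, Real.fourier_real_eq, Real.fourier_real_eq, ← integral_const_mul,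
      ← integral_sub]
    · refine integral_congr_ae (ae_of_all _ fun v => ?_)
      simp only [Circle.smul_def, smul_eq_mul]; ring
    · exact (Real.fourierIntegral_convergent_iff ξ).2 hd |>.congr
        (ae_of_all _ fun v => by simp [mul_comm])
    · refine Integrable.const_mul ?_ _
      exact (Real.fourierIntegral_convergent_iff ξ).2 hd2 |>.congr
        (ae_of_all _ fun v => by simp [mul_comm])
  rw [hfun, hlin, hshift, fourier_damped hb hσ, Circle.smul_def, Real.fourierChar_apply]
  have e : c * cexp (-(1 + σ) * Real.log w) * cexp (↑(2 * Real.pi * (-Real.log w * ξ)) * I) =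
      cexp (-(σ + (2 * Real.pi * ξ - t₁ : ℝ) * I) * Real.log w) := by
    rw [hc, ← Complex.exp_add, ← Complex.exp_add]
    congr 1; push_cast; ring
  rw [← e, smul_eq_mul]
  simp only [vline]
  ring

theorem norm_one_sub_twist_le (t : ℝ) {w σ : ℝ} (hw : 1 ≤ w) (hσ : 0 < σ) :
    ‖1 - cexp (-(σ + (t : ℝ) * I) * Real.log w)‖ ≤ 2 := by
  refine (norm_sub_le _ _).trans ?_
  rw [norm_one, Complex.norm_exp]
  have : (-(σ + (t : ℝ) * I) * Real.log w : ℂ).re = -σ * Real.log w := by simp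
  rw [this]
  have : Real.exp (-σ * Real.log w) ≤ 1 := Real.exp_le_one_iff.2 (by
    have := Real.log_nonneg hw; nlinarith)
  linarith

/-- Mean-square bound for the increments of the partial sums of `f(n) log n`. -/
theorem IsHalaszClass.integral_sq_incr_le (h : IsHalaszClass κ f Λf) {σ : ℝ} (hσ : 0 < σ)
    (hσ1 : σ ≤ 1) {w : ℝ} (hw : 1 ≤ w) (t₁ : ℝ) {M T : ℝ} (hT : 7 ≤ T)
    (hMT : ∀ t : ℝ, |t| ≤ T → ‖LSeries f (vline σ t)‖ *
      ‖1 - cexp (-(σ + (t - t₁ : ℝ) * I) * Real.log w)‖ ≤ M) :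
    Integrable (fun v => ‖incr (fun n : ℕ => f n * (Real.log n : ℂ))
      (cexp ((1 + t₁ * I) * Real.log w)) w (Real.exp v)‖ ^ 2 * Real.exp (-(2 * (1 + σ)) * v)) ∧
    ∫ v, ‖incr (fun n : ℕ => f n * (Real.log n : ℂ))
      (cexp ((1 + t₁ * I) * Real.log w)) w (Real.exp v)‖ ^ 2 * Real.exp (-(2 * (1 + σ)) * v) ≤
      (κ * (Real.log 4 + 4)) ^ 2 / σ * (M ^ 2 + 2800 * (1 + 1 / σ) ^ (2 * κ) / T) := by
  have hw0 : 0 < w := by linarith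
  have hκ := h.nonneg_kappa
  set b := fun n : ℕ => f n * (Real.log n : ℂ) with hbdef
  set c := cexp ((1 + t₁ * I) * Real.log w) with hc
  have hb : ∀ σ : ℝ, 1 < σ → LSeriesSummable b σ :=
      fun σ hσ => h.summable_mul_log (by simpa using hσ)
  have hΛ : ∀ σ : ℝ, 1 < σ → LSeriesSummable Λf σ := fun σ hσ =>
    h.summable_vonMangoldt (by simpa using hσ)
  set G : ℝ → ℂ := fun v => incr b c w (Real.exp v) * ((Real.exp (-(1 + σ) * v) : ℝ) : ℂ) with hG
  have hGfun : G = fun v => damped b σ v - (c * cexp (-(1 + σ) * Real.log w)) *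
      damped b σ (v + -Real.log w) := funext fun v => damped_incr_eq b c hw0 σ v
  have hd := integrable_damped hb hσ
  have hd2 := memLp_damped hb hσ
  have hG1 : Integrable G := by
    rw [hGfun]
    exact hd.sub ((hd.comp_add_right _).const_mul _)
  have hG2 : MemLp G 2 := by
    rw [hGfun]
    exact hd2.sub ((hd2.comp_measurePreserving (measurePreserving_add_right volume _)).const_mul _)
  obtain ⟨hI, hE⟩ := integrable_and_integral_norm_fourier_sq hG1 hG2
  have hsq : ∀ v, ‖incr b c w (Real.exp v)‖ ^ 2 * Real.exp (-(2 * (1 + σ)) * v) = ‖G v‖ ^ 2 := by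
    intro v
    rw [hG]
    simp only [norm_mul, norm_real, Real.norm_eq_abs, Real.abs_exp, mul_pow]
    rw [← Real.exp_nat_mul]
    congr 2; push_cast; ring
  simp only [hsq]
  refine ⟨hG2.integrable_norm_pow two_ne_zero, ?_⟩
  rw [← hE]
  set s := fun ξ : ℝ => vline σ (2 * Real.pi * ξ) with hs
  set D : ℝ → ℝ := fun ξ => ‖LSeries Λf (s ξ) / s ξ‖ ^ 2 with hD
  obtain ⟨hDI, hDE⟩ := integrable_sq_LSeries_div hΛ hσ
  set Z := (1 + 1 / σ) ^ κ with hZ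
  have hF : ∀ ξ, ‖𝓕 G ξ‖ ^ 2 = D ξ * (‖LSeries f (s ξ)‖ *
      ‖1 - cexp (-(σ + (2 * Real.pi * ξ - t₁ : ℝ) * I) * Real.log w)‖) ^ 2 := by
    intro ξ
    rw [hG, fourier_damped_incr hb t₁ hw0 hσ, h.LSeries_mul_log (by rw [vline_re]; linarith), hD]
    simp only [hs, norm_mul, norm_div]
    ring
  set X := T / (2 * Real.pi) with hX
  have hpi := Real.pi_pos
  have hX1 : 1 ≤ X := by rw [hX, le_div_iff₀ (by positivity)]; linarith [Real.pi_lt_d2]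
  have hS : MeasurableSet {ξ : ℝ | X < |ξ|} := measurableSet_lt measurable_const measurable_norm
  have hpt : ∀ ξ, ‖𝓕 G ξ‖ ^ 2 ≤ M ^ 2 * D ξ +
      (4 * Z ^ 2) * ({ξ : ℝ | X < |ξ|}.indicator D ξ) := by
    intro ξ
    rw [hF]
    have hD0 : 0 ≤ D ξ := sq_nonneg _
    by_cases hξ : X < |ξ|
    · rw [Set.indicator_of_mem (by exact hξ)]
      have h1 : ‖LSeries f (s ξ)‖ *
          ‖1 - cexp (-(σ + (2 * Real.pi * ξ - t₁ : ℝ) * I) * Real.log w)‖ ≤ Z * 2 :=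
        mul_le_mul (h.norm_LSeries_le hσ _) (norm_one_sub_twist_le _ hw hσ) (norm_nonneg _)
          (by positivity)
      calc _ ≤ D ξ * (Z * 2) ^ 2 := by gcongr
        _ ≤ _ := by nlinarith [mul_nonneg (sq_nonneg M) hD0]
    · rw [Set.indicator_of_notMem (by exact hξ), mul_zero, add_zero, mul_comm]
      gcongr
      refine hMT _ ?_
      rw [abs_mul, abs_of_pos (by positivity)]
      rw [not_lt, hX, le_div_iff₀ (by positivity)] at hξ
      linarith
  calc ∫ ξ, ‖𝓕 G ξ‖ ^ 2 ≤ ∫ ξ, (M ^ 2 * D ξ + (4 * Z ^ 2) * ({ξ : ℝ | X < |ξ|}.indicator D ξ)) :=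
        integral_mono hI ((hDI.const_mul _).add ((hDI.indicator hS).const_mul _)) hpt
    _ = M ^ 2 * (∫ ξ, D ξ) + 4 * Z ^ 2 * ∫ ξ in {ξ : ℝ | X < |ξ|}, D ξ := by
        rw [integral_add (hDI.const_mul _) ((hDI.indicator hS).const_mul _), integral_const_mul,
          integral_const_mul, integral_indicator hS]
    _ ≤ M ^ 2 * ((κ * (Real.log 4 + 4)) ^ 2 / (2 * σ)) +
          4 * Z ^ 2 * (100 * (κ * (Real.log 4 + 4)) ^ 2 / (σ * X)) := by
        gcongr
        · exact hDE.le.trans (integral_sq_damped_le hκ h.bound hσ)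
        · exact integral_abs_gt_le hκ h.bound hσ hσ1 hX1
    _ ≤ _ := by
        have e1 : (1 + 1 / σ) ^ (2 * κ) = Z ^ 2 := by
          rw [hZ, ← Real.rpow_natCast, ← Real.rpow_mul (by positivity)]; congr 1; push_cast; ring
        have hT0 : 0 < T := by linarith
        have e2 : 1 / X ≤ 7 / T := by
          rw [hX, one_div_div]; gcongr; linarith [Real.pi_lt_d2]
        set Q := (κ * (Real.log 4 + 4)) ^ 2 with hQ
        have hQ0 : 0 ≤ Q := sq_nonneg _
        rw [e1]
        have a1 : M ^ 2 * (Q / (2 * σ)) ≤ Q / σ * M ^ 2 := by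
          rw [mul_comm]; gcongr; linarith
        have a2 : 4 * Z ^ 2 * (100 * Q / (σ * X)) ≤ Q / σ * (2800 * Z ^ 2 / T) := by
          calc _ = 400 * Z ^ 2 * (Q / σ) * (1 / X) := by field_simp; ring
            _ ≤ 400 * Z ^ 2 * (Q / σ) * (7 / T) := by gcongr
            _ = _ := by ring
        rw [mul_add]; exact add_le_add a1 a2

end BlockBound

section LocalBounds

open Metric
open scoped ComplexConjugate

theorem exists_log_on_ball {g : ℂ → ℂ} {c : ℂ} {r : ℝ} (hr : 0 < r)
    (hg : DifferentiableOn ℂ g (ball c r)) (hne : ∀ z ∈ ball c r, g z ≠ 0) :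
    ∃ l : ℂ → ℂ, DifferentiableOn ℂ l (ball c r) ∧ l c = 0 ∧
      ∀ z ∈ ball c r, g z = g c * cexp (l z) := by
  have hd : DifferentiableOn ℂ (fun z => deriv g z / g z) (ball c r) :=
    (hg.deriv isOpen_ball).div hg hne
  obtain ⟨l, hl⟩ := hd.isExactOn_ball
  have hc : c ∈ ball c r := mem_ball_self hr
  refine ⟨fun z => l z - l c,
    fun z hz => ((hl z hz).sub_const _).differentiableAt.differentiableWithinAt,
    sub_self _, fun z hz => ?_⟩
  have hder : ∀ z ∈ ball c r, HasDerivAt (fun z => g z * cexp (-(l z))) 0 z := by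
    intro z hz
    have h1 := (hg.differentiableAt (isOpen_ball.mem_nhds hz)).hasDerivAt
    refine (h1.mul (hl z hz).neg.cexp).congr_deriv ?_
    have := hne z hz
    field_simp
    ring
  have hconst := (convex_ball c r).is_const_of_fderivWithin_eq_zero (𝕜 := ℂ)
    (f := fun z => g z * cexp (-(l z)))
    (fun z hz => (hder z hz).differentiableAt.differentiableWithinAt)
    (fun z hz => by
      rw [fderivWithin_of_isOpen isOpen_ball hz]
      ext; simp [(hder z hz).hasFDerivAt.fderiv]) hz hc
  calc g z = g z * cexp (-(l z)) * cexp (l z) := by rw [mul_assoc, ← Complex.exp_add]; simp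
    _ = g c * cexp (-(l c)) * cexp (l z) := by rw [hconst]
    _ = _ := by rw [mul_assoc, ← Complex.exp_add]; congr 2; ring

/-- Borel–Carathéodory for the logarithm of a zero-free function. -/
theorem exists_log_norm_le {g : ℂ → ℂ} {c : ℂ} {r M : ℝ} (hr : 0 < r) (hM : 0 < M)
    (hg : DifferentiableOn ℂ g (ball c r)) (hne : ∀ z ∈ ball c r, g z ≠ 0)
    (hb : ∀ z ∈ ball c r, ‖g z‖ ≤ Real.exp M * ‖g c‖) :
    ∃ l : ℂ → ℂ, DifferentiableOn ℂ l (ball c r) ∧ l c = 0 ∧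
      (∀ z ∈ ball c r, g z = g c * cexp (l z)) ∧
      ∀ z ∈ ball c r, ‖l z‖ ≤ 2 * M * ‖z - c‖ / (r - ‖z - c‖) := by
  obtain ⟨l, hl, hl0, hle⟩ := exists_log_on_ball hr hg hne
  refine ⟨l, hl, hl0, hle, fun z hz => ?_⟩
  have hc : c ∈ ball c r := mem_ball_self hr
  have hmem : ∀ y ∈ ball (0:ℂ) r, c + y ∈ ball c r := by
    intro y hy; simpa using hy
  have h := borelCaratheodory_zero (f := fun y => l (c + y)) (z := z - c) (R := r) hM ?_ ?_ hr ?_ ?_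
  · simpa using h
  · exact hl.comp (by fun_prop) hmem
  · intro y hy
    have h1 := hb _ (hmem y hy)
    rw [hle _ (hmem y hy), norm_mul, Complex.norm_exp, mul_comm] at h1
    have h2 := le_of_mul_le_mul_right h1 (norm_pos_iff.2 (hne c hc))
    exact Real.exp_le_exp.1 h2
  · simpa [dist_eq_norm] using hz
  · simpa using hl0

theorem norm_logDeriv_le_of_ne_zero {g : ℂ → ℂ} {r M : ℝ} (hr : 0 < r) (hM : 0 < M)
    (hg : DifferentiableOn ℂ g (ball 0 r)) (hne : ∀ z ∈ ball (0:ℂ) r, g z ≠ 0)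
    (hb : ∀ z ∈ ball (0:ℂ) r, ‖g z‖ ≤ Real.exp M * ‖g 0‖) :
    ‖deriv g 0 / g 0‖ ≤ 4 * M / r := by
  obtain ⟨l, hl, hl0, hle, hbd⟩ := exists_log_norm_le hr hM hg hne hb
  have h0 : (0:ℂ) ∈ ball (0:ℂ) r := mem_ball_self hr
  have hld := (hl.differentiableAt (isOpen_ball.mem_nhds h0)).hasDerivAt
  have hgd : HasDerivAt g (g 0 * (cexp (l 0) * deriv l 0)) 0 :=
    (hld.cexp.const_mul (g 0)).congr_of_eventuallyEq
      (Filter.eventuallyEq_of_mem (isOpen_ball.mem_nhds h0) hle)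
  rw [hgd.deriv, hl0, Complex.exp_zero, one_mul, mul_div_cancel_left₀ _ (hne 0 h0)]
  refine hld.le_of_lip' (by positivity) ?_
  filter_upwards [ball_mem_nhds (0:ℂ) (half_pos hr)] with z hz
  have hz' : ‖z‖ < r / 2 := by simpa using hz
  have := hbd z (by simp; linarith)
  rw [hl0, sub_zero]
  rw [sub_zero] at this ⊢
  refine this.trans ?_
  rw [div_le_iff₀ (by linarith)]
  have h3 : 4 * M / r * ‖z‖ * (r / 2) ≤ 4 * M / r * ‖z‖ * (r - ‖z‖) := by
    gcongr; linarith
  refine le_trans (le_of_eq ?_) h3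
  field_simp; ring

/-- Removing a zero by a Blaschke factor. -/
theorem exists_remove_zero {g : ℂ → ℂ} (hg : Differentiable ℂ g) {R B : ℝ} (hR : 0 < R) {ρ : ℂ}
    (hρ : g ρ = 0) (hρR : ‖ρ‖ < R / 2) (h0 : g 0 ≠ 0) (hB : ∀ z ∈ closedBall (0:ℂ) R, ‖g z‖ ≤ B) :
    ∃ g₁ : ℂ → ℂ, Differentiable ℂ g₁ ∧ g₁ 0 ≠ 0 ∧ 2 * ‖g 0‖ ≤ ‖g₁ 0‖ ∧
      (∀ z ∈ closedBall (0:ℂ) R, ‖g₁ z‖ ≤ B) ∧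
      (∀ z ∈ ball (0:ℂ) (R / 2), g₁ z = 0 → g z = 0) ∧
      deriv g 0 / g 0 = deriv g₁ 0 / g₁ 0 + (-1 / ρ + conj ρ / R ^ 2) := by
  have hρ0 : ρ ≠ 0 := fun h => h0 (h ▸ hρ)
  have hRc : (R:ℂ) ≠ 0 := by exact_mod_cast hR.ne'
  set q := dslope g ρ with hq
  have hqd : Differentiable ℂ q := by
    have : DifferentiableOn ℂ q Set.univ :=
      (Complex.differentiableOn_dslope Filter.univ_mem).2 hg.differentiableOn
    exact differentiableOn_univ.1 this
  have hqe : ∀ z, (z - ρ) * q z = g z := by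
    intro z
    have := sub_smul_dslope g ρ z
    rw [smul_eq_mul, hρ, sub_zero] at this
    exact this
  set g₁ : ℂ → ℂ := fun z => q z * ((R ^ 2 - conj ρ * z) / R) with hg₁
  have hd1 : Differentiable ℂ g₁ := by
    rw [hg₁]; exact hqd.mul (by fun_prop)
  have hrel : ∀ z, g z * (R ^ 2 - conj ρ * z) = g₁ z * (R * (z - ρ)) := by
    intro z
    rw [← hqe z, hg₁]
    field_simp
  have hrel0 : g 0 * R = -(g₁ 0 * ρ) := by
    have := hrel 0
    simp only [mul_zero, sub_zero, zero_sub] at this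
    have h2 : (g 0 * R - -(g₁ 0 * ρ)) * R = 0 := by linear_combination this
    rcases mul_eq_zero.1 h2 with h | h
    · exact sub_eq_zero.1 h
    · exact absurd h hRc
  have h10 : g₁ 0 ≠ 0 := fun h => by
    rw [h, zero_mul, neg_zero, mul_eq_zero] at hrel0
    exact hrel0.elim h0 hRc
  have hnonv : ∀ z : ℂ, ‖z‖ ≤ R → (R:ℂ) ^ 2 - conj ρ * z ≠ 0 := by
    intro z hz h
    have h1 : ‖(R:ℂ) ^ 2‖ = ‖conj ρ * z‖ := by rw [sub_eq_zero.1 h]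
    rw [norm_pow, norm_mul, RCLike.norm_conj, norm_real, Real.norm_of_nonneg hR.le] at h1
    nlinarith [norm_nonneg ρ, norm_nonneg z]
  refine ⟨g₁, hd1, h10, ?_, ?_, ?_, ?_⟩
  · have h1 : ‖g 0‖ * R = ‖g₁ 0‖ * ‖ρ‖ := by
      have := congrArg norm hrel0
      rwa [norm_mul, norm_neg, norm_mul, norm_real, Real.norm_of_nonneg hR.le] at this
    have h2 : ‖g₁ 0‖ * ‖ρ‖ ≤ ‖g₁ 0‖ * (R / 2) := by gcongr
    nlinarith
  · intro z hz
    have hcl : closure (ball (0:ℂ) R) = closedBall 0 R := closure_ball _ hR.ne'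
    refine Complex.norm_le_of_forall_mem_frontier_norm_le (U := ball (0:ℂ) R) isBounded_ball
      hd1.diffContOnCl ?_ (by rwa [hcl])
    intro y hy
    rw [frontier_ball _ hR.ne', mem_sphere_zero_iff_norm] at hy
    have hyc : y ∈ closedBall (0:ℂ) R := by simp [hy]
    have h1 : ‖(R:ℂ) ^ 2 - conj ρ * y‖ = R * ‖y - ρ‖ := by
      have e : (R:ℂ) ^ 2 = conj y * y := by
        rw [← normSq_eq_conj_mul_self, normSq_eq_norm_sq, hy]; push_cast; ring
      rw [e, ← sub_mul, ← map_sub, norm_mul, RCLike.norm_conj, hy, mul_comm]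
    have h2 : ‖y - ρ‖ ≠ 0 := by
      rw [norm_ne_zero_iff, sub_ne_zero]
      rintro rfl; rw [hy] at hρR; linarith
    have h3 := congrArg norm (hrel y)
    rw [norm_mul, h1, norm_mul (g₁ y), norm_mul (R:ℂ), norm_real, Real.norm_of_nonneg hR.le] at h3
    have h4 : ‖g y‖ = ‖g₁ y‖ := mul_right_cancel₀ (mul_ne_zero hR.ne' h2) h3
    rw [← h4]; exact hB y hyc
  · intro z hz hz0
    have hzR : ‖z‖ ≤ R := by
      have : ‖z‖ < R / 2 := by simpa using hz
      linarith
    have := hrel z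
    rw [hz0, zero_mul, mul_eq_zero] at this
    exact this.resolve_right (hnonv z hzR)
  · have hA : HasDerivAt (fun z => g z * ((R:ℂ) ^ 2 - conj ρ * z))
        (deriv g 0 * ((R:ℂ) ^ 2 - conj ρ * 0) + g 0 * (0 - conj ρ * 1)) 0 :=
      (hg 0).hasDerivAt.mul ((hasDerivAt_const _ _).sub ((hasDerivAt_id _).const_mul _))
    have hB : HasDerivAt (fun z => g₁ z * ((R:ℂ) * (z - ρ)))
        (deriv g₁ 0 * ((R:ℂ) * (0 - ρ)) + g₁ 0 * ((R:ℂ) * 1)) 0 :=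
      (hd1 0).hasDerivAt.mul (((hasDerivAt_id _).sub_const _).const_mul _)
    have hAB := (hA.congr_of_eventuallyEq (Filter.Eventually.of_forall fun z =>
      (hrel z).symm)).unique hB
    have e0 : g 0 = -(g₁ 0 * ρ) / R := by rw [← hrel0]; field_simp
    have e1 : deriv g 0 = (deriv g₁ 0 * ((R:ℂ) * (0 - ρ)) + g₁ 0 * ((R:ℂ) * 1) +
        g 0 * conj ρ) / (R:ℂ) ^ 2 := by
      field_simp; linear_combination hAB
    rw [e1, e0]
    field_simp
    ring

theorem blaschke_re_nonneg {ρ : ℂ} {R : ℝ} (hρ0 : ρ ≠ 0) (hρR : ‖ρ‖ < R / 2)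
    (hre : ρ.re ≤ 0) : 0 ≤ (-1 / ρ + conj ρ / (R:ℂ) ^ 2).re := by
  have h1 : (-1 / ρ + conj ρ / (R:ℂ) ^ 2) = ((1 / ‖ρ‖ ^ 2 - 1 / R ^ 2 : ℝ) : ℂ) * (-conj ρ) := by
    have e : (1:ℂ) / ρ = conj ρ * ((1 / ‖ρ‖ ^ 2 : ℝ) : ℂ) := by
      rw [one_div, Complex.inv_def, normSq_eq_norm_sq, one_div]
    rw [neg_div, e]; push_cast; ring
  rw [h1, re_ofReal_mul, neg_re, conj_re]
  refine mul_nonneg ?_ (by linarith)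
  have : 0 < ‖ρ‖ := norm_pos_iff.2 hρ0
  rw [sub_nonneg]
  gcongr
  linarith

/-- A function without zeros to the right of the origin has logarithmic derivative at the origin
bounded below in terms of its growth. -/
theorem re_logDeriv_ge {R : ℝ} (hR : 0 < R) (n : ℕ) : ∀ g : ℂ → ℂ, Differentiable ℂ g → g 0 ≠ 0 →
    ∀ M : ℝ, M < n * Real.log 2 → (∀ z ∈ closedBall (0:ℂ) R, ‖g z‖ ≤ Real.exp M * ‖g 0‖) →
    (∀ z ∈ ball (0:ℂ) (R / 2), g z = 0 → z.re ≤ 0) →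
    -(8 * (M + 1) / R) ≤ (deriv g 0 / g 0).re := by
  induction n with
  | zero =>
    intro g hg h0 M hM hb _
    have h1 := hb 0 (by simp [hR.le])
    have : 1 ≤ Real.exp M := by
      have := norm_pos_iff.2 h0
      nlinarith
    have := Real.one_le_exp_iff.1 this
    simp at hM; linarith
  | succ n ih =>
    intro g hg h0 M hM hb hz
    have hM0 : 0 ≤ M := by
      have h1 := hb 0 (by simp [hR.le])
      have : 1 ≤ Real.exp M := by
        have := norm_pos_iff.2 h0
        nlinarith
      exact Real.one_le_exp_iff.1 this
    by_cases hex : ∃ ρ ∈ ball (0:ℂ) (R / 2), g ρ = 0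
    · obtain ⟨ρ, hρ, hgρ⟩ := hex
      have hρR : ‖ρ‖ < R / 2 := by simpa using hρ
      have hρ0 : ρ ≠ 0 := fun h => h0 (h ▸ hgρ)
      obtain ⟨g₁, hd, h10, hdouble, hb1, hz1, hlog⟩ := exists_remove_zero hg hR hgρ hρR h0 hb
      have := ih g₁ hd h10 (M - Real.log 2) (by push_cast at hM; linarith) (fun z hz => ?_)
        (fun z hz h => ?_)
      · rw [hlog, add_re]
        have h2 := blaschke_re_nonneg hρ0 hρR (hz ρ hρ hgρ)
        have h3 : 8 * (M - Real.log 2 + 1) / R ≤ 8 * (M + 1) / R := by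
          have := Real.log_pos one_lt_two
          gcongr; linarith
        linarith
      · refine (hb1 z hz).trans ?_
        rw [Real.exp_sub, Real.exp_log two_pos, div_mul_eq_mul_div, le_div_iff₀ two_pos, mul_assoc]
        gcongr
        linarith
      · exact ‹∀ z ∈ ball (0:ℂ) (R / 2), g z = 0 → z.re ≤ 0› z hz (hz1 z hz h)
    · push Not at hex
      have h1 := norm_logDeriv_le_of_ne_zero (g := g) (r := R / 2) (M := M + 1) (by linarith)
        (by linarith) hg.differentiableOn hex (fun z hz => by
          refine (hb z ?_).trans ?_
          · have : ‖z‖ < R / 2 := by simpa using hz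
            simp; linarith
          · gcongr; linarith)
      have h2 := (abs_le.1 ((abs_re_le_norm _).trans h1)).1
      refine le_trans (le_of_eq ?_) h2
      field_simp; ring

theorem re_logDeriv_ge' {R M : ℝ} (hR : 0 < R) {g : ℂ → ℂ} (hg : Differentiable ℂ g) (h0 : g 0 ≠ 0)
    (hb : ∀ z ∈ closedBall (0:ℂ) R, ‖g z‖ ≤ Real.exp M * ‖g 0‖)
    (hz : ∀ z ∈ ball (0:ℂ) (R / 2), g z = 0 → z.re ≤ 0) :
    -(8 * (M + 1) / R) ≤ (deriv g 0 / g 0).re := by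
  obtain ⟨n, hn⟩ := exists_nat_gt (M / Real.log 2)
  exact re_logDeriv_ge hR n g hg h0 M ((div_lt_iff₀ (Real.log_pos one_lt_two)).1 hn) hb hz

/-- A zero close to the origin on the negative axis forces a large logarithmic derivative. -/
theorem re_logDeriv_ge_of_zero {R M r : ℝ} (hR : 0 < R) {g : ℂ → ℂ} (hg : Differentiable ℂ g)
    (h0 : g 0 ≠ 0) (hb : ∀ z ∈ closedBall (0:ℂ) R, ‖g z‖ ≤ Real.exp M * ‖g 0‖)
    (hz : ∀ z ∈ ball (0:ℂ) (R / 2), g z = 0 → z.re ≤ 0) (hr : 0 < r) (hrR : r < R / 2)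
    (hgr : g (-r : ℝ) = 0) :
    -(8 * (M + 1) / R) + (1 / r - 1 / R) ≤ (deriv g 0 / g 0).re := by
  have hnorm : ‖((-r : ℝ) : ℂ)‖ = r := by rw [norm_real, Real.norm_eq_abs, abs_neg, abs_of_pos hr]
  obtain ⟨g₁, hd, h10, hdouble, hb1, hz1, hlog⟩ :=
    exists_remove_zero hg hR hgr (by rwa [hnorm]) h0 hb
  have h1 := re_logDeriv_ge' (M := M) hR hd h10 (fun z hz => (hb1 z hz).trans (by
    gcongr; linarith [norm_nonneg (g 0)])) (fun z hz' h => hz z hz' (hz1 z hz' h))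
  rw [hlog, add_re]
  have e : (-1 / ((-r : ℝ) : ℂ) + conj ((-r : ℝ) : ℂ) / (R:ℂ) ^ 2).re = 1 / r - r / R ^ 2 := by
    have : (-1 / ((-r : ℝ) : ℂ) + conj ((-r : ℝ) : ℂ) / (R:ℂ) ^ 2) =
        ((1 / r - r / R ^ 2 : ℝ) : ℂ) := by
      rw [conj_ofReal]; push_cast
      have : (r:ℂ) ≠ 0 := by exact_mod_cast hr.ne'
      field_simp
      ring
    rw [this, ofReal_re]
  rw [e]
  have : r / R ^ 2 ≤ 1 / R := by rw [div_le_div_iff₀ (by positivity) hR]; nlinarith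
  linarith

end LocalBounds

section ZetaGrowth

open Filter Topology

/-- The fractional part on `(1, ∞)`, extended by zero. -/
def fractTail (t : ℝ) : ℂ := if 1 < t then ((Int.fract t : ℝ) : ℂ) else 0

theorem norm_fractTail_le (t : ℝ) : ‖fractTail t‖ ≤ 1 := by
  unfold fractTail
  split_ifs
  · rw [norm_real, Real.norm_of_nonneg (Int.fract_nonneg t)]; exact (Int.fract_lt_one t).le
  · simp

theorem measurable_fractTail : Measurable fractTail :=
  Measurable.ite measurableSet_Ioi (measurable_ofReal.comp measurable_fract) measurable_const

theorem differentiableAt_mellin_fractTail {s : ℂ} (hs : s.re < 0) :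
    DifferentiableAt ℂ (mellin fractTail) s := by
  refine mellin_differentiableAt_of_isBigO_rpow (a := 0) (b := s.re - 1) ?_ ?_ hs ?_ (by linarith)
  · refine LocallyIntegrable.locallyIntegrableOn ?_ _
    refine (locallyIntegrable_const (1:ℝ)).mono measurable_fractTail.aestronglyMeasurable
      (ae_of_all _ fun t => by simpa using norm_fractTail_le t)
  · simp only [neg_zero, Real.rpow_zero]
    exact Asymptotics.IsBigO.of_bound 1 (Eventually.of_forall fun t => by
      simpa using norm_fractTail_le t)
  · refine Asymptotics.IsBigO.of_bound 1 ?_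
    filter_upwards [Ioo_mem_nhdsGT (zero_lt_one' ℝ)] with t ht
    rw [fractTail, if_neg (not_lt.2 ht.2.le), norm_zero]; positivity

theorem mellin_fractTail_eq (s : ℂ) :
    mellin fractTail (-s) = ∫ t in Set.Ioi (1:ℝ), ((Int.fract t : ℝ) : ℂ) * (t:ℂ) ^ (-(s + 1)) := by
  have hsub : Set.Ioi (1:ℝ) ⊆ Set.Ioi 0 := Set.Ioi_subset_Ioi zero_le_one
  have h : ∫ t in Set.Ioi (0:ℝ), (t:ℂ) ^ (-s - 1) • fractTail t =
      ∫ t in Set.Ioi (1:ℝ), (t:ℂ) ^ (-s - 1) • fractTail t :=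
    setIntegral_eq_of_subset_of_forall_sdiff_eq_zero measurableSet_Ioi hsub fun t ht => by
      rw [fractTail, if_neg (show ¬ 1 < t from ht.2), smul_zero]
  rw [mellin, h]
  refine setIntegral_congr_fun measurableSet_Ioi fun t ht => ?_
  simp only [fractTail, if_pos (show 1 < t from ht), smul_eq_mul]
  rw [mul_comm, neg_add']

theorem norm_mellin_fractTail_le {s : ℂ} (hs : 1 / 2 ≤ s.re) : ‖mellin fractTail (-s)‖ ≤ 2 := by
  rw [mellin_fractTail_eq]
  have hI : IntegrableOn (fun t : ℝ => t ^ (-(3 / 2) : ℝ)) (Set.Ioi 1) :=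
    integrableOn_Ioi_rpow_of_lt (by norm_num) one_pos
  calc _ ≤ ∫ t in Set.Ioi (1:ℝ), t ^ (-(3 / 2) : ℝ) := by
        refine norm_integral_le_of_norm_le hI ?_
        refine (ae_restrict_iff' measurableSet_Ioi).2 (ae_of_all _ fun t ht => ?_)
        have ht1 : 1 < t := ht
        rw [norm_mul, norm_cpow_eq_rpow_re_of_pos (by linarith), norm_real,
          Real.norm_of_nonneg (Int.fract_nonneg t)]
        calc _ ≤ 1 * t ^ ((-(s + 1)).re) := by
              gcongr; exact (Int.fract_lt_one t).le
          _ ≤ _ := by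
              rw [one_mul]
              refine Real.rpow_le_rpow_of_exponent_le ht1.le ?_
              simp; linarith
    _ = 2 := by rw [integral_Ioi_rpow_of_lt (by norm_num) one_pos]; norm_num

theorem riemannZeta₁_eq_of_one_lt {s : ℂ} (hs : 1 < s.re) :
    riemannZeta₁ s = s - s * (s - 1) * mellin fractTail (-s) := by
  have hs1 : s ≠ 1 := fun h => by rw [h] at hs; simp at hs
  have hs1' : s - 1 ≠ 0 := sub_ne_zero.2 hs1
  have hζ : riemannZeta s = s * ∫ t in Set.Ioi (1:ℝ), ((⌊t⌋₊:ℕ) : ℂ) * (t:ℂ) ^ (-(s + 1)) := by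
    rw [← LSeries_one_eq_riemannZeta hs, LSeries_eq_mul_integral 1 zero_le_one (by simpa using hs)
      ((LSeriesSummable_one_iff).2 hs)]
    · simp
    · refine Asymptotics.IsBigO.of_bound 1 (Eventually.of_forall fun n => ?_)
      simp
  have hlt : (-s).re < -1 := by simpa using hs
  have hI1 : IntegrableOn (fun t : ℝ => (t:ℂ) ^ (-s)) (Set.Ioi 1) :=
    integrableOn_Ioi_cpow_of_lt hlt one_pos
  have hI2 : IntegrableOn (fun t : ℝ => ((Int.fract t : ℝ) : ℂ) * (t:ℂ) ^ (-(s + 1)))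
      (Set.Ioi 1) := by
    have h0 : IntegrableOn (fun t : ℝ => (t:ℂ) ^ (-(s + 1))) (Set.Ioi 1) :=
      integrableOn_Ioi_cpow_of_lt (by simp; linarith) one_pos
    refine Integrable.mono (show Integrable _ (volume.restrict _) from h0)
      ((measurable_ofReal.comp measurable_fract).aestronglyMeasurable.mul h0.1)
      (ae_of_all _ fun t => ?_)
    rw [norm_mul, norm_real, Real.norm_of_nonneg (Int.fract_nonneg t)]
    exact mul_le_of_le_one_left (norm_nonneg _) (Int.fract_lt_one t).le
  have e : ∫ t in Set.Ioi (1:ℝ), ((⌊t⌋₊:ℕ) : ℂ) * (t:ℂ) ^ (-(s + 1)) =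
      1 / (s - 1) - mellin fractTail (-s) := by
    rw [mellin_fractTail_eq]
    have h1 : ∫ t in Set.Ioi (1:ℝ), (t:ℂ) ^ (-s) = 1 / (s - 1) := by
      rw [integral_Ioi_cpow_of_lt hlt one_pos]
      have : -s + 1 ≠ 0 := fun h => hs1' (by linear_combination -h)
      simp
      field_simp
      ring
    rw [← h1, ← integral_sub hI1 hI2]
    refine setIntegral_congr_fun measurableSet_Ioi fun t ht => ?_
    have ht0 : (0:ℝ) < t := lt_trans one_pos ht
    have htc : (t:ℂ) ≠ 0 := by exact_mod_cast ht0.ne'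
    have h2 : (t:ℂ) ^ (-s) = t * (t:ℂ) ^ (-(s + 1)) := by
      rw [show -s = 1 + -(s + 1) by ring, cpow_add _ _ htc, cpow_one]
    have h3 : (t:ℂ) = ((⌊t⌋₊:ℕ):ℂ) + ((Int.fract t : ℝ) : ℂ) := by
      have h4 : ((⌊t⌋₊:ℕ):ℝ) = (⌊t⌋ : ℝ) := natCast_floor_eq_intCast_floor ht0.le
      have h5 := Int.floor_add_fract t
      rw [← h4] at h5
      exact_mod_cast h5.symm
    simp only [h2]
    linear_combination (-(t:ℂ) ^ (-(s + 1))) * h3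
  have h2 : riemannZeta₁ s = (s - 1) * riemannZeta s := by
    rw [riemannZeta_eq_inv_sub_mul hs1]; field_simp
  rw [h2, hζ, e]
  field_simp

theorem riemannZeta₁_eq {s : ℂ} (hs : 0 < s.re) :
    riemannZeta₁ s = s - s * (s - 1) * mellin fractTail (-s) := by
  set U : Set ℂ := {s | 0 < s.re} with hU
  have hUo : IsOpen U := isOpen_lt continuous_const continuous_re
  have hUc : IsPreconnected U := (convex_halfSpace_re_gt 0).isPreconnected
  have h1 : AnalyticOnNhd ℂ riemannZeta₁ U :=
    differentiable_riemannZeta₁.differentiableOn.analyticOnNhd hUo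
  have h2 : AnalyticOnNhd ℂ (fun s => s - s * (s - 1) * mellin fractTail (-s)) U := by
    refine DifferentiableOn.analyticOnNhd (fun z hz => ?_) hUo
    have hm : DifferentiableAt ℂ (fun z => mellin fractTail (-z)) z :=
      (differentiableAt_mellin_fractTail (show (-z).re < 0 from neg_neg_of_pos hz)).comp z
        differentiableAt_id.neg
    exact (differentiableAt_id.sub ((differentiableAt_id.mul
      (differentiableAt_id.sub_const 1)).mul hm)).differentiableWithinAt
  have h3 : riemannZeta₁ =ᶠ[𝓝 2] fun s => s - s * (s - 1) * mellin fractTail (-s) := by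
    filter_upwards [(isOpen_lt continuous_const continuous_re).mem_nhds
      (show (1:ℝ) < (2:ℂ).re by simp)] with z hz
    exact riemannZeta₁_eq_of_one_lt hz
  exact h1.eqOn_of_preconnected_of_eventuallyEq h2 hUc (show (0:ℝ) < (2:ℂ).re by simp) h3 hs

theorem norm_riemannZeta₁_le {s : ℂ} (hs : 1 / 2 ≤ s.re) :
    ‖riemannZeta₁ s‖ ≤ 2 * (1 + ‖s‖) ^ 2 := by
  rw [riemannZeta₁_eq (by linarith)]
  have h1 : ‖s - 1‖ ≤ ‖s‖ + 1 := by simpa using norm_sub_le s 1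
  calc _ ≤ ‖s‖ + ‖s‖ * ‖s - 1‖ * ‖mellin fractTail (-s)‖ := by
        refine (norm_sub_le _ _).trans ?_
        rw [norm_mul, norm_mul]
    _ ≤ ‖s‖ + ‖s‖ * (‖s‖ + 1) * 2 := by
        gcongr; exact norm_mellin_fractTail_le hs
    _ ≤ _ := by nlinarith [norm_nonneg s]

end ZetaGrowth

section ZeroFree

open Metric ArithmeticFunction

theorem riemannZeta₁_eq_mul {s : ℂ} (hs : s ≠ 1) :
    riemannZeta₁ s = (s - 1) * riemannZeta s := by
  rw [riemannZeta_eq_inv_sub_mul hs, mul_inv_cancel_left₀ (sub_ne_zero.2 hs)]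

theorem riemannZeta₁_ne_zero {s : ℂ} (hs : 1 ≤ s.re) : riemannZeta₁ s ≠ 0 := by
  rcases eq_or_ne s 1 with rfl | h
  · rw [riemannZeta₁_one]; exact one_ne_zero
  · rw [riemannZeta₁_eq_mul h]
    exact mul_ne_zero (sub_ne_zero.2 h) (riemannZeta_ne_zero_of_one_le_re hs)

theorem le_norm_riemannZeta_vline {σ : ℝ} (hσ : 0 < σ) (hσ1 : σ ≤ 1) (t : ℝ) :
    σ / 2 ≤ ‖riemannZeta (vline σ t)‖ := by
  have hre : 1 < (vline σ t).re := by rw [vline_re]; linarith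
  have h1 : LSeries 1 (vline σ t) * LSeries (fun n => ((moebius n : ℤ) : ℂ)) (vline σ t) = 1 :=
    LSeries_one_mul_Lseries_moebius hre
  rw [LSeries_one_eq_riemannZeta hre] at h1
  have hsum : Summable fun n : ℕ => if n = 0 then (0:ℝ) else 1 / (n:ℝ) ^ (1 + σ) := by
    refine (Real.summable_one_div_nat_rpow.2 (show 1 < 1 + σ by linarith)).of_nonneg_of_le
      (fun n => ?_) (fun n => ?_) <;> split_ifs <;> first | positivity | rfl
  have h2 : ‖LSeries (fun n => ((moebius n : ℤ) : ℂ)) (vline σ t)‖ ≤ 1 + 1 / σ := by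
    refine le_trans (tsum_of_norm_bounded hsum.hasSum fun n => ?_)
      (realDirichlet_one_le_one_add hσ)
    rw [LSeries.norm_term_eq, vline_re]
    split_ifs with h
    · rfl
    · gcongr
      rw [Complex.norm_intCast]
      exact_mod_cast abs_moebius_le_one
  have h3 := congrArg norm h1
  rw [norm_mul, norm_one] at h3
  have h4 : 1 + 1 / σ ≤ 2 / σ := by
    have : 1 ≤ 1 / σ := (le_div_iff₀ hσ).2 (by linarith)
    calc _ ≤ 1 / σ + 1 / σ := by linarith
      _ = _ := by ring
  have h5 : 1 ≤ ‖riemannZeta (vline σ t)‖ * (2 / σ) := by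
    rw [← h3]; gcongr; exact h2.trans h4
  calc σ / 2 = 1 * (σ / 2) := by ring
    _ ≤ ‖riemannZeta (vline σ t)‖ * (2 / σ) * (σ / 2) := by gcongr
    _ = _ := by field_simp

theorem abs_le_norm_vline_sub_one (σ t : ℝ) : |t| ≤ ‖vline σ t - 1‖ := by
  have := abs_im_le_norm (vline σ t - 1)
  simpa [vline_im] using this

theorem norm_vline_le {σ : ℝ} (hσ : 0 ≤ σ) (hσ1 : σ ≤ 1) (t : ℝ) : ‖vline σ t‖ ≤ 2 + |t| := by
  refine (norm_le_abs_re_add_abs_im _).trans ?_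
  rw [vline_re, vline_im, abs_of_nonneg (by linarith)]; linarith

theorem vline_ne_one {σ : ℝ} (hσ : 0 < σ) (t : ℝ) : vline σ t ≠ 1 := fun h => by
  have := vline_re σ t
  rw [h, one_re] at this; linarith

theorem le_norm_riemannZeta₁_vline {σ t : ℝ} (hσ : 0 < σ) (hσ1 : σ ≤ 1) (ht : 1 ≤ |t|) :
    σ / 2 ≤ ‖riemannZeta₁ (vline σ t)‖ := by
  rw [riemannZeta₁_eq_mul (vline_ne_one hσ t), norm_mul]
  calc σ / 2 = 1 * (σ / 2) := by ring
    _ ≤ _ := by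
      gcongr
      · exact ht.trans (abs_le_norm_vline_sub_one σ t)
      · exact le_norm_riemannZeta_vline hσ hσ1 t

/-- Growth of `(s - 1) ζ(s)` relative to its value slightly to the right of the line `re s = 1`. -/
theorem norm_riemannZeta₁_le_exp_mul {σ t : ℝ} (hσ : 0 < σ) (hσ1 : σ ≤ 1) (ht : 1 ≤ |t|) {z : ℂ}
    (hz : 1 / 2 ≤ z.re) (hzt : ‖z - vline σ t‖ ≤ 3) :
    ‖riemannZeta₁ z‖ ≤ Real.exp (4 * Real.log (|t| + 6) + Real.log (1 / σ)) *
      ‖riemannZeta₁ (vline σ t)‖ := by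
  have h1 : ‖z‖ ≤ 5 + |t| := by
    have := norm_add_le (z - vline σ t) (vline σ t)
    rw [sub_add_cancel] at this
    linarith [norm_vline_le hσ.le hσ1 t]
  have h2 : (0:ℝ) < |t| + 6 := by positivity
  have h3 : Real.exp (4 * Real.log (|t| + 6) + Real.log (1 / σ)) = (|t| + 6) ^ 4 * (1 / σ) := by
    rw [Real.exp_add, Real.exp_log (by positivity), show (4:ℝ) = ((4:ℕ):ℝ) by norm_num,
      ← Real.log_pow, Real.exp_log (by positivity)]
  rw [h3]
  calc _ ≤ 2 * (1 + ‖z‖) ^ 2 := norm_riemannZeta₁_le hz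
    _ ≤ 2 * (|t| + 6) ^ 2 := by
        have : 1 + ‖z‖ ≤ |t| + 6 := by linarith
        gcongr
    _ ≤ (|t| + 6) ^ 4 / 2 := by
        have : (7:ℝ) ^ 2 ≤ (|t| + 6) ^ 2 := by gcongr; linarith
        nlinarith
    _ = (|t| + 6) ^ 4 * (1 / σ) * (σ / 2) := by field_simp
    _ ≤ _ := by gcongr; exact le_norm_riemannZeta₁_vline hσ hσ1 ht

theorem LSeries_vonMangoldt_eq_sub {s : ℂ} (hs : 1 < s.re) :
    LSeries (fun n => (Λ n : ℂ)) s = 1 / (s - 1) - deriv riemannZeta₁ s / riemannZeta₁ s := by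
  have hs1 : s ≠ 1 := fun h => by rw [h] at hs; simp at hs
  have hs2 : s - 1 ≠ 0 := sub_ne_zero.2 hs1
  have hζ := riemannZeta_ne_zero_of_one_le_re hs.le
  rw [LSeries_vonMangoldt_eq_deriv_riemannZeta_div hs]
  have h1 : HasDerivAt riemannZeta₁ (1 * riemannZeta s + (s - 1) * deriv riemannZeta s) s := by
    refine (((hasDerivAt_id s).sub_const 1).mul
      (differentiableAt_riemannZeta hs1).hasDerivAt).congr_of_eventuallyEq ?_
    filter_upwards [isOpen_ne.mem_nhds hs1] with z hz
    exact riemannZeta₁_eq_mul hz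
  rw [h1.deriv, riemannZeta₁_eq_mul hs1]
  field_simp
  ring

theorem re_LSeries_vonMangoldt_combination {σ : ℝ} (hσ : 0 < σ) (t : ℝ) :
    0 ≤ 3 * (LSeries (fun n => (Λ n : ℂ)) (vline σ 0)).re +
      4 * (LSeries (fun n => (Λ n : ℂ)) (vline σ t)).re +
      (LSeries (fun n => (Λ n : ℂ)) (vline σ (2 * t))).re := by
  have hS : ∀ u : ℝ, LSeriesSummable (fun n => (Λ n : ℂ)) (vline σ u) := fun u =>
    LSeriesSummable_vonMangoldt (by rw [vline_re]; linarith)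
  have hR : ∀ u : ℝ, HasSum (fun n => (LSeries.term (fun n => (Λ n : ℂ)) (vline σ u) n).re)
      (LSeries (fun n => (Λ n : ℂ)) (vline σ u)).re := fun u => hasSum_re (hS u).hasSum
  refine (((hR 0).mul_left 3).add ((hR t).mul_left 4) |>.add (hR (2 * t))).nonneg fun n => ?_
  rcases Nat.eq_zero_or_pos n with rfl | hn
  · simp
  have key : ∀ u : ℝ, (LSeries.term (fun n => (Λ n : ℂ)) (vline σ u) n).re =
      Λ n * (n:ℝ) ^ (-(1 + σ)) * Real.cos (u * Real.log n) := by
    intro u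
    have hn0 : (0:ℝ) < n := by exact_mod_cast hn
    rw [LSeries.term_of_ne_zero hn.ne', div_eq_mul_inv, ← cpow_neg, re_ofReal_mul, mul_assoc]
    congr 1
    rw [← ofReal_natCast, cpow_def_of_ne_zero (by exact_mod_cast hn0.ne'), ← ofReal_log hn0.le,
      exp_re, re_ofReal_mul, im_ofReal_mul, neg_re, neg_im, vline_re, vline_im,
      Real.rpow_def_of_pos hn0, mul_neg, mul_neg, Real.cos_neg, mul_comm u]
  simp only [key]
  rw [zero_mul, Real.cos_zero, mul_assoc 2 t, Real.cos_two_mul]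
  have h1 : 0 ≤ Λ n * (n:ℝ) ^ (-(1 + σ)) := mul_nonneg vonMangoldt_nonneg (by positivity)
  have h2 := mul_nonneg h1 (sq_nonneg (1 + Real.cos (t * Real.log n)))
  nlinarith

theorem exists_re_LSeries_vonMangoldt_le : ∃ C : ℝ, 0 < C ∧ ∀ σ : ℝ, 0 < σ → σ ≤ 1 →
    (LSeries (fun n => (Λ n : ℂ)) (vline σ 0)).re ≤ 1 / σ + C := by
  have hK : IsCompact (reProdIm (Set.Icc (1:ℝ) 2) {0}) :=
    isCompact_Icc.reProdIm isCompact_singleton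
  obtain ⟨C, hC⟩ := hK.exists_bound_of_continuousOn
      (f := fun s => deriv riemannZeta₁ s / riemannZeta₁ s)
    (ContinuousOn.div (differentiable_riemannZeta₁.contDiff (n := 1)
      |>.continuous_deriv le_rfl).continuousOn
      differentiable_riemannZeta₁.continuous.continuousOn fun s hs => riemannZeta₁_ne_zero hs.1.1)
  refine ⟨max C 1, by positivity, fun σ hσ hσ1 => ?_⟩
  have hre : 1 < (vline σ 0).re := by rw [vline_re]; linarith
  rw [LSeries_vonMangoldt_eq_sub hre, sub_re]
  have h1 : (1 / (vline σ 0 - 1)).re = 1 / σ := by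
    have : vline σ 0 - 1 = (σ : ℂ) := by simp [vline]
    rw [this, ← ofReal_one, ← ofReal_div, ofReal_re]
  have h2 := hC (vline σ 0) ⟨by rw [Set.mem_preimage, vline_re]; constructor <;> linarith,
    by rw [Set.mem_preimage, vline_im]; rfl⟩
  have h3 := (abs_le.1 ((abs_re_le_norm _).trans h2)).1
  rw [h1]
  linarith [le_max_left C 1]

theorem riemannZeta₁_shift_bound {σ t : ℝ} (hσ : 0 < σ) (hσ1 : σ ≤ 1) (ht : 1 ≤ |t|) :
    Differentiable ℂ (fun z => riemannZeta₁ (vline σ t + z)) ∧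
    riemannZeta₁ (vline σ t + 0) ≠ 0 ∧
    (∀ z ∈ closedBall (0:ℂ) (1 / 2), ‖riemannZeta₁ (vline σ t + z)‖ ≤
      Real.exp (4 * Real.log (|t| + 6) + Real.log (1 / σ)) * ‖riemannZeta₁ (vline σ t + 0)‖) ∧
    (∀ z ∈ ball (0:ℂ) (1 / 2 / 2), riemannZeta₁ (vline σ t + z) = 0 → z.re ≤ 0) ∧
    (LSeries (fun n => (Λ n : ℂ)) (vline σ t)).re ≤
      1 - (deriv (fun z => riemannZeta₁ (vline σ t + z)) 0 / riemannZeta₁ (vline σ t + 0)).re := by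
  have hre : 1 < (vline σ t).re := by rw [vline_re]; linarith
  refine ⟨differentiable_riemannZeta₁.comp (differentiable_const _ |>.add differentiable_id),
    by rw [add_zero]; exact riemannZeta₁_ne_zero hre.le, fun z hz => ?_, fun z _ h => ?_, ?_⟩
  · have hz' : ‖z‖ ≤ 1 / 2 := by simpa using hz
    rw [add_zero]
    refine norm_riemannZeta₁_le_exp_mul hσ hσ1 ht ?_ (by rw [add_sub_cancel_left]; linarith)
    rw [add_re, vline_re]
    linarith [(abs_le.1 ((abs_re_le_norm z).trans hz')).1]
  · by_contra! hz
    exact riemannZeta₁_ne_zero (by rw [add_re, vline_re]; linarith) h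
  · rw [deriv_comp_const_add, add_zero, LSeries_vonMangoldt_eq_sub hre, sub_re]
    gcongr
    refine (re_le_norm _).trans ?_
    rw [norm_div, norm_one]
    exact div_le_one_of_le₀ (ht.trans (abs_le_norm_vline_sub_one σ t)) (norm_nonneg _)

theorem re_LSeries_vonMangoldt_vline_le {σ t : ℝ} (hσ : 0 < σ) (hσ1 : σ ≤ 1) (ht : 1 ≤ |t|) :
    (LSeries (fun n => (Λ n : ℂ)) (vline σ t)).re ≤
      17 + 64 * Real.log (|t| + 6) + 16 * Real.log (1 / σ) := by
  obtain ⟨h1, h2, h3, h4, h5⟩ := riemannZeta₁_shift_bound hσ hσ1 ht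
  have := re_logDeriv_ge' (by norm_num) h1 h2 h3 h4
  linarith

theorem re_LSeries_vonMangoldt_vline_le_of_zero {σ t r : ℝ} (hσ : 0 < σ) (hσ1 : σ ≤ 1)
    (ht : 1 ≤ |t|) (hr : 0 < r) (hr1 : r < 1 / 4) (h0 : riemannZeta₁ (vline (σ - r) t) = 0) :
    (LSeries (fun n => (Λ n : ℂ)) (vline σ t)).re ≤
      19 + 64 * Real.log (|t| + 6) + 16 * Real.log (1 / σ) - 1 / r := by
  obtain ⟨h1, h2, h3, h4, h5⟩ := riemannZeta₁_shift_bound hσ hσ1 ht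
  have := re_logDeriv_ge_of_zero (r := r) (by norm_num) h1 h2 h3 h4 hr (by linarith) (by
    rw [← h0]; congr 1; simp only [vline]; push_cast; ring)
  linarith

end ZeroFree

section ZetaLog

open Metric ArithmeticFunction

theorem one_le_log_abs_add_six (t : ℝ) : 1 ≤ Real.log (|t| + 6) := by
  rw [Real.le_log_iff_exp_le (by positivity)]
  linarith [Real.exp_one_lt_d9, abs_nonneg t]

/-- The classical zero-free region. -/
theorem exists_riemannZeta₁_zeroFree : ∃ c : ℝ, 0 < c ∧ c ≤ 1 / 4 ∧ ∀ s : ℂ, 1 ≤ |s.im| →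
    1 - c / Real.log (|s.im| + 6) < s.re → riemannZeta₁ s ≠ 0 := by
  obtain ⟨C, hC, hCb⟩ := exists_re_LSeries_vonMangoldt_le
  set b : ℝ := 1 / (2 * (3 * C + 717)) with hb
  have hK : 0 < 3 * C + 717 := by positivity
  have hb0 : 0 < b := by positivity
  have hb1 : b ≤ 1 / 8 := by
    rw [hb]; exact one_div_le_one_div_of_le (by norm_num) (by linarith)
  have hbK : b * (3 * C + 717) = 1 / 2 := by rw [hb]; field_simp
  have hb2 : b ^ 2 ≤ 1 / 64 := by nlinarith
  refine ⟨b ^ 2 / 7, by positivity, by linarith, fun s hs hre h0 => ?_⟩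
  set ℓ := Real.log (|s.im| + 6) with hℓ
  have hℓ1 : 1 ≤ ℓ := one_le_log_abs_add_six _
  have hℓ0 : 0 < ℓ := by linarith
  set σ := b ^ 2 / ℓ with hσ
  have hσ0 : 0 < σ := by positivity
  have hσ1 : σ ≤ 1 / 64 := (div_le_self (by positivity) hℓ1).trans hb2
  have hs1 : s.re < 1 := by
    by_contra! h; exact riemannZeta₁_ne_zero h h0
  set r := 1 + σ - s.re with hr
  have hr0 : 0 < r := by linarith
  have hrσ : r < 8 / 7 * σ := by
    have : b ^ 2 / 7 / ℓ = σ / 7 := by rw [hσ]; ring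
    rw [this] at hre; linarith
  have hv : vline (σ - r) s.im = s := by
    apply Complex.ext
    · rw [vline_re]; ring
    · rw [vline_im]
  have h1 := re_LSeries_vonMangoldt_vline_le_of_zero hσ0 (by linarith) hs hr0 (by linarith)
    (by rw [hv]; exact h0)
  have h2 := re_LSeries_vonMangoldt_vline_le (t := 2 * s.im) hσ0 (by linarith)
    (by rw [abs_mul, abs_two]; linarith)
  have h3 := hCb σ hσ0 (by linarith)
  have h4 := re_LSeries_vonMangoldt_combination hσ0 s.im
  rw [← hℓ] at h1
  have h5 : Real.log (|2 * s.im| + 6) ≤ 2 * ℓ := by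
    rw [hℓ, show (2:ℝ) = ((2:ℕ):ℝ) by norm_num, ← Real.log_pow]
    refine Real.log_le_log (by positivity) ?_
    rw [abs_mul, Nat.abs_cast]; push_cast
    nlinarith [abs_nonneg s.im]
  have h6 : Real.log (1 / σ) ≤ 3 * ℓ / b := by
    have e : 1 / σ = ℓ * (1 / b) ^ 2 := by rw [hσ]; field_simp
    rw [e, Real.log_mul hℓ0.ne' (by positivity), Real.log_pow]
    have e1 := Real.log_le_sub_one_of_pos hℓ0
    have e2 := Real.log_le_sub_one_of_pos (show 0 < 1 / b by positivity)
    have e3 : ℓ ≤ ℓ / b := by rw [le_div_iff₀ hb0]; nlinarith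
    have e4 : 1 / b ≤ ℓ / b := by gcongr
    have e5 : 3 * ℓ / b = 3 * (ℓ / b) := by ring
    rw [e5]; push_cast; linarith
  have h7 : 4 / r ≤ 3 / σ + 3 * C + 93 + 384 * ℓ + 80 * (3 * ℓ / b) := by
    have e1 : 4 / r = 4 * (1 / r) := by ring
    have e2 : 3 / σ = 3 * (1 / σ) := by ring
    rw [e1, e2]; linarith
  have h8 : 3.5 / σ < 4 / r := by
    rw [div_lt_div_iff₀ hσ0 hr0]; linarith
  have h9 : 3 * C + 93 + 384 * ℓ + 80 * (3 * ℓ / b) ≤ (3 * C + 717) * (ℓ / b) := by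
    have e1 : ℓ ≤ ℓ / b := by rw [le_div_iff₀ hb0]; nlinarith
    have e2 : 80 * (3 * ℓ / b) = 240 * (ℓ / b) := by ring
    rw [e2]; nlinarith
  have h10 : (3 * C + 717) * (ℓ / b) = 0.5 / σ := by
    have : 3 * C + 717 = 1 / 2 / b := by rw [← hbK]; field_simp
    rw [this, hσ]; field_simp; norm_num
  have h11 : 3.5 / σ = 3 / σ + 0.5 / σ := by ring
  linarith

theorem log_sq_mul_le {σ ℓ : ℝ} (hσ : 0 < σ) (hσ1 : σ ≤ 1) :
    σ * ℓ * Real.log (1 / σ) ≤ 2 + σ * ℓ ^ 2 := by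
  have h0 : 0 ≤ Real.log (1 / σ) := Real.log_nonneg ((le_div_iff₀ hσ).2 (by linarith))
  have h1 : Real.log (1 / σ) ≤ 2 * (1 / Real.sqrt σ) := by
    have h2 := Real.log_le_sub_one_of_pos (show 0 < 1 / Real.sqrt σ by positivity)
    have h3 : 1 / σ = (1 / Real.sqrt σ) ^ 2 := by rw [div_pow, Real.sq_sqrt hσ.le, one_pow]
    rw [h3, Real.log_pow]; push_cast; linarith
  have h4 : σ * Real.log (1 / σ) ^ 2 ≤ 4 := by
    calc σ * Real.log (1 / σ) ^ 2 ≤ σ * (2 * (1 / Real.sqrt σ)) ^ 2 := by gcongr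
      _ = 4 := by rw [mul_pow, div_pow, Real.sq_sqrt hσ.le]; field_simp; norm_num
  nlinarith [mul_nonneg hσ.le (sq_nonneg (ℓ - Real.log (1 / σ))), mul_nonneg hσ.le (sq_nonneg ℓ)]

theorem exists_abs_log_riemannZeta₁_sub_le : ∃ C : ℝ, 0 < C ∧ ∀ σ₁ σ₂ t : ℝ, 0 < σ₁ → σ₁ ≤ σ₂ →
    σ₂ ≤ 1 → |Real.log ‖riemannZeta₁ (vline σ₁ t)‖ - Real.log ‖riemannZeta₁ (vline σ₂ t)‖| ≤
      C * (1 + σ₂ * Real.log (|t| + 6) ^ 2) := by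
  obtain ⟨c, hc, hc1, hfree⟩ := exists_riemannZeta₁_zeroFree
  have hK : IsCompact (reProdIm (Set.Icc (1:ℝ) 2) (Set.Icc (-3:ℝ) 3)) :=
    isCompact_Icc.reProdIm isCompact_Icc
  obtain ⟨C, hC⟩ := hK.exists_bound_of_continuousOn (f := fun s => Real.log ‖riemannZeta₁ s‖)
    (ContinuousOn.log differentiable_riemannZeta₁.continuous.norm.continuousOn
      fun s hs => norm_ne_zero_iff.2 (riemannZeta₁_ne_zero hs.1.1))
  refine ⟨2 * max C 1 + 20 / c, by positivity, fun σ₁ σ₂ t h1 h12 h2 => ?_⟩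
  have hσ₂ : 0 < σ₂ := h1.trans_le h12
  set ℓ := Real.log (|t| + 6) with hℓ
  have hℓ1 : 1 ≤ ℓ := one_le_log_abs_add_six t
  have hY : 1 ≤ 1 + σ₂ * ℓ ^ 2 := le_add_of_nonneg_right (by positivity)
  have hm : 0 < max C 1 := by positivity
  rcases le_or_gt |t| 3 with ht | ht
  · have hmem : ∀ σ : ℝ, 0 < σ → σ ≤ 1 → |Real.log ‖riemannZeta₁ (vline σ t)‖| ≤ C := by
      intro σ hσ hσ1
      refine hC _ ⟨?_, ?_⟩
      · rw [Set.mem_preimage, vline_re]; constructor <;> linarith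
      · rw [Set.mem_preimage, vline_im]; exact abs_le.1 ht
    calc _ ≤ |Real.log ‖riemannZeta₁ (vline σ₁ t)‖| + |Real.log ‖riemannZeta₁ (vline σ₂ t)‖| :=
          abs_sub _ _
      _ ≤ C + C := add_le_add (hmem _ h1 (h12.trans h2)) (hmem _ hσ₂ h2)
      _ ≤ (2 * max C 1 + 20 / c) * 1 := by
          have : 0 < 20 / c := by positivity
          linarith [le_max_left C 1]
      _ ≤ _ := by gcongr
  set η := c / (2 * ℓ) with hη
  have hη0 : 0 < η := by positivity
  have hη1 : η ≤ 1 / 8 := by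
    rw [hη, div_le_iff₀ (by positivity)]; nlinarith
  have hR : 0 < σ₂ + η := by positivity
  have hball : ∀ z ∈ ball (vline σ₂ t) (σ₂ + η), 1 - η < z.re ∧ 1 ≤ |z.im| ∧ |z.im| ≤ |t| + 2 ∧
      ‖z - vline σ₂ t‖ ≤ 3 := by
    intro z hz
    rw [mem_ball, dist_eq_norm] at hz
    have e1 := (abs_re_le_norm _).trans_lt hz
    have e2 := (abs_im_le_norm _).trans_lt hz
    rw [sub_re, vline_re] at e1
    rw [sub_im, vline_im] at e2
    refine ⟨by linarith [(abs_lt.1 e1).1], ?_, ?_, by linarith⟩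
    · have := abs_sub_abs_le_abs_sub t z.im
      rw [abs_sub_comm] at this; linarith
    · have := abs_sub_abs_le_abs_sub z.im t
      linarith
  have hM : 0 < 4 * ℓ + Real.log (1 / σ₂) := by
    have : 0 ≤ Real.log (1 / σ₂) := Real.log_nonneg ((le_div_iff₀ hσ₂).2 (by linarith))
    linarith
  obtain ⟨l, -, -, hle, hlb⟩ := exists_log_norm_le hR hM
    (differentiable_riemannZeta₁.differentiableOn (s := ball (vline σ₂ t) (σ₂ + η)))
    (fun z hz => by
      obtain ⟨e1, e2, e3, -⟩ := hball z hz
      refine hfree z e2 (lt_of_le_of_lt ?_ e1)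
      have e4 : Real.log (|z.im| + 6) ≤ 2 * ℓ := by
        rw [hℓ, show (2:ℝ) = ((2:ℕ):ℝ) by norm_num, ← Real.log_pow]
        refine Real.log_le_log (by positivity) ?_
        nlinarith [abs_nonneg t]
      have e5 := one_le_log_abs_add_six z.im
      have : η ≤ c / Real.log (|z.im| + 6) := by rw [hη]; gcongr
      linarith)
    (fun z hz => by
      obtain ⟨e1, e2, e3, e4⟩ := hball z hz
      exact norm_riemannZeta₁_le_exp_mul hσ₂ h2 (by linarith) (by linarith) e4)
  have hdiff : ‖vline σ₁ t - vline σ₂ t‖ = σ₂ - σ₁ := by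
    have : vline σ₁ t - vline σ₂ t = ((σ₁ - σ₂ : ℝ) : ℂ) := by
      simp only [vline]; push_cast; ring
    rw [this, norm_real, Real.norm_eq_abs, abs_of_nonpos (by linarith)]; ring
  have hz1 : vline σ₁ t ∈ ball (vline σ₂ t) (σ₂ + η) := by
    rw [mem_ball, dist_eq_norm, hdiff]; linarith
  have hb := hlb _ hz1
  rw [hle _ hz1, norm_mul, norm_exp, Real.log_mul (norm_ne_zero_iff.2 (riemannZeta₁_ne_zero
    (by rw [vline_re]; linarith))) (Real.exp_pos _).ne', Real.log_exp, add_sub_cancel_left]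
  refine (abs_re_le_norm _).trans (hb.trans ?_)
  rw [hdiff]
  have h5 := log_sq_mul_le (ℓ := ℓ) hσ₂ h2
  calc _ ≤ 2 * (4 * ℓ + Real.log (1 / σ₂)) * σ₂ / η := by
        gcongr <;> linarith
    _ = 4 / c * (4 * (σ₂ * ℓ ^ 2) + σ₂ * ℓ * Real.log (1 / σ₂)) := by
        rw [hη]; field_simp; ring
    _ ≤ 4 / c * (5 * (1 + σ₂ * ℓ ^ 2)) := by
        gcongr; linarith
    _ = 20 / c * (1 + σ₂ * ℓ ^ 2) := by ring
    _ ≤ _ := by gcongr; linarith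

/-- Away from the pole, `log |ζ|` varies little near the line `re s = 1`. -/
theorem exists_abs_log_riemannZeta_sub_le : ∃ C : ℝ, 0 < C ∧ ∀ σ₁ σ₂ t : ℝ, 0 < σ₁ → σ₁ ≤ σ₂ →
    σ₂ ≤ 1 → σ₂ ≤ |t| →
    |Real.log ‖riemannZeta (vline σ₁ t)‖ - Real.log ‖riemannZeta (vline σ₂ t)‖| ≤
      C * (1 + σ₂ * Real.log (|t| + 6) ^ 2) := by
  obtain ⟨C, hC, hCb⟩ := exists_abs_log_riemannZeta₁_sub_le
  refine ⟨C + 1, by positivity, fun σ₁ σ₂ t h1 h12 h2 ht => ?_⟩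
  have hσ₂ : 0 < σ₂ := h1.trans_le h12
  have ht0 : 0 < |t| := hσ₂.trans_le ht
  have hnorm : ∀ σ : ℝ, ‖vline σ t - 1‖ ^ 2 = σ ^ 2 + t ^ 2 := by
    intro σ
    rw [← normSq_eq_norm_sq, normSq_apply, sub_re, sub_im, vline_re, vline_im, one_re, one_im]
    ring
  have hpos : ∀ σ : ℝ, 0 < ‖vline σ t - 1‖ := fun σ =>
    ht0.trans_le (abs_le_norm_vline_sub_one σ t)
  have hlog : ∀ σ : ℝ, 0 < σ → Real.log ‖riemannZeta (vline σ t)‖ =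
      Real.log ‖riemannZeta₁ (vline σ t)‖ - Real.log ‖vline σ t - 1‖ := by
    intro σ hσ
    rw [riemannZeta₁_eq_mul (vline_ne_one hσ t), norm_mul, Real.log_mul (hpos σ).ne'
      (norm_ne_zero_iff.2 (riemannZeta_ne_zero_of_one_le_re (by rw [vline_re]; linarith)))]
    ring
  have h3 : Real.log ‖vline σ₁ t - 1‖ ≤ Real.log ‖vline σ₂ t - 1‖ := by
    refine Real.log_le_log (hpos _) (abs_le_of_sq_le_sq' ?_ (norm_nonneg _)).2
    rw [hnorm, hnorm]; gcongr
  have h4 : Real.log ‖vline σ₂ t - 1‖ ≤ Real.log ‖vline σ₁ t - 1‖ + 1 := by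
    have h5 : ‖vline σ₂ t - 1‖ ≤ 2 * ‖vline σ₁ t - 1‖ := by
      refine (abs_le_of_sq_le_sq' ?_ (by positivity)).2
      rw [mul_pow, hnorm, hnorm]
      have : σ₂ ^ 2 ≤ t ^ 2 := by rw [← sq_abs t]; gcongr
      nlinarith [sq_nonneg σ₁, sq_nonneg t]
    have h6 := Real.log_le_log (hpos _) h5
    rw [Real.log_mul two_ne_zero (hpos _).ne'] at h6
    linarith [Real.log_two_lt_d9]
  have h7 := hCb σ₁ σ₂ t h1 h12 h2
  rw [hlog _ h1, hlog _ hσ₂]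
  have h8 : 0 ≤ σ₂ * Real.log (|t| + 6) ^ 2 := by positivity
  rw [abs_le] at h7 ⊢
  constructor <;> nlinarith [h7.1, h7.2]

end ZetaLog

section SineSeries

open AddCircle

theorem integral_exp_mul_sin (k : ℤ) :
    ∫ x in (0:ℝ)..1, cexp (-(2 * Real.pi * k * I) * x) * ((2 * Real.sin (Real.pi * x) : ℝ) : ℂ) =
      ((4 / Real.pi / (1 - 4 * (k:ℝ) ^ 2) : ℝ) : ℂ) := by
  have hpi : (Real.pi : ℂ) ≠ 0 := by exact_mod_cast Real.pi_ne_zero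
  have h1 : ∀ m : ℤ, Odd m → (m:ℂ) ≠ 0 := by
    intro m hm h
    have : m = 0 := by exact_mod_cast h
    rw [this] at hm; exact absurd hm (by decide)
  have hI : ∀ m : ℤ, Odd m → ∫ x in (0:ℝ)..1, cexp ((Real.pi * m * I) * x) =
      -2 / (Real.pi * m * I) := by
    intro m hm
    have hc : (Real.pi * m * I : ℂ) ≠ 0 := mul_ne_zero (mul_ne_zero hpi (h1 m hm)) I_ne_zero
    rw [integral_exp_mul_complex hc]
    congr 1
    obtain ⟨j, rfl⟩ := hm
    have : (Real.pi * ((2 * j + 1 : ℤ) : ℂ) * I * ((1:ℝ):ℂ)) = Real.pi * I +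
        j * (2 * Real.pi * I) := by
      push_cast; ring
    rw [this, Complex.exp_add, exp_pi_mul_I, exp_int_mul_two_pi_mul_I]
    simp; norm_num
  have e : ∀ x : ℝ, cexp (-(2 * Real.pi * k * I) * x) * ((2 * Real.sin (Real.pi * x) : ℝ) : ℂ) =
      -I * cexp ((Real.pi * ((1 - 2 * k : ℤ) : ℂ) * I) * x) +
        I * cexp ((Real.pi * ((-1 - 2 * k : ℤ) : ℂ) * I) * x) := by
    intro x
    have e1 : cexp ((Real.pi * ((1 - 2 * k : ℤ) : ℂ) * I) * x) =
        cexp (-(2 * Real.pi * k * I) * x) * cexp (Real.pi * x * I) := by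
      rw [← Complex.exp_add]; congr 1; push_cast; ring
    have e2 : cexp ((Real.pi * ((-1 - 2 * k : ℤ) : ℂ) * I) * x) =
        cexp (-(2 * Real.pi * k * I) * x) * cexp (-(Real.pi * x) * I) := by
      rw [← Complex.exp_add]; congr 1; push_cast; ring
    rw [e1, e2]
    push_cast
    rw [Complex.sin]
    ring
  simp_rw [e]
  rw [intervalIntegral.integral_add (Continuous.intervalIntegrable (by fun_prop) _ _)
    (Continuous.intervalIntegrable (by fun_prop) _ _), intervalIntegral.integral_const_mul,
    intervalIntegral.integral_const_mul, hI _ ⟨-k, by ring⟩, hI _ ⟨-1 - k, by ring⟩]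
  have o1 := h1 (1 - 2 * k) ⟨-k, by ring⟩
  have o2 := h1 (-1 - 2 * k) ⟨-1 - k, by ring⟩
  have o3 : (1 - 4 * (k:ℂ) ^ 2) = -(((1 - 2 * k : ℤ) : ℂ) * ((-1 - 2 * k : ℤ) : ℂ)) := by
    push_cast; ring
  have o4 : ((4 / Real.pi / (1 - 4 * (k:ℝ) ^ 2) : ℝ) : ℂ) = 4 / Real.pi /
      -(((1 - 2 * k : ℤ) : ℂ) * ((-1 - 2 * k : ℤ) : ℂ)) := by
    rw [← o3]; push_cast; ring
  rw [o4]
  have o5 : ((1 - 2 * k : ℤ) : ℂ) - ((-1 - 2 * k : ℤ) : ℂ) = 2 := by push_cast; ring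
  have hI0 := I_ne_zero
  generalize ((1 - 2 * k : ℤ) : ℂ) = p at *
  generalize ((-1 - 2 * k : ℤ) : ℂ) = q at *
  field_simp
  linear_combination (-2) * o5

theorem summable_sine_coeff :
    Summable fun k : ℤ => ((4 / Real.pi / (1 - 4 * (k:ℝ) ^ 2) : ℝ) : ℂ) := by
  refine Summable.of_norm_bounded_eventually
    (g := fun k : ℤ => 4 / Real.pi * (1 / (k:ℝ) ^ 2))
    ((Real.summable_one_div_int_pow.2 one_lt_two).mul_left _) ?_
  have : ({0}:Set ℤ)ᶜ ∈ Filter.cofinite := (Set.finite_singleton 0).compl_mem_cofinite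
  filter_upwards [this] with k hk
  have hk1 : (1:ℝ) ≤ (k:ℝ) ^ 2 := by
    have : (1:ℤ) ≤ k ^ 2 := Int.one_le_abs (pow_ne_zero 2 hk) |>.trans
      (by rw [abs_of_nonneg (sq_nonneg k)])
    exact_mod_cast this
  rw [norm_real, Real.norm_eq_abs, abs_div, abs_of_pos (by positivity : 0 < 4 / Real.pi),
    abs_of_neg (by linarith), div_eq_mul_one_div (4 / Real.pi)]
  gcongr
  linarith

theorem hasSum_two_mul_sin {x : ℝ} (hx : x ∈ Set.Ico (0:ℝ) 1) :
    HasSum (fun k : ℕ => 8 / Real.pi / (1 - 4 * ((k:ℝ) + 1) ^ 2) *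
      Real.cos ((k + 1) * (2 * Real.pi * x))) (2 * Real.sin (Real.pi * x) - 4 / Real.pi) := by
  set G : ℝ → ℂ := fun x => ((2 * Real.sin (Real.pi * x) : ℝ) : ℂ) with hG
  have hcont : Continuous (AddCircle.liftIco (1:ℝ) 0 G) := by
    refine liftIco_zero_continuous ?_ (Continuous.continuousOn (by fun_prop))
    simp [hG]
  have hcoeff : fourierCoeff (AddCircle.liftIco (1:ℝ) 0 G) =
      fun k : ℤ => ((4 / Real.pi / (1 - 4 * (k:ℝ) ^ 2) : ℝ) : ℂ) := by
    ext k
    rw [fourierCoeff_liftIco_eq, fourierCoeffOn_eq_integral, ← integral_exp_mul_sin]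
    simp only [zero_add, sub_zero, div_one, one_smul]
    refine intervalIntegral.integral_congr fun y _ => ?_
    simp only [smul_eq_mul, fourier_coe_apply, hG]
    congr 2
    push_cast; ring
  have h := has_pointwise_sum_fourier_series_of_summable (f := ⟨_, hcont⟩)
    (by simpa [hcoeff] using summable_sine_coeff) (x : AddCircle (1:ℝ))
  have h2 : HasSum (fun k : ℤ => ((4 / Real.pi / (1 - 4 * (k:ℝ) ^ 2) : ℝ) : ℂ) *
      cexp ((k * (2 * Real.pi * x) : ℝ) * I)) (G x) := by
    convert h using 1
    · ext k
      rw [ContinuousMap.coe_mk, hcoeff, fourier_coe_apply, smul_eq_mul]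
      congr 2
      push_cast; ring
    · rw [ContinuousMap.coe_mk, liftIco_coe_apply (by simpa using hx)]
  have h3 := (hasSum_nat_add_iff' 1).2 (hasSum_re h2.nat_add_neg)
  have e : ∀ k : ℤ, (((4 / Real.pi / (1 - 4 * (k:ℝ) ^ 2) : ℝ) : ℂ) *
      cexp ((k * (2 * Real.pi * x) : ℝ) * I)).re =
      4 / Real.pi / (1 - 4 * (k:ℝ) ^ 2) * Real.cos (k * (2 * Real.pi * x)) := by
    intro k
    rw [re_ofReal_mul, exp_ofReal_mul_I_re]
  simp only [add_re, e, Finset.sum_range_one] at h3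
  refine (congrArg₂ (fun a b => HasSum a b) (funext fun k => ?_) ?_).mp h3
  · push_cast
    rw [neg_mul, Real.cos_neg, neg_sq]
    ring
  · have hGre : (G x).re = 2 * Real.sin (Real.pi * x) := ofReal_re _
    simp [hGre]

theorem hasSum_two_mul_abs_sin (θ : ℝ) :
    HasSum (fun k : ℕ => 8 / Real.pi / (1 - 4 * ((k:ℝ) + 1) ^ 2) *
      Real.cos ((k + 1) * θ)) (2 * |Real.sin (θ / 2)| - 4 / Real.pi) := by
  have hx : θ = 2 * Real.pi * (θ / (2 * Real.pi)) := by field_simp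
  set x := θ / (2 * Real.pi) with hxd
  have h := hasSum_two_mul_sin (x := Int.fract x) ⟨Int.fract_nonneg x, Int.fract_lt_one x⟩
  have hfl := Int.floor_add_fract x
  convert h using 1
  · ext k
    congr 1
    rw [hx, ← Real.cos_add_int_mul_two_pi (_ * (2 * Real.pi * Int.fract x)) (((k:ℤ) + 1) * ⌊x⌋)]
    nth_rewrite 1 [← hfl]
    congr 1
    push_cast; ring
  · have e : θ / 2 = Real.pi * Int.fract x + ⌊x⌋ * Real.pi := by
      rw [hx]; nth_rewrite 1 [← hfl]; ring
    have hs : 0 ≤ Real.sin (Real.pi * Int.fract x) := by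
      refine Real.sin_nonneg_of_nonneg_of_le_pi ?_ ?_
      · exact mul_nonneg Real.pi_pos.le (Int.fract_nonneg x)
      · exact mul_le_of_le_one_right Real.pi_pos.le (Int.fract_lt_one x).le
    rw [e, Real.sin_add_int_mul_pi, abs_mul, abs_zpow, abs_neg, abs_one, one_zpow, one_mul,
      abs_of_nonneg hs]

theorem hasSum_two_mul_abs_cos (θ : ℝ) :
    HasSum (fun k : ℕ => 8 / Real.pi / (1 - 4 * ((k:ℝ) + 1) ^ 2) * (-1) ^ (k + 1) *
      Real.cos ((k + 1) * θ)) (2 * |Real.cos (θ / 2)| - 4 / Real.pi) := by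
  have h := hasSum_two_mul_abs_sin (θ + Real.pi)
  rw [show (θ + Real.pi) / 2 = θ / 2 + Real.pi / 2 by ring, Real.sin_add_pi_div_two] at h
  convert h using 1
  ext k
  rw [mul_assoc]
  congr 1
  rw [show ((k:ℝ) + 1) * (θ + Real.pi) = (k + 1) * θ +
      ((k + 1 : ℕ) : ℝ) * Real.pi by push_cast; ring,
    Real.cos_add_nat_mul_pi]

theorem abs_sine_coeff_le (k : ℕ) :
    |8 / Real.pi / (1 - 4 * ((k:ℝ) + 1) ^ 2)| ≤ 3 / ((k:ℝ) + 1) ^ 2 := by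
  have h1 : (1:ℝ) ≤ ((k:ℝ) + 1) ^ 2 := one_le_pow₀ (by linarith [Nat.cast_nonneg (α := ℝ) k])
  rw [abs_div, abs_of_pos (by positivity : 0 < 8 / Real.pi), abs_of_neg (by linarith)]
  have h2 : 8 / Real.pi ≤ 3 := by
    rw [div_le_iff₀ Real.pi_pos]; linarith [Real.pi_gt_three]
  calc _ ≤ 3 / (-(1 - 4 * ((k:ℝ) + 1) ^ 2)) := by gcongr; linarith
    _ ≤ _ := by gcongr; linarith

end SineSeries

section LogSeries

open ArithmeticFunction Filter

variable {κ : ℝ} {f Λf : ℕ → ℂ}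

theorem IsHalaszClass.apply_zero_one (h : IsHalaszClass κ f Λf) {n : ℕ} (hn : n ≤ 1) : Λf n = 0 :=
  h.supp n fun hp => by have := hp.two_le; lia

theorem vonMangoldt_div_log_le (n : ℕ) : Λ n / Real.log n ≤ 1 / Real.log 2 * Λ n := by
  rcases le_or_gt n 1 with hn | hn
  · interval_cases n <;> simp
  · have h2 : Real.log 2 ≤ Real.log n := Real.log_le_log two_pos (by exact_mod_cast hn)
    have h0 : 0 < Real.log 2 := Real.log_pos one_lt_two
    rw [div_eq_mul_one_div, mul_comm]
    gcongr

/-- The coefficients of `log F`. -/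
def logCoeff (Λf : ℕ → ℂ) (n : ℕ) : ℂ := Λf n / (Real.log n : ℂ)

theorem IsHalaszClass.norm_logCoeff_le (h : IsHalaszClass κ f Λf) (n : ℕ) :
    ‖logCoeff Λf n‖ ≤ κ * (Λ n / Real.log n) := by
  rcases Nat.eq_zero_or_pos n with rfl | hn
  · simp [logCoeff]
  · have h0 : 0 ≤ Real.log n := Real.log_natCast_nonneg n
    rw [logCoeff, norm_div, norm_real, Real.norm_of_nonneg h0, ← mul_div_assoc]
    gcongr
    exact h.bound n hn

theorem IsHalaszClass.summable_logCoeff (h : IsHalaszClass κ f Λf) {s : ℂ} (hs : 1 < s.re) :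
    LSeriesSummable (logCoeff Λf) s := by
  refine (LSeriesSummable_of_le_vonMangoldt (κ := κ * (1 / Real.log 2)) (fun n _ => ?_)
    hs).of_re_le_re (by simp)
  refine (h.norm_logCoeff_le n).trans ?_
  rw [mul_assoc]
  exact mul_le_mul_of_nonneg_left (vonMangoldt_div_log_le n) h.nonneg_kappa

theorem IsHalaszClass.LSeries_eq_exp (h : IsHalaszClass κ f Λf) {s : ℂ} (hs : 1 < s.re) :
    LSeries f s = cexp (LSeries (logCoeff Λf) s) := by
  have hab : ∀ {a : ℕ → ℂ}, (∀ s : ℂ, 1 < s.re → LSeriesSummable a s) →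
      LSeries.abscissaOfAbsConv a ≤ (1:ℝ) := fun ha =>
    LSeries.abscissaOfAbsConv_le_of_forall_lt_LSeriesSummable fun y hy => ha y (by simpa using hy)
  have hf := hab fun s hs => h.summable hs
  have hb := hab fun s hs => h.summable_logCoeff hs
  have hlt : ∀ {s : ℂ}, 1 < s.re → ((1:ℝ) : EReal) < s.re := fun hs => by exact_mod_cast hs
  have hdf : ∀ s : ℂ, 1 < s.re → HasDerivAt (LSeries f) (-(LSeries Λf s * LSeries f s)) s := by
    intro s hs
    convert! LSeries_hasDerivAt (hf.trans_lt (hlt hs)) using 2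
    rw [← h.LSeries_mul_log hs]
    congr 1
    ext n
    rw [LSeries.logMul, natCast_log, mul_comm]
  have hdb : ∀ s : ℂ, 1 < s.re → HasDerivAt (LSeries (logCoeff Λf)) (-(LSeries Λf s)) s := by
    intro s hs
    convert! LSeries_hasDerivAt (hb.trans_lt (hlt hs)) using 2
    congr 1
    ext n
    rw [LSeries.logMul, logCoeff, ← natCast_log]
    rcases le_or_gt n 1 with hn | hn
    · rw [h.apply_zero_one hn]; simp
    · have : (Real.log n : ℂ) ≠ 0 := by
        exact_mod_cast (Real.log_pos (by exact_mod_cast hn)).ne'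
      field_simp
  set H : ℂ → ℂ := fun s => LSeries f s * cexp (-LSeries (logCoeff Λf) s) with hH
  have hdH : ∀ s : ℂ, 1 < s.re → HasDerivAt H 0 s := by
    intro s hs
    convert! (hdf s hs).mul (hdb s hs).neg.cexp using 1
    ring
  have hconst : ∀ x : ℝ, 1 < x → H x = H s := fun x hx =>
    (isOpen_lt continuous_const continuous_re).is_const_of_deriv_eq_zero
      (convex_halfSpace_re_gt 1).isPreconnected
      (fun z hz => (hdH z hz).differentiableAt.differentiableWithinAt)
      (fun z hz => (hdH z hz).deriv) (show (1:ℝ) < (x:ℂ).re by simpa using hx) hs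
  have hlim : Tendsto (fun x : ℝ => H x) atTop (nhds (1 * cexp (-0))) := by
    have e1 := LSeries.tendsto_atTop (hf.trans_lt (EReal.coe_lt_top 1))
    have e2 := LSeries.tendsto_atTop (hb.trans_lt (EReal.coe_lt_top 1))
    rw [h.map_one] at e1
    rw [logCoeff, h.apply_zero_one le_rfl, zero_div] at e2
    exact e1.mul (continuous_exp.continuousAt.tendsto.comp e2.neg)
  have hHs : H s = 1 := by
    refine tendsto_nhds_unique (tendsto_const_nhds.congr' ?_) (by simpa using hlim)
    filter_upwards [eventually_gt_atTop 1] with x hx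
    exact (hconst x hx).symm
  rw [hH] at hHs
  simp only [Complex.exp_neg] at hHs
  have := Complex.exp_ne_zero (LSeries (logCoeff Λf) s)
  field_simp at hHs
  exact hHs

theorem IsHalaszClass.norm_LSeries_eq_exp (h : IsHalaszClass κ f Λf) {σ : ℝ} (hσ : 0 < σ) (t : ℝ) :
    ‖LSeries f (vline σ t)‖ = Real.exp (LSeries (logCoeff Λf) (vline σ t)).re := by
  rw [h.LSeries_eq_exp (by rw [vline_re]; linarith), norm_exp]

theorem isHalaszClass_one : IsHalaszClass 1 1 (fun n => (Λ n : ℂ)) where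
  map_one := rfl
  mult m n _ := by simp
  supp n hn := by
    rw [vonMangoldt_apply, if_neg hn, ofReal_zero]
  bound n _ := by
    rw [norm_real, Real.norm_of_nonneg vonMangoldt_nonneg, one_mul]
  conv n _ := by
    rw [← vonMangoldt_sum, ofReal_sum]; simp
  abs_conv σ hσ := by simpa using Real.summable_one_div_nat_rpow.2 hσ

/-- The weight `Λ(n) / (n^{1+σ} log n)`. -/
def logWeight (σ : ℝ) (n : ℕ) : ℝ := Λ n / Real.log n * (n : ℝ) ^ (-(1 + σ))

theorem logWeight_nonneg (σ : ℝ) (n : ℕ) : 0 ≤ logWeight σ n :=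
  mul_nonneg (div_nonneg vonMangoldt_nonneg (Real.log_natCast_nonneg n)) (by positivity)

theorem logWeight_anti {σ₁ σ₂ : ℝ} (h : σ₁ ≤ σ₂) (n : ℕ) : logWeight σ₂ n ≤ logWeight σ₁ n := by
  rcases Nat.eq_zero_or_pos n with rfl | hn
  · simp [logWeight]
  · refine mul_le_mul_of_nonneg_left (Real.rpow_le_rpow_of_exponent_le (by exact_mod_cast hn)
      (by linarith)) (div_nonneg vonMangoldt_nonneg (Real.log_natCast_nonneg n))

theorem summable_logWeight {σ : ℝ} (hσ : 0 < σ) : Summable (logWeight σ) := by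
  have h := (isHalaszClass_one.summable_logCoeff (s := vline σ 0) (by rw [vline_re]; linarith)).norm
  refine h.congr fun n => ?_
  rw [LSeries.norm_term_eq, vline_re]
  split_ifs with hn
  · simp [logWeight, hn]
  · rw [logCoeff, norm_div, norm_real, norm_real, Real.norm_of_nonneg vonMangoldt_nonneg,
      Real.norm_of_nonneg (Real.log_natCast_nonneg n), logWeight, Real.rpow_neg (by positivity)]
    rfl

theorem term_vline (a : ℕ → ℂ) (σ t : ℝ) (n : ℕ) (ha : a 0 = 0) :
    LSeries.term a (vline σ t) n =
      a n * ((n:ℝ) ^ (-(1 + σ)) : ℝ) * cexp ((-(t * Real.log n) : ℝ) * I) := by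
  rcases Nat.eq_zero_or_pos n with rfl | hn
  · simp [ha]
  · have hn0 : (0:ℝ) < n := by exact_mod_cast hn
    rw [LSeries.term_of_ne_zero hn.ne', div_eq_mul_inv, ← cpow_neg, mul_assoc]
    congr 1
    rw [← ofReal_natCast, cpow_def_of_ne_zero (by exact_mod_cast hn0.ne'), ← ofReal_log hn0.le,
      Real.rpow_def_of_pos hn0, ofReal_exp, ← Complex.exp_add]
    congr 1
    simp only [vline]
    push_cast; ring

theorem hasSum_logWeight_mul_cos {σ : ℝ} (hσ : 0 < σ) (t : ℝ) :
    HasSum (fun n => logWeight σ n * Real.cos (t * Real.log n))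
      (Real.log ‖riemannZeta (vline σ t)‖) := by
  have hre : 1 < (vline σ t).re := by rw [vline_re]; linarith
  have h := hasSum_re (isHalaszClass_one.summable_logCoeff hre).hasSum
  rw [← LSeries_one_eq_riemannZeta hre, isHalaszClass_one.norm_LSeries_eq_exp hσ, Real.log_exp]
  refine (congrArg (fun a => HasSum a _) (funext fun n => ?_)).mp h
  rw [term_vline _ _ _ _ (by simp [logCoeff]), logCoeff, ← ofReal_div, ← ofReal_mul, re_ofReal_mul,
    exp_ofReal_mul_I_re, Real.cos_neg, logWeight]

end LogSeries

section Oscillation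

open ArithmeticFunction Filter

theorem summable_logWeight_sub {σ₁ σ₂ : ℝ} (h₁ : 0 < σ₁) (h₂ : 0 < σ₂) :
    Summable fun n => logWeight σ₁ n - logWeight σ₂ n :=
  (summable_logWeight h₁).sub (summable_logWeight h₂)

theorem tsum_logWeight_sub {σ₁ σ₂ : ℝ} (h₁ : 0 < σ₁) (h₂ : 0 < σ₂) :
    ∑' n, (logWeight σ₁ n - logWeight σ₂ n) =
      Real.log ‖riemannZeta (vline σ₁ 0)‖ - Real.log ‖riemannZeta (vline σ₂ 0)‖ := by
  have h := (hasSum_logWeight_mul_cos h₁ 0).sub (hasSum_logWeight_mul_cos h₂ 0)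
  simpa using h.tsum_eq

theorem sq_log_le {y : ℝ} (hy : 1 ≤ y) : Real.log y ^ 2 ≤ 16 * y ^ (1 / 2 : ℝ) := by
  have h := Real.log_le_rpow_div (zero_le_one.trans hy) (show (0:ℝ) < 1 / 4 by norm_num)
  have h0 := Real.log_nonneg hy
  calc Real.log y ^ 2 ≤ (y ^ (1 / 4 : ℝ) / (1 / 4)) ^ 2 := by gcongr
    _ = 16 * (y ^ (1 / 4 : ℝ)) ^ 2 := by ring
    _ = _ := by rw [← Real.rpow_natCast, ← Real.rpow_mul (by linarith)]; norm_num

theorem exists_abs_tsum_logWeight_sub_mul_le {φ : ℝ → ℝ} {c₀ A D : ℝ} {a : ℕ → ℝ} (hA : 0 ≤ A)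
    (hD : 0 ≤ D) (ha : ∀ k, |a k| ≤ A / ((k:ℝ) + 1) ^ 2)
    (hφ : ∀ θ, HasSum (fun k : ℕ => a k * Real.cos ((k + 1) * θ)) (φ θ - c₀)) :
    ∃ C : ℝ, 0 < C ∧ ∀ σ₁ σ₂ τ : ℝ, 0 < σ₁ → σ₁ ≤ σ₂ → σ₂ ≤ 1 → σ₂ ≤ |τ| →
      σ₂ * Real.log (|τ| + 6) ^ 2 ≤ D →
      Summable (fun n : ℕ => (logWeight σ₁ n - logWeight σ₂ n) * φ (τ * Real.log n)) ∧
      |∑' n : ℕ, (logWeight σ₁ n - logWeight σ₂ n) * φ (τ * Real.log n) -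
        c₀ * (Real.log ‖riemannZeta (vline σ₁ 0)‖ - Real.log ‖riemannZeta (vline σ₂ 0)‖)| ≤ C := by
  obtain ⟨C, hC, hCb⟩ := exists_abs_log_riemannZeta_sub_le
  have hsum32 : Summable fun k : ℕ => 1 / ((k:ℝ) + 1) ^ (3 / 2 : ℝ) := by
    have := (summable_nat_add_iff 1).2 (Real.summable_one_div_nat_rpow.2
      (show (1:ℝ) < 3 / 2 by norm_num))
    simpa using this
  set K := ∑' k : ℕ, 1 / ((k:ℝ) + 1) ^ (3 / 2 : ℝ) with hK
  have hK0 : 0 ≤ K := tsum_nonneg fun k => by positivity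
  refine ⟨A * C * (33 + 2 * D) * K + 1, by positivity, fun σ₁ σ₂ τ h1 h12 h2 hτ hDτ => ?_⟩
  have hσ₂ : 0 < σ₂ := h1.trans_le h12
  have hd0 : ∀ n, 0 ≤ logWeight σ₁ n - logWeight σ₂ n :=
      fun n => sub_nonneg.2 (logWeight_anti h12 n)
  have hd := summable_logWeight_sub h1 hσ₂
  have ha_sum : Summable fun k => |a k| := by
    refine Summable.of_nonneg_of_le (fun k => abs_nonneg _) ha (((summable_nat_add_iff 1).2
      (Real.summable_one_div_nat_pow.2 one_lt_two)).mul_left A |>.congr fun k => ?_)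
    push_cast; ring
  have hF : Summable fun p : ℕ × ℕ => (logWeight σ₁ p.1 - logWeight σ₂ p.1) *
      (a p.2 * Real.cos ((p.2 + 1) * (τ * Real.log p.1))) := by
    refine Summable.of_norm_bounded (hd.mul_of_nonneg ha_sum hd0 fun k => abs_nonneg _) fun p => ?_
    rw [norm_mul, Real.norm_of_nonneg (hd0 _), norm_mul]
    exact mul_le_mul_of_nonneg_left (mul_le_of_le_one_right (norm_nonneg _)
      (Real.abs_cos_le_one _)) (hd0 _)
  have hinner : ∀ n : ℕ, ∑' k : ℕ, (logWeight σ₁ n - logWeight σ₂ n) *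
      (a k * Real.cos ((k + 1) * (τ * Real.log n))) =
      (logWeight σ₁ n - logWeight σ₂ n) * (φ (τ * Real.log n) - c₀) := fun n =>
    ((hφ _).mul_left _).tsum_eq
  have hs1 : Summable fun n : ℕ => (logWeight σ₁ n - logWeight σ₂ n) * (φ (τ * Real.log n) - c₀) :=
    hF.prod.congr fun n => hinner n
  have hs2 : Summable fun n : ℕ => (logWeight σ₁ n - logWeight σ₂ n) * φ (τ * Real.log n) :=
    (hs1.add (hd.mul_right c₀)).congr fun n => by ring
  refine ⟨hs2, ?_⟩
  have e1 : ∑' n : ℕ, (logWeight σ₁ n - logWeight σ₂ n) * φ (τ * Real.log n) -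
      c₀ * (Real.log ‖riemannZeta (vline σ₁ 0)‖ - Real.log ‖riemannZeta (vline σ₂ 0)‖) =
      ∑' n : ℕ, (logWeight σ₁ n - logWeight σ₂ n) * (φ (τ * Real.log n) - c₀) := by
    rw [← tsum_logWeight_sub h1 hσ₂, ← tsum_mul_left, ← hs2.tsum_sub (hd.mul_left c₀)]
    exact tsum_congr fun n => by ring
  set Z : ℕ → ℝ := fun k => Real.log ‖riemannZeta (vline σ₁ ((k + 1) * τ))‖ -
    Real.log ‖riemannZeta (vline σ₂ ((k + 1) * τ))‖ with hZ
  have e2 : ∑' n : ℕ, (logWeight σ₁ n - logWeight σ₂ n) * (φ (τ * Real.log n) - c₀) =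
      ∑' k : ℕ, a k * Z k := by
    simp_rw [← hinner]
    rw [← Summable.tsum_comm (f := fun n k : ℕ => (logWeight σ₁ n - logWeight σ₂ n) *
      (a k * Real.cos ((k + 1) * (τ * Real.log n)))) hF]
    refine tsum_congr fun k => ?_
    have := ((hasSum_logWeight_mul_cos h1 ((k + 1) * τ)).sub
      (hasSum_logWeight_mul_cos hσ₂ ((k + 1) * τ))).mul_left (a k)
    rw [← this.tsum_eq]
    refine tsum_congr fun n => ?_
    rw [mul_assoc ((k:ℝ) + 1)]; ring
  rw [e1, e2]
  have hb : ∀ k : ℕ, ‖a k * Z k‖ ≤ A * C * (33 + 2 * D) * (1 / ((k:ℝ) + 1) ^ (3 / 2 : ℝ)) := by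
    intro k
    have hk : (1:ℝ) ≤ (k:ℝ) + 1 := by linarith [Nat.cast_nonneg (α := ℝ) k]
    have hk0 : (0:ℝ) < (k:ℝ) + 1 := by linarith
    have habs : |((k:ℝ) + 1) * τ| = ((k:ℝ) + 1) * |τ| := by rw [abs_mul, abs_of_pos hk0]
    have hz := hCb σ₁ σ₂ ((k + 1) * τ) h1 h12 h2 (by
      rw [habs]; exact hτ.trans (le_mul_of_one_le_left (abs_nonneg _) hk))
    have hl : Real.log (|((k:ℝ) + 1) * τ| + 6) ≤ Real.log ((k:ℝ) + 1) + Real.log (|τ| + 6) := by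
      rw [habs, ← Real.log_mul (by positivity) (by positivity)]
      refine Real.log_le_log (by positivity) (by nlinarith [abs_nonneg τ])
    have hl0 : 0 ≤ Real.log (|((k:ℝ) + 1) * τ| + 6) :=
      zero_le_one.trans (one_le_log_abs_add_six _)
    have hroot : (1:ℝ) ≤ ((k:ℝ) + 1) ^ (1 / 2 : ℝ) := Real.one_le_rpow hk (by norm_num)
    have hz2 : |Z k| ≤ C * ((33 + 2 * D) * ((k:ℝ) + 1) ^ (1 / 2 : ℝ)) := by
      refine hz.trans ?_
      gcongr
      calc 1 + σ₂ * Real.log (|((k:ℝ) + 1) * τ| + 6) ^ 2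
          ≤ 1 + σ₂ * (Real.log ((k:ℝ) + 1) + Real.log (|τ| + 6)) ^ 2 := by gcongr
        _ ≤ 1 + σ₂ * (2 * Real.log ((k:ℝ) + 1) ^ 2 + 2 * Real.log (|τ| + 6) ^ 2) := by
            gcongr
            nlinarith [sq_nonneg (Real.log ((k:ℝ) + 1) - Real.log (|τ| + 6))]
        _ ≤ 1 + 1 * (2 * Real.log ((k:ℝ) + 1) ^ 2) + 2 * D := by
            have : σ₂ * (2 * Real.log ((k:ℝ) + 1) ^ 2) ≤ 1 * (2 * Real.log ((k:ℝ) + 1) ^ 2) := by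
              gcongr
            linarith
        _ ≤ 1 + 1 * (2 * (16 * ((k:ℝ) + 1) ^ (1 / 2 : ℝ))) + 2 * D := by
            gcongr; exact sq_log_le hk
        _ ≤ _ := by nlinarith
    rw [norm_mul, Real.norm_eq_abs, Real.norm_eq_abs]
    calc |a k| * |Z k| ≤ A / ((k:ℝ) + 1) ^ 2 *
        (C * ((33 + 2 * D) * ((k:ℝ) + 1) ^ (1 / 2 : ℝ))) := by
          gcongr
          exact ha k
      _ = _ := by
          rw [show (3 / 2 : ℝ) = 2 - 1 / 2 by norm_num, Real.rpow_sub hk0, Real.rpow_two]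
          field_simp
  have := tsum_of_norm_bounded (hsum32.mul_left (A * C * (33 + 2 * D))).hasSum hb
  rw [tsum_mul_left, ← hK, Real.norm_eq_abs] at this
  linarith

theorem exists_log_riemannZeta_sub_le : ∃ C : ℝ, 0 < C ∧ ∀ σ₁ σ₂ : ℝ, 0 < σ₁ → σ₁ ≤ σ₂ → σ₂ ≤ 1 →
    Real.log ‖riemannZeta (vline σ₁ 0)‖ - Real.log ‖riemannZeta (vline σ₂ 0)‖ ≤
      Real.log (σ₂ / σ₁) + C := by
  obtain ⟨C, hC, hCb⟩ := exists_abs_log_riemannZeta₁_sub_le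
  refine ⟨C * (1 + Real.log 6 ^ 2), by positivity, fun σ₁ σ₂ h1 h12 h2 => ?_⟩
  have hσ₂ : 0 < σ₂ := h1.trans_le h12
  have hlog : ∀ σ : ℝ, 0 < σ → Real.log ‖riemannZeta (vline σ 0)‖ =
      Real.log ‖riemannZeta₁ (vline σ 0)‖ - Real.log σ := by
    intro σ hσ
    have e : vline σ 0 - 1 = (σ:ℂ) := by simp [vline]
    rw [riemannZeta₁_eq_mul (vline_ne_one hσ 0), norm_mul, e, norm_real, Real.norm_of_nonneg hσ.le,
      Real.log_mul hσ.ne' (norm_ne_zero_iff.2 (riemannZeta_ne_zero_of_one_le_re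
        (by rw [vline_re]; linarith)))]
    ring
  have h3 := (abs_le.1 (hCb σ₁ σ₂ 0 h1 h12 h2)).2
  rw [abs_zero, zero_add] at h3
  rw [hlog _ h1, hlog _ hσ₂, Real.log_div hσ₂.ne' h1.ne']
  have h4 : C * (1 + σ₂ * Real.log 6 ^ 2) ≤ C * (1 + Real.log 6 ^ 2) := by
    gcongr; exact mul_le_of_le_one_left (sq_nonneg _) h2
  linarith

/-- An upper bound for prime sums weighted by a periodic function with mean value `c₀`. -/
theorem exists_tsum_logWeight_sub_mul_le {φ : ℝ → ℝ} {c₀ A D : ℝ} {a : ℕ → ℝ} (hA : 0 ≤ A)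
    (hc₀ : 0 ≤ c₀) (hD : 0 ≤ D) (ha : ∀ k, |a k| ≤ A / ((k:ℝ) + 1) ^ 2)
    (hφ : ∀ θ, HasSum (fun k : ℕ => a k * Real.cos ((k + 1) * θ)) (φ θ - c₀)) :
    ∃ C : ℝ, 0 < C ∧ ∀ σ₁ σ₂ τ : ℝ, 0 < σ₁ → σ₁ ≤ σ₂ → σ₂ ≤ 1 → σ₂ ≤ |τ| →
      σ₂ * Real.log (|τ| + 6) ^ 2 ≤ D →
      Summable (fun n : ℕ => (logWeight σ₁ n - logWeight σ₂ n) * φ (τ * Real.log n)) ∧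
      ∑' n : ℕ, (logWeight σ₁ n - logWeight σ₂ n) * φ (τ * Real.log n) ≤
        c₀ * Real.log (σ₂ / σ₁) + C := by
  obtain ⟨C₁, h1, h1b⟩ := exists_abs_tsum_logWeight_sub_mul_le hA hD ha hφ
  obtain ⟨C₂, h2, h2b⟩ := exists_log_riemannZeta_sub_le
  refine ⟨C₁ + c₀ * C₂, by positivity, fun σ₁ σ₂ τ hσ₁ h12 hσ₂ hτ hDτ => ?_⟩
  obtain ⟨hs, hb⟩ := h1b σ₁ σ₂ τ hσ₁ h12 hσ₂ hτ hDτ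
  refine ⟨hs, ?_⟩
  have := mul_le_mul_of_nonneg_left (h2b σ₁ σ₂ hσ₁ h12 hσ₂) hc₀
  linarith [(abs_le.1 hb).2]

end Oscillation

section Repulsion

open ArithmeticFunction Filter

variable {κ : ℝ} {f Λf : ℕ → ℂ}

theorem tsum_logWeight_le {σ : ℝ} (hσ : 0 < σ) (h1 : σ ≤ 1) :
    ∑' n, logWeight σ n ≤ Real.log (2 / σ) := by
  have h : ∑' n, logWeight σ n = Real.log ‖riemannZeta (vline σ 0)‖ := by
    simpa using (hasSum_logWeight_mul_cos hσ 0).tsum_eq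
  rw [h]
  have hre : 1 < (vline σ 0).re := by rw [vline_re]; linarith
  have h2 := isHalaszClass_one.norm_LSeries_le hσ 0
  rw [Real.rpow_one] at h2
  have h3 : LSeries 1 (vline σ 0) = riemannZeta (vline σ 0) := LSeries_one_eq_riemannZeta hre
  rw [h3] at h2
  refine Real.log_le_log (norm_pos_iff.2 (riemannZeta_ne_zero_of_one_le_re hre.le)) (h2.trans ?_)
  rw [← sub_nonneg]
  have : 2 / σ - (1 + 1 / σ) = (1 - σ) / σ := by field_simp; ring
  rw [this]
  exact div_nonneg (by linarith) hσ.le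

theorem IsHalaszClass.hasSum_re (h : IsHalaszClass κ f Λf) {σ : ℝ} (hσ : 0 < σ) (t : ℝ) :
    HasSum (fun n : ℕ => (logCoeff Λf n * cexp ((-(t * Real.log n) : ℝ) * I)).re *
      (n:ℝ) ^ (-(1 + σ))) (LSeries (logCoeff Λf) (vline σ t)).re := by
  have h1 := (h.summable_logCoeff (s := vline σ t) (by rw [vline_re]; linarith)).LSeriesHasSum
  have h2 := Complex.hasSum_re h1
  refine (congrArg₂ (fun a b => HasSum a b) (funext fun n => ?_) rfl).mp h2
  rw [term_vline _ _ _ _ (by simp [logCoeff]), mul_right_comm, re_mul_ofReal]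

theorem IsHalaszClass.re_logCoeff_mul_le (h : IsHalaszClass κ f Λf) (n : ℕ) (z : ℂ) {b : ℝ}
    (hb : 0 ≤ b) : (logCoeff Λf n * z).re * b ≤ κ * (Λ n / Real.log n * b * ‖z‖) := by
  calc (logCoeff Λf n * z).re * b ≤ ‖logCoeff Λf n * z‖ * b := by gcongr; exact re_le_norm _
    _ = ‖logCoeff Λf n‖ * (‖z‖ * b) := by rw [norm_mul]; ring
    _ ≤ κ * (Λ n / Real.log n) * (‖z‖ * b) := by gcongr; exact h.norm_logCoeff_le n
    _ = _ := by ring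

theorem norm_cexp_add_cexp (a b : ℝ) :
    ‖cexp ((a:ℝ) * I) + cexp ((b:ℝ) * I)‖ = 2 * |Real.cos ((b - a) / 2)| := by
  have : cexp ((a:ℝ) * I) + cexp ((b:ℝ) * I) =
      cexp (((a + b) / 2 : ℝ) * I) * ((2 * Real.cos ((b - a) / 2) : ℝ) : ℂ) := by
    push_cast
    rw [Complex.two_cos, mul_add, ← Complex.exp_add, ← Complex.exp_add]
    refine (add_comm _ _).trans (congrArg₂ _ (congrArg _ ?_) (congrArg _ ?_)) <;> ring
  rw [this, norm_mul, norm_exp_ofReal_mul_I, one_mul, norm_real, Real.norm_eq_abs, abs_mul,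
    abs_of_pos two_pos]

theorem norm_cexp_sub_cexp (a b : ℝ) :
    ‖cexp ((a:ℝ) * I) - cexp ((b:ℝ) * I)‖ = 2 * |Real.sin ((b - a) / 2)| := by
  have : cexp ((a:ℝ) * I) - cexp ((b:ℝ) * I) =
      cexp (((a + b) / 2 : ℝ) * I) * ((2 * Real.sin ((b - a) / 2) : ℝ) : ℂ) * -I := by
    push_cast
    rw [Complex.two_sin, mul_assoc, mul_assoc, mul_neg, I_mul_I, neg_neg, mul_one, mul_sub,
      ← Complex.exp_add, ← Complex.exp_add]
    congr 2 <;> ring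
  rw [this, norm_mul, norm_neg, norm_I, mul_one, norm_mul, norm_exp_ofReal_mul_I, one_mul,
    norm_real,
    Real.norm_eq_abs, abs_mul, abs_of_pos two_pos]

theorem IsHalaszClass.re_add_re_le (h : IsHalaszClass κ f Λf) {σ : ℝ} (hσ : 0 < σ) (t t₁ : ℝ) :
    (LSeries (logCoeff Λf) (vline σ t)).re + (LSeries (logCoeff Λf) (vline σ t₁)).re ≤
      κ * ∑' n : ℕ, logWeight σ n * (2 * |Real.cos ((t - t₁) * Real.log n / 2)|) := by
  have hs := (h.hasSum_re hσ t).add (h.hasSum_re hσ t₁)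
  have hsum : Summable fun n : ℕ => logWeight σ n * (2 * |Real.cos ((t - t₁) * Real.log n / 2)|) :=
    Summable.of_nonneg_of_le (fun n => mul_nonneg (logWeight_nonneg _ _) (by positivity))
      (fun n => mul_le_mul_of_nonneg_left (by linarith [Real.abs_cos_le_one ((t - t₁) *
        Real.log n / 2)] : _ ≤ (2:ℝ)) (logWeight_nonneg _ _)) ((summable_logWeight hσ).mul_right 2)
  refine hasSum_le (fun n => ?_) hs (hsum.hasSum.mul_left κ)
  rw [← add_mul, ← add_re, ← mul_add]
  refine (h.re_logCoeff_mul_le n _ (by positivity)).trans_eq ?_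
  rw [norm_cexp_add_cexp, logWeight]
  congr 5
  ring

theorem IsHalaszClass.re_sub_re_le (h : IsHalaszClass κ f Λf) {σ₁ σ : ℝ} (hσ₁ : 0 < σ₁)
    (hσ : σ₁ ≤ σ) (t t₁ : ℝ) :
    (LSeries (logCoeff Λf) (vline σ t)).re - (LSeries (logCoeff Λf) (vline σ t₁)).re ≤
      (LSeries (logCoeff Λf) (vline σ₁ t)).re - (LSeries (logCoeff Λf) (vline σ₁ t₁)).re +
      κ * ∑' n : ℕ, (logWeight σ₁ n - logWeight σ n) *
        (2 * |Real.sin ((t - t₁) * Real.log n / 2)|) := by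
  have hσ0 : 0 < σ := hσ₁.trans_le hσ
  have hs := ((h.hasSum_re hσ0 t).sub (h.hasSum_re hσ0 t₁)).sub
    ((h.hasSum_re hσ₁ t).sub (h.hasSum_re hσ₁ t₁))
  have hnn : ∀ n, 0 ≤ logWeight σ₁ n - logWeight σ n := fun n => sub_nonneg.2 (logWeight_anti hσ n)
  have hsum : Summable fun n : ℕ => (logWeight σ₁ n - logWeight σ n) *
      (2 * |Real.sin ((t - t₁) * Real.log n / 2)|) :=
    Summable.of_nonneg_of_le (fun n => mul_nonneg (hnn n) (by positivity))
      (fun n => mul_le_mul_of_nonneg_left (by linarith [Real.abs_sin_le_one ((t - t₁) *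
        Real.log n / 2)] : _ ≤ (2:ℝ)) (hnn n)) ((summable_logWeight_sub hσ₁ hσ0).mul_right 2)
  have := hasSum_le (fun n => ?_) hs (hsum.hasSum.mul_left κ)
  · linarith
  rcases Nat.eq_zero_or_pos n with rfl | hn
  · simp [logCoeff, logWeight]
  have hb : 0 ≤ (n:ℝ) ^ (-(1 + σ₁)) - (n:ℝ) ^ (-(1 + σ)) := by
    rw [sub_nonneg]
    exact Real.rpow_le_rpow_of_exponent_le (by exact_mod_cast hn) (by linarith)
  have key := h.re_logCoeff_mul_le n (cexp ((-(t₁ * Real.log n) : ℝ) * I) -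
    cexp ((-(t * Real.log n) : ℝ) * I)) hb
  rw [norm_cexp_sub_cexp, mul_sub (logCoeff Λf n), sub_re] at key
  have e : |Real.sin ((-(t * Real.log n) - -(t₁ * Real.log n)) / 2)| =
      |Real.sin ((t - t₁) * Real.log n / 2)| := by
    rw [← abs_neg, ← Real.sin_neg]; congr 2; ring
  rw [e] at key
  simp only [logWeight]
  linarith

theorem log_abs_add_six_le {L τ : ℝ} {K : ℝ} (hK : 0 ≤ K) (hL : 1 ≤ Real.log L) (hL0 : 0 < L)
    (hτ : |τ| ≤ 2 * L ^ K) : Real.log (|τ| + 6) ≤ (3 + K) * Real.log L := by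
  have hL1 : 1 ≤ L := by
    rw [← Real.log_nonneg_iff hL0]; linarith
  have h1 : 1 ≤ L ^ K := Real.one_le_rpow hL1 hK
  have h8 : Real.log 8 ≤ 3 := by
    rw [show (8:ℝ) = 2 ^ 3 by norm_num, Real.log_pow]
    have := Real.log_two_lt_d9
    push_cast; linarith
  calc Real.log (|τ| + 6) ≤ Real.log (8 * L ^ K) :=
        Real.log_le_log (by positivity) (by linarith)
    _ = Real.log 8 + K * Real.log L := by
        rw [Real.log_mul (by norm_num) (by positivity), Real.log_rpow hL0]
    _ ≤ _ := by nlinarith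

theorem exists_norm_LSeries_le_of_isMax (hκ : 0 ≤ κ) : ∃ C : ℝ, 0 < C ∧ ∀ f Λf : ℕ → ℂ,
    IsHalaszClass κ f Λf → ∀ L : ℝ, 0 < L → 1 ≤ Real.log L → ∀ t₁ : ℝ, |t₁| ≤ L ^ κ →
    (∀ t : ℝ, |t| ≤ L ^ κ → ‖LSeries f (vline (1 / L) t)‖ ≤ ‖LSeries f (vline (1 / L) t₁)‖) →
    ∀ t : ℝ, |t| ≤ L ^ κ → ∀ σ ρ : ℝ, 1 / L ≤ σ → σ ≤ ρ → ρ ≤ |t - t₁| → ρ * Real.log L ^ 2 ≤ 1 →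
    ‖LSeries f (vline σ t)‖ ≤ C * ρ ^ (-κ) * (ρ * L) ^ (κ * (2 / Real.pi)) := by
  have hD : (0:ℝ) ≤ (3 + κ) ^ 2 := sq_nonneg _
  have hsc : (0:ℝ) ≤ 4 / Real.pi := by positivity
  obtain ⟨C₁, hC₁, hs⟩ := exists_tsum_logWeight_sub_mul_le (A := 3)
    (φ := fun θ => 2 * |Real.sin (θ / 2)|) (by norm_num) hsc hD abs_sine_coeff_le
    hasSum_two_mul_abs_sin
  obtain ⟨C₂, hC₂, hc⟩ := exists_tsum_logWeight_sub_mul_le (A := 3)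
    (φ := fun θ => 2 * |Real.cos (θ / 2)|)
    (a := fun k : ℕ => 8 / Real.pi / (1 - 4 * ((k:ℝ) + 1) ^ 2) * (-1) ^ (k + 1))
    (by norm_num) hsc hD (fun k => by
      rw [abs_mul, abs_pow, abs_neg, abs_one, one_pow, mul_one]; exact abs_sine_coeff_le k)
    hasSum_two_mul_abs_cos
  refine ⟨Real.exp (κ * (C₁ / 2 + C₂ / 2 + Real.log 2)), Real.exp_pos _, ?_⟩
  intro f Λf h L hL0 hL t₁ ht₁ hmax t ht σ ρ hσ hσρ hρτ hρ
  have hσ₁ : 0 < 1 / L := by positivity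
  have hσ0 : 0 < σ := hσ₁.trans_le hσ
  have hρ0 : 0 < ρ := hσ0.trans_le hσρ
  have hρ1 : ρ ≤ 1 := (le_mul_of_one_le_right hρ0.le (one_le_pow₀ hL)).trans hρ
  have hlogτ : Real.log (|t - t₁| + 6) ≤ (3 + κ) * Real.log L :=
    log_abs_add_six_le hκ hL hL0 ((abs_sub _ _).trans (by linarith))
  have hDρ : ∀ r, r ≤ ρ → 0 < r → r * Real.log (|t - t₁| + 6) ^ 2 ≤ (3 + κ) ^ 2 := by
    intro r hr hr0
    have h6 := one_le_log_abs_add_six (t - t₁)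
    calc r * Real.log (|t - t₁| + 6) ^ 2 ≤ ρ * ((3 + κ) * Real.log L) ^ 2 := by gcongr
      _ = (3 + κ) ^ 2 * (ρ * Real.log L ^ 2) := by ring
      _ ≤ (3 + κ) ^ 2 * 1 := by gcongr
      _ = _ := mul_one _
  obtain ⟨-, h1⟩ := hs (1 / L) σ (t - t₁) hσ₁ hσ (hσρ.trans hρ1) (hσρ.trans hρτ) (hDρ σ hσρ hσ0)
  obtain ⟨hsum2, h2⟩ := hc σ ρ (t - t₁) hσ0 hσρ hρ1 hρτ (hDρ ρ le_rfl hρ0)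
  have h3 := h.re_sub_re_le hσ₁ hσ t t₁
  have h4 := h.re_add_re_le hσ0 t t₁
  have hmx : (LSeries (logCoeff Λf) (vline (1 / L) t)).re ≤
      (LSeries (logCoeff Λf) (vline (1 / L) t₁)).re := by
    have := hmax t ht
    rwa [h.norm_LSeries_eq_exp hσ₁, h.norm_LSeries_eq_exp hσ₁, Real.exp_le_exp] at this
  have h5 : ∑' n : ℕ, logWeight σ n * (2 * |Real.cos ((t - t₁) * Real.log n / 2)|) ≤
      ∑' n : ℕ, (logWeight σ n - logWeight ρ n) * (2 * |Real.cos ((t - t₁) * Real.log n / 2)|) +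
      2 * Real.log (2 / ρ) := by
    have hq := (summable_logWeight hρ0).mul_right 2
    have hb : ∀ n : ℕ, 2 * |Real.cos ((t - t₁) * Real.log n / 2)| ≤ 2 := fun n => by
      linarith [Real.abs_cos_le_one ((t - t₁) * Real.log n / 2)]
    calc _ ≤ ∑' n : ℕ, ((logWeight σ n - logWeight ρ n) *
          (2 * |Real.cos ((t - t₁) * Real.log n / 2)|) + logWeight ρ n * 2) := by
          refine Summable.tsum_le_tsum (fun n => ?_) (Summable.of_nonneg_of_le
            (fun n => mul_nonneg (logWeight_nonneg _ _) (by positivity))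
            (fun n => mul_le_mul_of_nonneg_left (hb n) (logWeight_nonneg _ _))
            ((summable_logWeight hσ0).mul_right 2)) (hsum2.add hq)
          have := mul_le_mul_of_nonneg_left (hb n) (logWeight_nonneg ρ n)
          linarith
      _ ≤ _ := by
          rw [hsum2.tsum_add hq, tsum_mul_right]
          linarith [tsum_logWeight_le hρ0 hρ1]
  rw [h.norm_LSeries_eq_exp hσ0, Real.rpow_def_of_pos hρ0, Real.rpow_def_of_pos (by positivity),
    ← Real.exp_add, ← Real.exp_add, Real.exp_le_exp]
  have e1 : Real.log (σ / (1 / L)) = Real.log σ + Real.log L := by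
    rw [div_div_eq_mul_div, div_one, Real.log_mul hσ0.ne' hL0.ne']
  have e2 : Real.log (ρ / σ) = Real.log ρ - Real.log σ := Real.log_div hρ0.ne' hσ0.ne'
  have e3 : Real.log (ρ * L) = Real.log ρ + Real.log L := Real.log_mul hρ0.ne' hL0.ne'
  have e4 : Real.log (2 / ρ) = Real.log 2 - Real.log ρ := Real.log_div two_ne_zero hρ0.ne'
  rw [e1] at h1; rw [e2] at h2; rw [e3]; rw [e4] at h5
  have k1 := mul_le_mul_of_nonneg_left h1 hκ
  have k2 := mul_le_mul_of_nonneg_left (h5.trans (add_le_add_left h2 _)) hκ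
  have e5 : 4 / Real.pi = 2 * (2 / Real.pi) := by ring
  rw [e5] at k1 k2
  nlinarith
end Repulsion

section RepulsionNonneg

open ArithmeticFunction Filter

variable {κ : ℝ} {f Λf : ℕ → ℂ}

theorem IsHalaszClass.LSeries_eq_of_isMax (h : IsHalaszClass κ f Λf)
    (hf : ∀ n, ∃ r : ℝ, 0 ≤ r ∧ f n = r) {σ₁ t₁ : ℝ} (hσ₁ : 0 < σ₁)
    (hmax : ‖LSeries f (vline σ₁ 0)‖ ≤ ‖LSeries f (vline σ₁ t₁)‖) (σ t : ℝ) :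
    LSeries f (vline σ t) = LSeries f (vline σ (t - t₁)) := by
  choose r hr0 hr using hf
  set f0 : ℕ → ℂ := fun n => if n = 0 then 0 else f n with hf0
  have hcong : ∀ s, LSeries f s = LSeries f0 s := fun s =>
    LSeries_congr (fun {n} hn => by simp [hf0, hn]) s
  have hre : ∀ t, 1 < (vline σ₁ t).re := fun t => by rw [vline_re]; linarith
  have hsum : ∀ t, HasSum (fun n => LSeries.term f0 (vline σ₁ t) n) (LSeries f (vline σ₁ t)) := by
    intro t
    rw [hcong]
    exact ((LSeriesSummable_congr _ (fun {n} hn => by simp [hf0, hn])).1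
      (h.summable (hre t))).LSeriesHasSum
  have hterm : ∀ t n, LSeries.term f0 (vline σ₁ t) n =
      f0 n * ((n:ℝ) ^ (-(1 + σ₁)) : ℝ) * cexp ((-(t * Real.log n) : ℝ) * I) := fun t n =>
    term_vline _ _ _ _ (by simp [hf0])
  set z := LSeries f (vline σ₁ t₁) with hz
  set b : ℕ → ℝ := fun n => (if n = 0 then 0 else r n) * (n:ℝ) ^ (-(1 + σ₁)) with hb
  have hb0 : ∀ n, 0 ≤ b n := fun n => by
    simp only [hb]; split_ifs
    · simp
    · exact mul_nonneg (hr0 n) (by positivity)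
  have hbf : ∀ n, f0 n * ((n:ℝ) ^ (-(1 + σ₁)) : ℝ) = (b n : ℂ) := fun n => by
    simp only [hf0, hb]; split_ifs
    · simp
    · rw [hr n]; push_cast; ring
  have hS : HasSum b (LSeries f (vline σ₁ 0)).re := by
    refine (congrArg₂ (fun a b => HasSum a b) (funext fun n => ?_) rfl).mp
      (Complex.hasSum_re (hsum 0))
    rw [hterm, hbf]; simp
  have hb1 : b 1 = 1 := by
    have : (r 1 : ℂ) = 1 := by rw [← hr, h.map_one]
    have : r 1 = 1 := by exact_mod_cast this
    simp [hb, this]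
  have hSz : (LSeries f (vline σ₁ 0)).re ≤ ‖z‖ := (re_le_norm _).trans hmax
  have hz0 : 0 < ‖z‖ := by
    have := le_hasSum hS 1 fun n _ => hb0 n
    linarith
  set u : ℂ := starRingEnd ℂ z / ‖z‖ with hu
  have hunorm : ‖u‖ = 1 := by
    rw [hu, norm_div, RCLike.norm_conj, norm_real, norm_norm, div_self hz0.ne']
  have huz : u * z = ‖z‖ := by
    have hzc : (‖z‖ : ℂ) ≠ 0 := by exact_mod_cast hz0.ne'
    rw [hu, div_mul_eq_mul_div, mul_comm, mul_conj, normSq_eq_norm_sq, div_eq_iff hzc]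
    push_cast; ring
  have hdiff : HasSum (fun n : ℕ => b n - (u * (b n * cexp ((-(t₁ * Real.log n) : ℝ) * I))).re)
      ((LSeries f (vline σ₁ 0)).re - ‖z‖) := by
    have h1 := hS.sub (Complex.hasSum_re ((hsum t₁).mul_left u))
    rw [← hz, huz, ofReal_re] at h1
    refine (congrArg₂ (fun a b => HasSum a b) (funext fun n => ?_) rfl).mp h1
    rw [hterm, hbf]
  have hle : ∀ n : ℕ, 0 ≤ b n - (u * (b n * cexp ((-(t₁ * Real.log n) : ℝ) * I))).re := by
    intro n
    rw [sub_nonneg]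
    refine (re_le_norm _).trans ?_
    rw [norm_mul, norm_mul, norm_exp_ofReal_mul_I, hunorm, norm_real, Real.norm_of_nonneg (hb0 n)]
    simp
  have heq : ∀ n : ℕ, (u * (b n * cexp ((-(t₁ * Real.log n) : ℝ) * I))).re = b n := by
    intro n
    have := le_hasSum hdiff n fun n _ => hle n
    linarith [hle n]
  have eq_of_re : ∀ v : ℂ, ‖v‖ = v.re → v = (v.re : ℂ) := by
    intro v hv
    have h2 := Complex.sq_norm_sub_sq_re v
    rw [hv, sub_self] at h2
    apply Complex.ext
    · simp
    · rw [ofReal_im]; exact pow_eq_zero_iff two_ne_zero |>.1 h2.symm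
  have hu1 : u = 1 := by
    have h1 := heq 1
    rw [hb1] at h1
    simp only [ofReal_one, Nat.cast_one, Real.log_one, mul_zero, neg_zero, ofReal_zero,
      zero_mul, Complex.exp_zero, mul_one] at h1
    have := eq_of_re u (by rw [hunorm, h1])
    rw [this, h1, ofReal_one]
  have hfix : ∀ n : ℕ, n ≠ 0 → f n * (n:ℂ) ^ (-((t₁:ℂ) * I)) = f n := by
    intro n hn
    have hnpos : (0:ℝ) < n := by exact_mod_cast Nat.pos_of_ne_zero hn
    have h1 := heq n
    rw [hu1, one_mul] at h1
    have h2 := eq_of_re _ (show ‖(b n : ℂ) * cexp ((-(t₁ * Real.log n) : ℝ) * I)‖ = _ by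
      rw [h1, norm_mul, norm_exp_ofReal_mul_I, norm_real, Real.norm_of_nonneg (hb0 n), mul_one])
    rw [h1] at h2
    have h3 : cexp ((-(t₁ * Real.log n) : ℝ) * I) = (n:ℂ) ^ (-((t₁:ℂ) * I)) := by
      rw [cpow_def_of_ne_zero (by exact_mod_cast hn), ← natCast_log]
      congr 1; push_cast; ring
    rw [h3] at h2
    have h4 : (b n : ℂ) = f n * ((n:ℝ) ^ (-(1 + σ₁)) : ℝ) := by
      rw [← hbf n]; simp [hf0, hn]
    have h5 : (((n:ℝ) ^ (-(1 + σ₁)) : ℝ) : ℂ) ≠ 0 := by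
      exact_mod_cast (Real.rpow_pos_of_pos hnpos _).ne'
    rw [h4] at h2
    exact mul_right_cancel₀ h5 (by linear_combination h2)
  rw [show vline σ t = vline σ ((t - t₁) + t₁) by rw [sub_add_cancel], LSeries_twist]
  exact LSeries_congr (fun {n} hn => hfix n hn) _

theorem IsHalaszClass.logCoeff_prime (h : IsHalaszClass κ f Λf) {p : ℕ} (hp : p.Prime) :
    logCoeff Λf p = f p := by
  have h1 := h.conv p hp.one_le
  rw [Nat.Prime.sum_divisors hp, Nat.div_self hp.pos, Nat.div_one, h.map_one,
    h.apply_zero_one le_rfl, zero_mul, add_zero, mul_one] at h1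
  have : (Real.log p : ℂ) ≠ 0 := by
    exact_mod_cast (Real.log_pos (by exact_mod_cast hp.one_lt)).ne'
  rw [logCoeff, ← h1, mul_div_cancel_right₀ _ this]

theorem summable_vonMangoldt_div_not_prime :
    Summable fun n : ℕ => (if n.Prime then 0 else Λ n) / (n:ℝ) := by
  have := ArithmeticFunction.vonMangoldt.summable_residueClass_non_primes_div (q := 1) 0
  refine this.congr fun n => ?_
  congr 2
  simp [ArithmeticFunction.vonMangoldt.residueClass, Subsingleton.elim (n : ZMod 1) 0]

theorem IsHalaszClass.re_le_of_nonneg (h : IsHalaszClass κ f Λf)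
    (hf : ∀ n, ∃ r : ℝ, 0 ≤ r ∧ f n = r) {σ : ℝ} (hσ : 0 < σ) (t : ℝ) :
    (LSeries (logCoeff Λf) (vline σ t)).re ≤
      κ * ∑' n : ℕ, logWeight σ n * max (Real.cos (t * Real.log n)) 0 +
      κ * (1 / Real.log 2 * ∑' n : ℕ, (if n.Prime then 0 else Λ n) / (n:ℝ)) := by
  have hsum : Summable fun n : ℕ => logWeight σ n * max (Real.cos (t * Real.log n)) 0 :=
    Summable.of_nonneg_of_le (fun n => mul_nonneg (logWeight_nonneg _ _) (le_max_right _ _))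
      (fun n => mul_le_of_le_one_right (logWeight_nonneg _ _)
        (max_le (Real.cos_le_one _) zero_le_one)) (summable_logWeight hσ)
  refine hasSum_le (fun n => ?_) (h.hasSum_re hσ t) ((hsum.hasSum.mul_left κ).add
    ((summable_vonMangoldt_div_not_prime.hasSum.mul_left (1 / Real.log 2)).mul_left κ))
  have hκ := h.nonneg_kappa
  have hβ : 0 ≤ (n:ℝ) ^ (-(1 + σ)) := by positivity
  by_cases hn : n.Prime
  · rw [if_pos hn, zero_div, mul_zero, mul_zero, add_zero]
    obtain ⟨r, hr0, hr⟩ := hf n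
    have hc := h.logCoeff_prime hn
    have hrκ : r ≤ κ * (Λ n / Real.log n) := by
      have := h.norm_logCoeff_le n
      rwa [hc, hr, norm_real, Real.norm_of_nonneg hr0] at this
    rw [hc, hr, re_ofReal_mul, exp_ofReal_mul_I_re, Real.cos_neg, logWeight]
    calc r * Real.cos (t * Real.log n) * (n:ℝ) ^ (-(1 + σ))
        ≤ r * max (Real.cos (t * Real.log n)) 0 * (n:ℝ) ^ (-(1 + σ)) := by
          gcongr; exact le_max_left _ _
      _ ≤ κ * (Λ n / Real.log n) * max (Real.cos (t * Real.log n)) 0 * (n:ℝ) ^ (-(1 + σ)) := by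
          gcongr
      _ = _ := by ring
  · rw [if_neg hn]
    have h1 := h.re_logCoeff_mul_le n (cexp ((-(t * Real.log n) : ℝ) * I)) hβ
    rw [norm_exp_ofReal_mul_I, mul_one] at h1
    have h2 : 0 ≤ κ * (logWeight σ n * max (Real.cos (t * Real.log n)) 0) :=
      mul_nonneg hκ (mul_nonneg (logWeight_nonneg _ _) (le_max_right _ _))
    have h3 : Λ n / Real.log n * (n:ℝ) ^ (-(1 + σ)) ≤ 1 / Real.log 2 * (Λ n / n) := by
      rcases Nat.eq_zero_or_pos n with rfl | hn0
      · simp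
      have : (n:ℝ) ^ (-(1 + σ)) ≤ (n:ℝ)⁻¹ := by
        rw [← Real.rpow_neg_one]
        exact Real.rpow_le_rpow_of_exponent_le (by exact_mod_cast hn0) (by linarith)
      calc _ ≤ (1 / Real.log 2 * Λ n) * (n:ℝ)⁻¹ := by
            gcongr
            exact vonMangoldt_div_log_le n
        _ = _ := by ring
    linarith [mul_le_mul_of_nonneg_left h3 hκ]

theorem exists_norm_LSeries_le_of_isMax_nonneg (hκ : 0 ≤ κ) : ∃ C : ℝ, 0 < C ∧
    ∀ f Λf : ℕ → ℂ, IsHalaszClass κ f Λf → (∀ n, ∃ r : ℝ, 0 ≤ r ∧ f n = r) →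
    ∀ L : ℝ, 0 < L → 1 ≤ Real.log L → ∀ t₁ : ℝ, |t₁| ≤ L ^ κ →
    (∀ t : ℝ, |t| ≤ L ^ κ → ‖LSeries f (vline (1 / L) t)‖ ≤ ‖LSeries f (vline (1 / L) t₁)‖) →
    ∀ t : ℝ, |t| ≤ L ^ (2 * κ) → ∀ σ ρ : ℝ, 1 / L ≤ σ → σ ≤ ρ → ρ ≤ |t - t₁| →
    ρ * Real.log L ^ 2 ≤ 1 →
    ‖LSeries f (vline σ t)‖ ≤ C * ρ ^ (-κ) * (ρ * L) ^ (κ * (1 / Real.pi)) := by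
  have hD : (0:ℝ) ≤ (3 + (2 * κ + 1)) ^ 2 := sq_nonneg _
  have hsc : (0:ℝ) ≤ 4 / Real.pi := by positivity
  obtain ⟨C₁, hC₁, hs⟩ := exists_tsum_logWeight_sub_mul_le (A := 3) (c₀ := 0)
    (φ := Real.cos) (a := fun k : ℕ => if k = 0 then 1 else 0) (by norm_num) le_rfl hD (fun k => by
      split_ifs with hk
      · simp [hk]
      · rw [abs_zero]; positivity)
    (fun θ => by
      have := hasSum_ite_eq (0:ℕ) (Real.cos θ)
      rw [sub_zero]
      refine (congrArg₂ (fun a b => HasSum a b) (funext fun k => ?_) rfl).mp this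
      split_ifs with hk <;> simp [hk])
  obtain ⟨C₂, hC₂, hc⟩ := exists_tsum_logWeight_sub_mul_le (A := 3)
    (φ := fun θ => 2 * |Real.cos (θ / 2)|)
    (a := fun k : ℕ => 8 / Real.pi / (1 - 4 * ((k:ℝ) + 1) ^ 2) * (-1) ^ (k + 1))
    (by norm_num) hsc hD (fun k => by
      rw [abs_mul, abs_pow, abs_neg, abs_one, one_pow, mul_one]; exact abs_sine_coeff_le k)
    hasSum_two_mul_abs_cos
  set N := 1 / Real.log 2 * ∑' n : ℕ, (if n.Prime then 0 else Λ n) / (n:ℝ) with hN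
  refine ⟨Real.exp (κ * (C₁ / 2 + C₂ / 4 + Real.log 2 + N)), Real.exp_pos _, ?_⟩
  intro f Λf h hf L hL0 hL t₁ ht₁ hmax t ht σ ρ hσ hσρ hρτ hρ
  have hσ₁ : 0 < 1 / L := by positivity
  have hσ0 : 0 < σ := hσ₁.trans_le hσ
  have hρ0 : 0 < ρ := hσ0.trans_le hσρ
  have hρ1 : ρ ≤ 1 := (le_mul_of_one_le_right hρ0.le (one_le_pow₀ hL)).trans hρ
  have hL2 : 2 ≤ L := by
    rw [Real.le_log_iff_exp_le hL0] at hL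
    linarith [Real.add_one_le_exp 1]
  have hTT : |t - t₁| ≤ 2 * L ^ (2 * κ) := by
    have : L ^ κ ≤ L ^ (2 * κ) := Real.rpow_le_rpow_of_exponent_le (by linarith) (by linarith)
    exact (abs_sub _ _).trans (by linarith)
  have hTT2 : 2 * L ^ (2 * κ) ≤ L ^ (2 * κ + 1) := by
    rw [Real.rpow_add_one hL0.ne', mul_comm]; gcongr
  have hDρ : ∀ τ, |τ| ≤ 2 * |t - t₁| →
      ρ * Real.log (|τ| + 6) ^ 2 ≤ (3 + (2 * κ + 1)) ^ 2 := by
    intro τ hτ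
    have h6 := one_le_log_abs_add_six τ
    have := log_abs_add_six_le (K := 2 * κ + 1) (by positivity) hL hL0 (hτ.trans
      (mul_le_mul_of_nonneg_left (hTT.trans hTT2) two_pos.le))
    calc ρ * Real.log (|τ| + 6) ^ 2 ≤ ρ * ((3 + (2 * κ + 1)) * Real.log L) ^ 2 := by gcongr
      _ = (3 + (2 * κ + 1)) ^ 2 * (ρ * Real.log L ^ 2) := by ring
      _ ≤ (3 + (2 * κ + 1)) ^ 2 * 1 := by gcongr
      _ = _ := mul_one _
  have habs2 : |2 * (t - t₁)| = 2 * |t - t₁| := by rw [abs_mul, abs_of_pos two_pos]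
  obtain ⟨hsum1, h1⟩ := hs σ ρ (t - t₁) hσ0 hσρ hρ1 hρτ
    (hDρ _ (by linarith [abs_nonneg (t - t₁)]))
  obtain ⟨hsum2, h2⟩ := hc σ ρ (2 * (t - t₁)) hσ0 hσρ hρ1
    (by rw [habs2]; linarith [abs_nonneg (t - t₁)]) (hDρ _ habs2.le)
  rw [h.LSeries_eq_of_isMax hf hσ₁ (hmax 0 (by rw [abs_zero]; positivity))]
  have h3 := h.re_le_of_nonneg hf hσ0 (t - t₁)
  have h5 : ∑' n : ℕ, logWeight σ n * max (Real.cos ((t - t₁) * Real.log n)) 0 ≤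
      1 / 2 * (0 * Real.log (ρ / σ) + C₁) + 1 / 4 * (4 / Real.pi * Real.log (ρ / σ) + C₂) +
      Real.log (2 / ρ) := by
    have hq := summable_logWeight hρ0
    have hmx : ∀ θ : ℝ, max (Real.cos θ) 0 =
        1 / 2 * Real.cos θ + 1 / 4 * (2 * |Real.cos (2 * θ / 2)|) := fun θ => by
      rw [mul_div_cancel_left₀ _ two_ne_zero]
      rcases le_total 0 (Real.cos θ) with h | h
      · rw [max_eq_left h, abs_of_nonneg h]; ring
      · rw [max_eq_right h, abs_of_nonpos h]; ring
    have hcos : ∀ θ : ℝ, max (Real.cos θ) 0 ≤ 1 := fun θ => max_le (Real.cos_le_one _) zero_le_one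
    have hs3 := ((hsum1.mul_left (1 / 2)).add (hsum2.mul_left (1 / 4)))
    calc _ ≤ ∑' n : ℕ, ((1 / 2 * ((logWeight σ n - logWeight ρ n) *
            Real.cos ((t - t₁) * Real.log n)) + 1 / 4 * ((logWeight σ n - logWeight ρ n) *
            (2 * |Real.cos (2 * (t - t₁) * Real.log n / 2)|))) + logWeight ρ n) := by
          refine Summable.tsum_le_tsum (fun n => ?_) (Summable.of_nonneg_of_le
            (fun n => mul_nonneg (logWeight_nonneg _ _) (le_max_right _ _))
            (fun n => mul_le_of_le_one_right (logWeight_nonneg _ _) (hcos _))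
            (summable_logWeight hσ0)) (hs3.add hq)
          have h6 := mul_le_mul_of_nonneg_left (hcos ((t - t₁) * Real.log n))
            (logWeight_nonneg ρ n)
          have h7 := hmx ((t - t₁) * Real.log n)
          rw [← mul_assoc 2 (t - t₁)] at h7
          rw [h7] at h6 ⊢
          linarith
      _ ≤ _ := by
          rw [hs3.tsum_add hq, (hsum1.mul_left (1 / 2)).tsum_add (hsum2.mul_left (1 / 4)),
            tsum_mul_left, tsum_mul_left]
          linarith [tsum_logWeight_le hρ0 hρ1]
  rw [h.norm_LSeries_eq_exp hσ0, Real.rpow_def_of_pos hρ0, Real.rpow_def_of_pos (by positivity),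
    ← Real.exp_add, ← Real.exp_add, Real.exp_le_exp]
  have e2 : Real.log (ρ / σ) ≤ Real.log (ρ * L) := by
    refine Real.log_le_log (by positivity) ?_
    rw [div_eq_mul_inv]
    gcongr
    rw [inv_le_comm₀ hσ0 hL0, ← one_div]; exact hσ
  have e4 : Real.log (2 / ρ) = Real.log 2 - Real.log ρ := Real.log_div two_ne_zero hρ0.ne'
  rw [e4] at h5
  have k1 := mul_le_mul_of_nonneg_left h5 hκ
  have k2 := mul_le_mul_of_nonneg_left e2 (show 0 ≤ κ * (1 / Real.pi) by positivity)
  have e5 : 4 / Real.pi = 4 * (1 / Real.pi) := by ring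
  rw [e5] at k1
  rw [← hN] at h3
  nlinarith
end RepulsionNonneg

section MainBound

variable {κ : ℝ} {f Λf : ℕ → ℂ}

theorem mul_rpow_sub_one_le {κ E A L v : ℝ} (hE1 : E ≤ 1) (hEκ : E ≤ κ) (hA : 0 < A) (hAv : A ≤ v)
    (hvL : v ≤ L) : A * v ^ (κ - 1) ≤ A ^ E * L ^ (κ - E) := by
  have hv : 0 < v := by linarith
  calc A * v ^ (κ - 1) = A / v * v ^ κ := by rw [Real.rpow_sub_one hv.ne']; ring
    _ ≤ (A / v) ^ E * v ^ κ := by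
        gcongr
        exact Real.self_le_rpow_of_le_one (by positivity) (by rwa [div_le_one hv]) hE1
    _ = A ^ E * v ^ (κ - E) := by
        rw [Real.div_rpow hA.le hv.le, Real.rpow_sub hv]; ring
    _ ≤ _ := by gcongr

theorem mul_le_of_repulsion {κ E₀ E A L C₀ σ δ F W : ℝ} (hκ : 0 ≤ κ) (hEE : E ≤ E₀)
    (hE1 : E ≤ 1) (hEκ : E ≤ κ) (hC₀ : 0 ≤ C₀) (hA : 1 ≤ A) (hAL : A ≤ L) (hσL : 1 / L ≤ σ)
    (hσA : σ ≤ 1 / (2 * A)) (hF : 0 ≤ F) (hW : 0 ≤ W) (hF1 : F ≤ (1 + 1 / σ) ^ κ)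
    (hrep : ∀ ρ, σ ≤ ρ → ρ ≤ δ → ρ ≤ 1 / A → F ≤ C₀ * ρ ^ (-κ) * (ρ * L) ^ (κ - E₀))
    (hW2 : W ≤ 2) (hWA : W ≤ 2 * (σ + δ) * A) :
    F * W ≤ (4 * 2 ^ κ + 4 * C₀) * (A ^ E * L ^ (κ - E)) := by
  have hA0 : 0 < A := by linarith
  have hL0 : 0 < L := by linarith
  have hσ0 : 0 < σ := lt_of_lt_of_le (by positivity) hσL
  have hσA' : σ ≤ 1 / A := hσA.trans (by gcongr; linarith)
  have hB : 0 ≤ A ^ E * L ^ (κ - E) := by positivity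
  have h2κ : (0:ℝ) ≤ 2 ^ κ := by positivity
  have hsplit : ∀ ρ, σ ≤ ρ → ρ ≤ 1 / A →
      C₀ * ρ ^ (-κ) * (ρ * L) ^ (κ - E₀) ≤ C₀ * (ρ ^ (-E) * L ^ (κ - E)) := by
    intro ρ h1 h2
    have hρ0 : 0 < ρ := hσ0.trans_le h1
    have hρL : 1 ≤ ρ * L := by
      rw [div_le_iff₀ hL0] at hσL; nlinarith
    calc C₀ * ρ ^ (-κ) * (ρ * L) ^ (κ - E₀) ≤ C₀ * ρ ^ (-κ) * (ρ * L) ^ (κ - E) := by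
          gcongr
      _ = C₀ * (ρ ^ (-κ) * ρ ^ (κ - E) * L ^ (κ - E)) := by
          rw [Real.mul_rpow hρ0.le hL0.le]; ring
      _ = _ := by rw [← Real.rpow_add hρ0]; congr 4; ring
  rcases le_or_gt (1 / A) δ with hδ | hδ
  · have h1 := (hrep (1 / A) hσA' hδ le_rfl).trans (hsplit _ hσA' le_rfl)
    rw [one_div, Real.inv_rpow hA0.le, ← Real.rpow_neg hA0.le, neg_neg] at h1
    calc F * W ≤ C₀ * (A ^ E * L ^ (κ - E)) * 2 := by gcongr
      _ ≤ _ := by nlinarith [mul_nonneg hC₀ hB, mul_nonneg h2κ hB]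
  rcases le_or_gt δ σ with hδσ | hδσ
  · have h1 : F ≤ 2 ^ κ * σ ^ (-κ) := by
      refine hF1.trans ?_
      rw [Real.rpow_neg hσ0.le, ← div_eq_mul_inv, ← Real.div_rpow two_pos.le hσ0.le]
      have h2 : σ ≤ 1 := hσA'.trans (by rw [div_le_one hA0]; exact hA)
      have h3 : (1:ℝ) ≤ 1 / σ := by rwa [le_div_iff₀ hσ0, one_mul]
      have h4 : 2 / σ = 1 / σ + 1 / σ := by ring
      gcongr
      linarith
    have h2 : W ≤ 4 * (σ * A) := by nlinarith
    have h3 : σ * A ≤ 1 := by rwa [le_div_iff₀ hA0] at hσA'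
    calc F * W ≤ 2 ^ κ * σ ^ (-κ) * (4 * (σ * A) ^ E) := by
          refine mul_le_mul h1 (h2.trans ?_) hW (by positivity)
          gcongr
          exact Real.self_le_rpow_of_le_one (by positivity) h3 hE1
      _ = 4 * 2 ^ κ * (A ^ E * (σ ^ (-κ) * σ ^ E)) := by
          rw [Real.mul_rpow hσ0.le hA0.le]; ring
      _ = 4 * 2 ^ κ * (A ^ E * σ⁻¹ ^ (κ - E)) := by
          rw [← Real.rpow_add hσ0, Real.inv_rpow hσ0.le, ← Real.rpow_neg hσ0.le]
          congr 3; ring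
      _ ≤ 4 * 2 ^ κ * (A ^ E * L ^ (κ - E)) := by
          have : σ⁻¹ ≤ L := by rwa [inv_le_comm₀ hσ0 hL0, ← one_div]
          gcongr
      _ ≤ _ := by nlinarith [mul_nonneg hC₀ hB]
  · have hδ0 : 0 < δ := hσ0.trans hδσ
    have h1 := (hrep δ hδσ.le le_rfl hδ.le).trans (hsplit _ hδσ.le hδ.le)
    have h2 : W ≤ 4 * (δ * A) := by nlinarith
    have h3 : δ * A ≤ 1 := by rw [lt_div_iff₀ hA0] at hδ; exact hδ.le
    calc F * W ≤ C₀ * (δ ^ (-E) * L ^ (κ - E)) * (4 * (δ * A) ^ E) := by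
          refine mul_le_mul h1 (h2.trans ?_) hW (by positivity)
          gcongr
          exact Real.self_le_rpow_of_le_one (by positivity) h3 hE1
      _ = 4 * C₀ * (A ^ E * L ^ (κ - E)) * (δ ^ (-E) * δ ^ E) := by
          rw [Real.mul_rpow hδ0.le hA0.le]; ring
      _ = 4 * C₀ * (A ^ E * L ^ (κ - E)) := by
          rw [← Real.rpow_add hδ0, neg_add_cancel, Real.rpow_zero, mul_one]
      _ ≤ _ := by nlinarith [mul_nonneg h2κ hB]

theorem norm_one_sub_twist_le_mul (t : ℝ) {w σ : ℝ} (hw : 1 ≤ w) (hσ : 0 < σ) :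
    ‖1 - cexp (-(σ + (t : ℝ) * I) * Real.log w)‖ ≤ 2 * (σ + |t|) * Real.log w := by
  have hl := Real.log_nonneg hw
  set z : ℂ := -(σ + (t : ℝ) * I) * Real.log w with hz
  have hzn : ‖z‖ ≤ (σ + |t|) * Real.log w := by
    rw [hz, norm_mul, norm_neg, norm_real, Real.norm_of_nonneg hl]
    gcongr
    refine (norm_add_le _ _).trans ?_
    rw [norm_mul, norm_I, norm_real, norm_real, mul_one, Real.norm_of_nonneg hσ.le,
      Real.norm_eq_abs]
  rcases le_or_gt ‖z‖ 1 with h | h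
  · rw [norm_sub_rev]
    have := Complex.norm_exp_sub_one_le h
    linarith
  · have := norm_one_sub_twist_le t hw hσ
    rw [← hz] at this
    linarith

/-- The repulsion hypothesis: away from `t₁`, the Dirichlet series of `f` is small close to the
line `Re s = 1`. -/
def IsRepelled (κ E₀ C₀ L T t₁ : ℝ) (f : ℕ → ℂ) : Prop :=
  ∀ t : ℝ, |t| ≤ T → ∀ σ ρ : ℝ, 1 / L ≤ σ → σ ≤ ρ → ρ ≤ |t - t₁| → ρ * Real.log L ^ 2 ≤ 1 →
    ‖LSeries f (vline σ t)‖ ≤ C₀ * ρ ^ (-κ) * (ρ * L) ^ (κ - E₀)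

theorem IsHalaszClass.norm_LSeries_mul_le_of_isRepelled (h : IsHalaszClass κ f Λf)
    {E₀ E A L C₀ T t₁ w : ℝ} (hEE : E ≤ E₀) (hE1 : E ≤ 1) (hEκ : E ≤ κ)
    (hC₀ : 0 ≤ C₀) (hA : 1 ≤ A) (hAL : A ≤ L) (hw : 1 ≤ w)
    (hwA : Real.log w ≤ A) (hLA : Real.log L ^ 2 ≤ A) (hrep : IsRepelled κ E₀ C₀ L T t₁ f)
    {σ : ℝ} (hσL : 1 / L ≤ σ) (hσA : σ ≤ 1 / (2 * A)) {t : ℝ} (ht : |t| ≤ T) :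
    ‖LSeries f (vline σ t)‖ * ‖1 - cexp (-(σ + (t - t₁ : ℝ) * I) * Real.log w)‖ ≤
      (4 * 2 ^ κ + 4 * C₀) * (A ^ E * L ^ (κ - E)) := by
  have hA0 : 0 < A := by linarith
  have hσ0 : 0 < σ := lt_of_lt_of_le (one_div_pos.2 (by linarith)) hσL
  refine mul_le_of_repulsion (δ := |t - t₁|) h.nonneg_kappa hEE hE1 hEκ hC₀ hA hAL hσL hσA
    (norm_nonneg _) (norm_nonneg _) (h.norm_LSeries_le hσ0 t) (fun ρ h1 h2 h3 => ?_)
    (norm_one_sub_twist_le _ hw hσ0) ((norm_one_sub_twist_le_mul _ hw hσ0).trans (by gcongr))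
  refine hrep t ht σ ρ hσL h1 h2 ?_
  have hρ0 : 0 < ρ := hσ0.trans_le h1
  calc ρ * Real.log L ^ 2 ≤ 1 / A * A := by gcongr
    _ = 1 := by field_simp

/-- A mean square bound for the increments of the summatory function of `f(n) log n`. -/
theorem IsHalaszClass.exists_integral_sq_le_of_isRepelled (hκ : 0 ≤ κ) {E₀ E C₀ : ℝ}
    (hE0 : 0 ≤ E) (hEE : E ≤ E₀) (hE1 : E ≤ 1) (hEκ : E ≤ κ) (hC₀ : 0 ≤ C₀) :
    ∃ K : ℝ, 0 < K ∧ ∀ f Λf : ℕ → ℂ, IsHalaszClass κ f Λf → ∀ A L T t₁ w : ℝ, 1 ≤ A → A ≤ L →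
    1 ≤ w → Real.log w ≤ A → Real.log L ^ 2 ≤ A → 7 ≤ T → L ^ (2 * E) ≤ T →
    IsRepelled κ E₀ C₀ L T t₁ f → ∀ σ : ℝ, 1 / L ≤ σ → σ ≤ 1 / (2 * A) →
    Integrable (fun v => ‖incr (fun n : ℕ => f n * (Real.log n : ℂ))
      (cexp ((1 + t₁ * I) * Real.log w)) w (Real.exp v)‖ ^ 2 * Real.exp (-(2 * (1 + σ)) * v)) ∧
    ∫ v, ‖incr (fun n : ℕ => f n * (Real.log n : ℂ))
      (cexp ((1 + t₁ * I) * Real.log w)) w (Real.exp v)‖ ^ 2 * Real.exp (-(2 * (1 + σ)) * v) ≤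
      K / σ * (A ^ E * L ^ (κ - E)) ^ 2 := by
  refine ⟨(κ * (Real.log 4 + 4)) ^ 2 * ((4 * 2 ^ κ + 4 * C₀) ^ 2 + 2800 * 2 ^ (2 * κ)) + 1,
    by positivity, ?_⟩
  intro f Λf h A L T t₁ w hA hAL hw hwA hLA hT hET hrep σ hσL hσA
  have hA0 : 0 < A := by linarith
  have hL1 : 1 ≤ L := by linarith
  have hL0 : 0 < L := by linarith
  have hσ0 : 0 < σ := lt_of_lt_of_le (one_div_pos.2 hL0) hσL
  have hσ1 : σ ≤ 1 := hσA.trans (by rw [div_le_one (by positivity)]; linarith)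
  set B := A ^ E * L ^ (κ - E) with hB
  have hB0 : 0 ≤ B := by positivity
  obtain ⟨h1, h2⟩ := h.integral_sq_incr_le hσ0 hσ1 hw t₁
    (M := (4 * 2 ^ κ + 4 * C₀) * B) (T := T) hT
    fun t ht => h.norm_LSeries_mul_le_of_isRepelled hEE hE1 hEκ hC₀ hA hAL hw hwA hLA hrep
      hσL hσA ht
  refine ⟨h1, h2.trans ?_⟩
  have h3 : (1 + 1 / σ) ^ (2 * κ) / T ≤ 2 ^ (2 * κ) * B ^ 2 := by
    have h4 : 1 + 1 / σ ≤ 2 * L := by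
      have : 1 / σ ≤ L := by rwa [one_div, inv_le_comm₀ hσ0 hL0, ← one_div]
      linarith
    have hT0 : 0 < T := by linarith
    rw [div_le_iff₀ hT0]
    calc (1 + 1 / σ) ^ (2 * κ) ≤ (2 * L) ^ (2 * κ) := by gcongr
      _ = 2 ^ (2 * κ) * (L ^ (κ - E)) ^ 2 * L ^ (2 * E) := by
          rw [Real.mul_rpow two_pos.le hL0.le, ← Real.rpow_natCast (L ^ (κ - E)),
            ← Real.rpow_mul hL0.le, mul_assoc, ← Real.rpow_add hL0]
          congr 2; push_cast; ring
      _ ≤ 2 ^ (2 * κ) * B ^ 2 * T := by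
          have : L ^ (κ - E) ≤ B := le_mul_of_one_le_left (by positivity)
            (Real.one_le_rpow hA hE0)
          gcongr
  have h5 : 0 ≤ (κ * (Real.log 4 + 4)) ^ 2 := sq_nonneg _
  calc (κ * (Real.log 4 + 4)) ^ 2 / σ * (((4 * 2 ^ κ + 4 * C₀) * B) ^ 2 +
        2800 * (1 + 1 / σ) ^ (2 * κ) / T)
      = (κ * (Real.log 4 + 4)) ^ 2 / σ * (((4 * 2 ^ κ + 4 * C₀) * B) ^ 2 +
        2800 * ((1 + 1 / σ) ^ (2 * κ) / T)) := by ring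
    _ ≤ (κ * (Real.log 4 + 4)) ^ 2 / σ * (((4 * 2 ^ κ + 4 * C₀) * B) ^ 2 +
        2800 * (2 ^ (2 * κ) * B ^ 2)) := by gcongr
    _ = (κ * (Real.log 4 + 4)) ^ 2 * ((4 * 2 ^ κ + 4 * C₀) ^ 2 + 2800 * 2 ^ (2 * κ)) / σ
        * B ^ 2 := by ring
    _ ≤ _ := by gcongr; linarith

end MainBound

section Identities

open ArithmeticFunction Finset

variable {κ : ℝ} {f Λf : ℕ → ℂ}

theorem intervalIntegrable_exp_neg_mul_incr (f : ℕ → ℂ) {c : ℂ} {w : ℝ} (hw : 1 ≤ w)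
    (hc : ‖c‖ = w) (a b : ℝ) :
    IntervalIntegrable (fun v => Real.exp (-v) * ‖incr f c w (Real.exp v)‖) volume a b := by
  have := intervalIntegrable_exp_mul_incr f hw hc zero_le_one (-a) (-b)
  rw [IntervalIntegrable.iff_comp_neg] at this
  simpa using this

theorem IsHalaszClass.summatory_mul_log (h : IsHalaszClass κ f Λf) (x : ℝ) :
    summatory (fun n : ℕ => f n * (Real.log n : ℂ)) x =
      ∑ d ∈ Icc 1 ⌊x⌋₊, Λf d * summatory f (x / d) := by
  have h1 := sum_Icc_sum_divisors (fun d m => Λf d * f m) ⌊x⌋₊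
  rw [summatory, Finset.sum_congr rfl fun n hn => h.conv n (Finset.mem_Icc.1 hn).1, h1]
  refine Finset.sum_congr rfl fun d _ => ?_
  rw [summatory, Finset.mul_sum, Nat.floor_div_natCast]

theorem IsHalaszClass.incr_mul_log (h : IsHalaszClass κ f Λf) (c : ℂ) {x w : ℝ} (hw : 1 ≤ w)
    (hx : 0 ≤ x) : incr (fun n : ℕ => f n * (Real.log n : ℂ)) c w x =
      ∑ d ∈ Icc 1 ⌊x⌋₊, Λf d * incr f c w (x / d) := by
  have hw0 : 0 < w := by linarith
  have h2 : summatory (fun n : ℕ => f n * (Real.log n : ℂ)) (x / w) =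
      ∑ d ∈ Icc 1 ⌊x⌋₊, Λf d * summatory f (x / d / w) := by
    rw [h.summatory_mul_log]
    have hle : x / w ≤ x := div_le_self hx hw
    refine Finset.sum_subset_zero_on_sdiff (Finset.Icc_subset_Icc_right (Nat.floor_le_floor hle))
      (fun d hd => ?_) (fun d _ => by rw [div_right_comm])
    obtain ⟨hd1, hd2⟩ := Finset.mem_sdiff.1 hd
    have hd0 : 1 ≤ d := (Finset.mem_Icc.1 hd1).1
    have hdw : ⌊x / w⌋₊ < d := by
      by_contra hcon
      exact hd2 (Finset.mem_Icc.2 ⟨hd0, not_lt.1 hcon⟩)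
    have hdpos : (0:ℝ) < d := by exact_mod_cast hd0
    rw [summatory_of_lt_one _, mul_zero]
    rw [div_right_comm, div_lt_one hdpos]
    exact (Nat.floor_lt (by positivity)).1 hdw
  rw [incr, h.summatory_mul_log, h2, Finset.mul_sum, ← Finset.sum_sub_distrib]
  exact Finset.sum_congr rfl fun d _ => by rw [incr]; ring

theorem IsHalaszClass.norm_incr_mul_log_le (h : IsHalaszClass κ f Λf) (c : ℂ) {x w : ℝ}
    (hw : 1 ≤ w) (hx : 0 ≤ x) : ‖incr (fun n : ℕ => f n * (Real.log n : ℂ)) c w x‖ ≤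
      κ * ∑ d ∈ Icc 1 ⌊x⌋₊, Λ d * ‖incr f c w (x / d)‖ := by
  rw [h.incr_mul_log c hw hx, Finset.mul_sum]
  refine norm_sum_le_of_le _ fun d hd => ?_
  rw [norm_mul, ← mul_assoc]
  exact mul_le_mul_of_nonneg_right (h.bound d (Finset.mem_Icc.1 hd).1) (norm_nonneg _)

theorem exists_norm_log_mul_summatory_sub_le (hκ : 0 ≤ κ) : ∃ K : ℝ, 0 < K ∧ ∀ f : ℕ → ℂ,
    IsDominated κ (fun n => ‖f n‖) → ∀ u : ℝ, 1 ≤ u →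
    ‖(Real.log u : ℂ) * summatory f u - summatory (fun n : ℕ => f n * (Real.log n : ℂ)) u‖ ≤
      K * u * (1 + Real.log u) ^ (κ - 1) := by
  obtain ⟨K, hK, hb⟩ := exists_sum_mul_sqrt_le hκ
  refine ⟨2 * K, by positivity, fun f hf u hu => ?_⟩
  have hu0 : 0 < u := by linarith
  rw [summatory, summatory, Finset.mul_sum, ← Finset.sum_sub_distrib]
  calc _ ≤ ∑ n ∈ Icc 1 ⌊u⌋₊, 2 * (‖f n‖ * √(u / n)) := by
        refine norm_sum_le_of_le _ fun n hn => ?_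
        obtain ⟨h1, h2⟩ := Finset.mem_Icc.1 hn
        have hn0 : (0:ℝ) < n := by exact_mod_cast h1
        have hnu : (n:ℝ) ≤ u := (Nat.le_floor_iff hu0.le).1 h2
        have e : (Real.log u : ℂ) * f n - f n * (Real.log n : ℂ) =
            f n * ((Real.log (u / n) : ℝ) : ℂ) := by
          rw [Real.log_div hu0.ne' hn0.ne']; push_cast; ring
        have h3 : 1 ≤ u / n := (one_le_div hn0).2 hnu
        have h4 : Real.log (u / n) ≤ 2 * √(u / n) := by
          have := Real.log_le_rpow_div (zero_le_one.trans h3) (show (0:ℝ) < 1 / 2 by norm_num)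
          rw [← Real.sqrt_eq_rpow] at this
          linarith
        rw [e, norm_mul, norm_real, Real.norm_of_nonneg (Real.log_nonneg h3)]
        calc ‖f n‖ * Real.log (u / n) ≤ ‖f n‖ * (2 * √(u / n)) := by gcongr
          _ = _ := by ring
    _ ≤ 2 * (K * u * (1 + Real.log u) ^ (κ - 1)) := by
        rw [← Finset.mul_sum]
        exact mul_le_mul_of_nonneg_left (hb _ hf u hu) two_pos.le
    _ = _ := by ring

/-- Comparison of the increments for `f(n)` and for `f(n) log n`. -/
theorem exists_mul_norm_incr_le (hκ : 0 ≤ κ) : ∃ K : ℝ, 0 < K ∧ ∀ f : ℕ → ℂ,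
    IsDominated κ (fun n => ‖f n‖) → ∀ w : ℝ, 1 ≤ w → ∀ c : ℂ, ‖c‖ = w → ∀ v : ℝ,
    2 * Real.log w ≤ v → v * ‖incr f c w (Real.exp v)‖ ≤
      ‖incr (fun n : ℕ => f n * (Real.log n : ℂ)) c w (Real.exp v)‖ +
      K * Real.exp v * ((1 + Real.log w) * (1 + v) ^ (κ - 1)) := by
  obtain ⟨K₁, hK₁, h1⟩ := exists_norm_log_mul_summatory_sub_le hκ
  obtain ⟨K₂, hK₂, h2⟩ := exists_sum_le hκ
  refine ⟨K₁ + (K₁ + K₂) * 2 ^ |κ - 1|, by positivity, fun f hf w hw c hc v hv => ?_⟩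
  set l := Real.log w with hl
  have hl0 : 0 ≤ l := Real.log_nonneg hw
  have hw0 : 0 < w := by linarith
  have hv0 : 0 ≤ v := by linarith
  have hdiv : Real.exp v / w = Real.exp (v - l) := by rw [Real.exp_sub, hl, Real.exp_log hw0]
  set S := summatory f (Real.exp v)
  set S' := summatory f (Real.exp (v - l)) with hS'
  set H := summatory (fun n : ℕ => f n * (Real.log n : ℂ)) (Real.exp v)
  set H' := summatory (fun n : ℕ => f n * (Real.log n : ℂ)) (Real.exp (v - l))
  have a1 := h1 f hf (Real.exp v) (Real.one_le_exp hv0)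
  have a2 := h1 f hf (Real.exp (v - l)) (Real.one_le_exp (by linarith))
  have a3 : ‖S'‖ ≤ K₂ * Real.exp (v - l) * (1 + (v - l)) ^ (κ - 1) := by
    have := (norm_summatory_le f _).trans (h2 _ hf (Real.exp (v - l))
      (Real.one_le_exp (by linarith)))
    rwa [Real.log_exp] at this
  rw [Real.log_exp] at a1 a2
  set R := (1 + v) ^ (κ - 1) with hR
  have hR0 : 0 < R := by positivity
  have hq : (1 + (v - l)) ^ (κ - 1) ≤ 2 ^ |κ - 1| * R :=
    rpow_le_rpow_abs_mul (by linarith) one_le_two (by linarith) (by linarith)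
  set q : ℝ := 2 ^ |κ - 1| with hqdef
  have hwe : w * Real.exp (v - l) = Real.exp v := by rw [← hdiv]; field_simp
  have key : (v:ℂ) * (S - c * S') = (H - c * H') + ((v * S - H) -
      (c * (((v - l : ℝ) : ℂ) * S' - H') + c * ((l:ℂ) * S'))) := by push_cast; ring
  have e1 : ‖c * (((v - l : ℝ) : ℂ) * S' - H')‖ ≤ Real.exp v * (K₁ * (q * R)) := by
    rw [norm_mul, hc]
    calc _ ≤ w * (K₁ * Real.exp (v - l) * (q * R)) := by
          gcongr; exact a2.trans (by gcongr)
      _ = w * Real.exp (v - l) * (K₁ * (q * R)) := by ring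
      _ = _ := by rw [hwe]
  have e2 : ‖c * ((l:ℂ) * S')‖ ≤ Real.exp v * (l * (K₂ * (q * R))) := by
    rw [norm_mul, hc, norm_mul, norm_real, Real.norm_of_nonneg hl0]
    calc _ ≤ w * (l * (K₂ * Real.exp (v - l) * (q * R))) := by
          gcongr; exact a3.trans (by gcongr)
      _ = w * Real.exp (v - l) * (l * (K₂ * (q * R))) := by ring
      _ = _ := by rw [hwe]
  have hfin : v * ‖S - c * S'‖ ≤ ‖H - c * H'‖ + (K₁ * Real.exp v * R +
      (Real.exp v * (K₁ * (q * R)) + Real.exp v * (l * (K₂ * (q * R))))) := by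
    calc v * ‖S - c * S'‖ = ‖(v:ℂ) * (S - c * S')‖ := by
          rw [norm_mul, norm_real, Real.norm_of_nonneg hv0]
      _ ≤ _ := by
          rw [key]
          refine (norm_add_le _ _).trans (add_le_add_right ((norm_sub_le _ _).trans
            (add_le_add a1 ((norm_add_le _ _).trans (add_le_add e1 e2)))) _)
  rw [incr, incr, hdiv]
  refine hfin.trans (add_le_add_right ?_ _)
  have p1 : 0 ≤ Real.exp v * R * l := by positivity
  have p2 : 0 ≤ Real.exp v * R * q := by positivity
  have p3 : 0 ≤ Real.exp v * R * q * l := by positivity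
  have : (K₁ + (K₁ + K₂) * q) * Real.exp v * ((1 + l) * R) - (K₁ * Real.exp v * R +
      (Real.exp v * (K₁ * (q * R)) + Real.exp v * (l * (K₂ * (q * R))))) =
      K₁ * (Real.exp v * R * l) + K₁ * (Real.exp v * R * q * l) + K₂ * (Real.exp v * R * q) := by
    ring
  nlinarith [mul_nonneg hK₁.le p1, mul_nonneg hK₁.le p3, mul_nonneg hK₂.le p2]

end Identities

section IntegralBound

open ArithmeticFunction Finset

variable {κ : ℝ} {f Λf : ℕ → ℂ}

theorem integral_one_add_rpow_le (hκ : 0 < κ) (b : ℝ) :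
    ∫ v in (0:ℝ)..b, (1 + v) ^ (κ - 1) ≤ (1 + b) ^ κ / κ := by
  have h := intervalIntegral.integral_comp_add_left (a := 0) (b := b)
    (fun v : ℝ => v ^ (κ - 1)) 1
  rw [h, integral_rpow (Or.inl (by linarith))]
  simp only [add_zero, Real.one_rpow, sub_add_cancel]
  gcongr
  linarith

theorem intervalIntegrable_one_add_rpow {p b : ℝ} (hb : 0 ≤ b) :
    IntervalIntegrable (fun v : ℝ => (1 + v) ^ p) volume 0 b := by
  refine ContinuousOn.intervalIntegrable fun v hv => ?_
  rw [Set.uIcc_of_le hb] at hv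
  exact ((continuousAt_const.add continuousAt_id).rpow_const
    (Or.inl (ne_of_gt (show (0:ℝ) < 1 + v by linarith [hv.1])))).continuousWithinAt

theorem exists_integral_summatory_le (hκ : 0 < κ) : ∃ K : ℝ, 0 < K ∧ ∀ a : ℕ → ℝ,
    IsDominated κ a → ∀ b : ℝ, 0 ≤ b →
    ∫ v in (0:ℝ)..b, Real.exp (-v) * summatory a (Real.exp v) ≤ K * (1 + b) ^ κ := by
  obtain ⟨K, hK, h2⟩ := exists_sum_le hκ.le
  refine ⟨K / κ, by positivity, fun a ha b hb => ?_⟩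
  have hmeas : Measurable fun v => Real.exp (-v) * summatory a (Real.exp v) :=
    (by fun_prop : Measurable fun v : ℝ => Real.exp (-v)).mul
      ((measurable_summatory a).comp Real.measurable_exp)
  have hpt : ∀ v ∈ Set.Icc 0 b, Real.exp (-v) * summatory a (Real.exp v) ≤
      K * (1 + v) ^ (κ - 1) := fun v hv => by
    have := h2 a ha (Real.exp v) (Real.one_le_exp hv.1)
    rw [Real.log_exp] at this
    calc _ ≤ Real.exp (-v) * (K * Real.exp v * (1 + v) ^ (κ - 1)) := by gcongr; exact this
      _ = Real.exp (-v) * Real.exp v * (K * (1 + v) ^ (κ - 1)) := by ring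
      _ = _ := by rw [← Real.exp_add, neg_add_cancel, Real.exp_zero, one_mul]
  have hint := (intervalIntegrable_one_add_rpow (p := κ - 1) hb).const_mul K
  calc _ ≤ ∫ v in (0:ℝ)..b, K * (1 + v) ^ (κ - 1) := by
        refine intervalIntegral.integral_mono_on hb ?_ hint hpt
        refine hint.mono_fun hmeas.aestronglyMeasurable ?_
        refine (ae_restrict_iff' measurableSet_uIoc).2 (ae_of_all _ fun v hv => ?_)
        rw [Set.uIoc_of_le hb] at hv
        have h1 : 0 ≤ Real.exp (-v) * summatory a (Real.exp v) :=
          mul_nonneg (Real.exp_pos _).le (summatory_nonneg ha.nonneg _)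
        have h3 := hpt v ⟨hv.1.le, hv.2⟩
        beta_reduce
        rw [Real.norm_of_nonneg h1, Real.norm_of_nonneg (h1.trans h3)]
        exact h3
    _ ≤ K * ((1 + b) ^ κ / κ) := by
        rw [intervalIntegral.integral_const_mul]
        gcongr
        exact integral_one_add_rpow_le hκ b
    _ = _ := by ring

theorem exists_integral_incr_le (hκ : 0 < κ) : ∃ K : ℝ, 0 < K ∧ ∀ f : ℕ → ℂ,
    IsDominated κ (fun n => ‖f n‖) → ∀ w : ℝ, 1 ≤ w → ∀ c : ℂ, ‖c‖ = w → ∀ b : ℝ,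
    Real.log w ≤ b →
    ∫ v in (0:ℝ)..b, Real.exp (-v) * ‖incr f c w (Real.exp v)‖ ≤ K * (1 + b) ^ κ := by
  obtain ⟨K, hK, hI⟩ := exists_integral_summatory_le hκ
  refine ⟨2 * K, by positivity, fun f hf w hw c hc b hwb => ?_⟩
  set l := Real.log w with hl
  have hl0 : 0 ≤ l := Real.log_nonneg hw
  have hw0 : 0 < w := by linarith
  have hb : 0 ≤ b := hl0.trans hwb
  set a : ℕ → ℝ := fun n => ‖f n‖ with ha
  set G : ℝ → ℝ := fun v => Real.exp (-v) * summatory a (Real.exp v) with hG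
  have ha0 : ∀ n, 0 ≤ a n := fun n => norm_nonneg _
  have hGint : ∀ x y, IntervalIntegrable G volume x y := fun x y => by
    rw [intervalIntegrable_iff]
    refine Measure.integrableOn_of_bounded (M := Real.exp (-(min x y)) *
      summatory a (Real.exp (max x y))) (by simp [Set.uIoc]) ?_ ?_
    · exact ((by fun_prop : Measurable fun v : ℝ => Real.exp (-v)).mul
        ((measurable_summatory a).comp Real.measurable_exp)).aestronglyMeasurable
    · refine (ae_restrict_iff' measurableSet_uIoc).2 (ae_of_all _ fun v hv => ?_)
      rw [Real.norm_of_nonneg (mul_nonneg (Real.exp_pos _).le (summatory_nonneg ha0 _))]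
      have h1 : v ≤ max x y := hv.2
      have h2 : min x y ≤ v := hv.1.le
      exact mul_le_mul (by gcongr) (summatory_mono ha0 (by gcongr)) (summatory_nonneg ha0 _)
        (Real.exp_pos _).le
  have hpt : ∀ v, Real.exp (-v) * ‖incr f c w (Real.exp v)‖ ≤ G v + G (v - l) := fun v => by
    have h1 := norm_incr_le f hw hc (le_refl (Real.exp v))
    have hdiv : Real.exp v / w = Real.exp (v - l) := by rw [Real.exp_sub, hl, Real.exp_log hw0]
    have hwe : Real.exp (-v) * w = Real.exp (-(v - l)) := by
      rw [← Real.exp_log hw0, ← Real.exp_add]; congr 1; ring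
    rw [hdiv] at h1
    calc _ ≤ Real.exp (-v) * (summatory a (Real.exp v) +
          w * summatory a (Real.exp (v - l))) := by gcongr
      _ = Real.exp (-v) * summatory a (Real.exp v) +
          Real.exp (-v) * w * summatory a (Real.exp (v - l)) := by ring
      _ = _ := by rw [hwe]
  have hGshift : IntervalIntegrable (fun v => G (v - l)) volume 0 b := by
    have := (hGint (0 - l) (b - l)).comp_sub_right l
    simpa using this
  calc _ ≤ ∫ v in (0:ℝ)..b, (G v + G (v - l)) :=
        intervalIntegral.integral_mono_on hb (intervalIntegrable_exp_neg_mul_incr f hw hc 0 b)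
          ((hGint _ _).add hGshift) fun v _ => hpt v
    _ = (∫ v in (0:ℝ)..b, G v) + ∫ v in (0:ℝ)..b, G (v - l) :=
        intervalIntegral.integral_add (hGint _ _) hGshift
    _ ≤ K * (1 + b) ^ κ + K * (1 + b) ^ κ := by
        refine add_le_add (hI a hf b hb) ?_
        rw [intervalIntegral.integral_comp_sub_right (fun v => G v) l,
          ← intervalIntegral.integral_add_adjacent_intervals (hGint (0 - l) 0) (hGint 0 (b - l))]
        have h0 : ∫ v in (0 - l)..0, G v = 0 := by
          refine intervalIntegral.integral_zero_ae ?_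
          have : ∀ᵐ v : ℝ, v ≠ 0 := Measure.ae_ne volume 0
          filter_upwards [this] with v hv hmem
          rw [Set.uIoc_of_le (by linarith)] at hmem
          have : Real.exp v < 1 := Real.exp_lt_one_iff.2 (lt_of_le_of_ne hmem.2 hv)
          simp only [hG, summatory_of_lt_one a this, mul_zero]
        rw [h0, zero_add]
        refine (hI a hf (b - l) (by linarith)).trans ?_
        gcongr
        · linarith
    _ = _ := by ring

/-- The contribution of a dyadic block. -/
theorem IsHalaszClass.exists_integral_block_le (hκ : 0 ≤ κ) {E₀ E C₀ : ℝ}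
    (hE0 : 0 ≤ E) (hEE : E ≤ E₀) (hE1 : E ≤ 1) (hEκ : E ≤ κ) (hC₀ : 0 ≤ C₀) :
    ∃ K : ℝ, 0 < K ∧ ∀ f Λf : ℕ → ℂ, IsHalaszClass κ f Λf → ∀ A L T t₁ w : ℝ, 1 ≤ A → A ≤ L →
    1 ≤ w → Real.log w ≤ A → Real.log L ^ 2 ≤ A → 7 ≤ T → L ^ (2 * E) ≤ T →
    IsRepelled κ E₀ C₀ L T t₁ f → ∀ V V' : ℝ, 2 * A ≤ V → V ≤ V' → V' ≤ 2 * V → V' ≤ L →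
    ∫ v in V..V', Real.exp (-v) *
      ‖incr f (cexp ((1 + t₁ * I) * Real.log w)) w (Real.exp v)‖ ≤ K * (A ^ E * L ^ (κ - E)) := by
  obtain ⟨K₁, hK₁, hsq⟩ := IsHalaszClass.exists_integral_sq_le_of_isRepelled hκ hE0 hEE hE1 hEκ hC₀
  obtain ⟨K₂, hK₂, hcmp⟩ := exists_mul_norm_incr_le hκ
  refine ⟨Real.exp 4 / 2 * K₁ + (1 / 2 + K₂ * (2 * 2 ^ |κ - 1|)), by positivity, ?_⟩
  intro f Λf h A L T t₁ w hA hAL hw hwA hLA hT hET hrep V V' hAV hVV' hV'2 hV'L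
  have hA0 : 0 < A := by linarith
  have hL0 : 0 < L := by linarith
  have hV0 : 0 < V := by linarith
  have hw0 : 0 < w := by linarith
  set c := cexp ((1 + t₁ * I) * Real.log w) with hc
  have hcn : ‖c‖ = w := by
    rw [hc, Complex.norm_exp]
    simp [Real.exp_log hw0]
  obtain ⟨hXint, hX⟩ := hsq f Λf h A L T t₁ w hA hAL hw hwA hLA hT hET hrep (1 / V)
    (one_div_le_one_div_of_le hV0 (hVV'.trans hV'L)) (one_div_le_one_div_of_le (by linarith) hAV)
  rw [← hc] at hXint hX
  set B := A ^ E * L ^ (κ - E) with hB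
  have hB0 : 0 < B := by positivity
  set X : ℝ → ℝ := fun v => ‖incr (fun n : ℕ => f n * (Real.log n : ℂ)) c w (Real.exp v)‖ ^ 2 *
    Real.exp (-(2 * (1 + 1 / V)) * v) with hXdef
  have hX0 : ∀ v, 0 ≤ X v := fun v => by positivity
  set D : ℝ := (B / 2 + K₂ * (2 * 2 ^ |κ - 1|) * B) / V with hD
  have hpt : ∀ v ∈ Set.Icc V V', Real.exp (-v) * ‖incr f c w (Real.exp v)‖ ≤
      Real.exp 4 / (2 * (B * V)) * X v + D := by
    intro v hv
    have hv0 : 0 < v := hV0.trans_le hv.1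
    have h1 := hcmp f h.isDominated w hw c hcn v (by linarith [hv.1])
    set H := ‖incr (fun n : ℕ => f n * (Real.log n : ℂ)) c w (Real.exp v)‖ with hH
    set g := ‖incr f c w (Real.exp v)‖
    have hexp : Real.exp (-v) * Real.exp v = 1 := by
      rw [← Real.exp_add, neg_add_cancel, Real.exp_zero]
    have h2 : v * (Real.exp (-v) * g) ≤ Real.exp (-v) * H +
        K₂ * ((1 + Real.log w) * (1 + v) ^ (κ - 1)) := by
      have := mul_le_mul_of_nonneg_left h1 (Real.exp_pos (-v)).le
      have e : Real.exp (-v) * (H + K₂ * Real.exp v * ((1 + Real.log w) * (1 + v) ^ (κ - 1))) =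
          Real.exp (-v) * H + K₂ * ((Real.exp (-v) * Real.exp v) *
            ((1 + Real.log w) * (1 + v) ^ (κ - 1))) := by ring
      rw [e, hexp, one_mul] at this
      linarith
    have h3 : (1 + Real.log w) * (1 + v) ^ (κ - 1) ≤ 2 * 2 ^ |κ - 1| * B := by
      have q1 : (1 + v) ^ (κ - 1) ≤ 2 ^ |κ - 1| * v ^ (κ - 1) :=
        rpow_le_rpow_abs_mul hv0 one_le_two (by linarith) (by linarith [hv.1])
      have q2 := mul_rpow_sub_one_le hE1 hEκ hA0 (show A ≤ v by linarith [hv.1])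
        (hv.2.trans hV'L)
      calc _ ≤ (2 * A) * (2 ^ |κ - 1| * v ^ (κ - 1)) := by gcongr; linarith
        _ = 2 * 2 ^ |κ - 1| * (A * v ^ (κ - 1)) := by ring
        _ ≤ _ := by gcongr
    have h4 : (Real.exp (-v) * H) ^ 2 ≤ Real.exp 4 * X v := by
      have q : Real.exp (-v) ^ 2 ≤ Real.exp 4 * Real.exp (-(2 * (1 + 1 / V)) * v) := by
        rw [← Real.exp_nat_mul, ← Real.exp_add]
        refine Real.exp_le_exp.2 ?_
        have : v / V ≤ 2 := by rw [div_le_iff₀ hV0]; linarith [hv.2]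
        have e : -(2 * (1 + 1 / V)) * v = -(2 * v) - 2 * (v / V) := by ring
        rw [e]; push_cast; linarith
      rw [mul_pow, hXdef]
      calc Real.exp (-v) ^ 2 * H ^ 2 ≤ Real.exp 4 * Real.exp (-(2 * (1 + 1 / V)) * v) * H ^ 2 := by
            gcongr
        _ = _ := by ring
    set y := Real.exp (-v) * H with hy
    have hy0 : 0 ≤ y := by positivity
    have h5 : y ≤ Real.exp 4 / (2 * B) * X v + B / 2 := by
      have : y ≤ y ^ 2 / (2 * B) + B / 2 := by
        rw [← sub_nonneg]
        have e : y ^ 2 / (2 * B) + B / 2 - y = (y - B) ^ 2 / (2 * B) := by field_simp; ring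
        rw [e]; positivity
      refine this.trans (add_le_add_left ?_ _)
      calc y ^ 2 / (2 * B) ≤ Real.exp 4 * X v / (2 * B) := by gcongr
        _ = _ := by ring
    set y' := Real.exp (-v) * g with hy'
    have hy'0 : 0 ≤ y' := by positivity
    have h6 : V * y' ≤ Real.exp 4 / (2 * B) * X v + (B / 2 + K₂ * (2 * 2 ^ |κ - 1|) * B) := by
      calc V * y' ≤ v * y' := by gcongr; exact hv.1
        _ ≤ y + K₂ * ((1 + Real.log w) * (1 + v) ^ (κ - 1)) := h2
        _ ≤ (Real.exp 4 / (2 * B) * X v + B / 2) + K₂ * (2 * 2 ^ |κ - 1| * B) := by gcongr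
        _ = _ := by ring
    have e : Real.exp 4 / (2 * (B * V)) * X v + D =
        (Real.exp 4 / (2 * B) * X v + (B / 2 + K₂ * (2 * 2 ^ |κ - 1|) * B)) / V := by
      rw [hD]; field_simp
    rw [e, le_div_iff₀ hV0, mul_comm]
    exact h6
  have hXi : IntervalIntegrable (fun v => Real.exp 4 / (2 * (B * V)) * X v) volume V V' :=
    hXint.intervalIntegrable.const_mul _
  calc _ ≤ ∫ v in V..V', (Real.exp 4 / (2 * (B * V)) * X v + D) :=
        intervalIntegral.integral_mono_on hVV' (intervalIntegrable_exp_neg_mul_incr f hw hcn _ _)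
          (hXi.add intervalIntegrable_const) hpt
    _ = Real.exp 4 / (2 * (B * V)) * (∫ v in V..V', X v) + (V' - V) * D := by
        rw [intervalIntegral.integral_add hXi intervalIntegrable_const,
          intervalIntegral.integral_const_mul, intervalIntegral.integral_const, smul_eq_mul]
    _ ≤ Real.exp 4 / (2 * (B * V)) * (K₁ / (1 / V) * B ^ 2) + V * D := by
        have hD0 : 0 ≤ D := by positivity
        gcongr
        · refine le_trans ?_ hX
          rw [intervalIntegral.integral_of_le hVV']
          exact setIntegral_le_integral hXint (ae_of_all _ hX0)
        · linarith
    _ = _ := by rw [hD]; field_simp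

theorem integral_le_of_blocks {g : ℝ → ℝ} {a L D : ℝ} (ha : 0 ≤ a)
    (hg : ∀ x y, IntervalIntegrable g volume x y) (hD : 0 ≤ D)
    (hblock : ∀ V V', a ≤ V → V ≤ V' → V' ≤ 2 * V → V' ≤ L → ∫ v in V..V', g v ≤ D) (n : ℕ) :
    ∀ b, a ≤ b → b ≤ 2 ^ n * a → b ≤ L → ∫ v in a..b, g v ≤ n * D := by
  induction n with
  | zero =>
    intro b h1 h2 _
    have : b = a := by simp at h2; linarith
    simp [this]
  | succ n ih =>
    intro b h1 h2 h3
    push_cast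
    rcases le_total b (2 ^ n * a) with h | h
    · linarith [ih b h1 h h3]
    · have ha2 : a ≤ 2 ^ n * a := le_mul_of_one_le_left ha (one_le_pow₀ one_le_two)
      rw [← intervalIntegral.integral_add_adjacent_intervals (hg a (2 ^ n * a)) (hg _ b)]
      have := hblock (2 ^ n * a) b ha2 h (by rw [pow_succ] at h2; linarith) h3
      linarith [ih (2 ^ n * a) ha2 le_rfl (h.trans h3)]

end IntegralBound

section Lipschitz

open ArithmeticFunction Finset

variable {κ : ℝ} {f Λf : ℕ → ℂ}

theorem log_two_le_log_div {L l : ℝ} (hL : 6 ≤ L) (hl : 0 ≤ l) (hlL : l ≤ L / 3) :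
    Real.log 2 ≤ Real.log (L / (1 + l)) := by
  refine Real.log_le_log two_pos ?_
  rw [le_div_iff₀ (by linarith)]
  linarith

theorem exists_two_pow_mul_ge {L A l : ℝ} (hL : 6 ≤ L) (hl : 0 ≤ l) (hlL : l ≤ L / 3)
    (hlA : 1 + l ≤ 2 * A) :
    ∃ n : ℕ, L ≤ 2 ^ n * (2 * A) ∧ (n : ℝ) ≤ 4 * Real.log (L / (1 + l)) := by
  have hA : 0 < 2 * A := by linarith
  have hL0 : 0 < L := by linarith
  have hQ := log_two_le_log_div hL hl hlL
  have hlog2 := Real.log_two_gt_d9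
  have hpos : 0 < L / (2 * A) := by positivity
  have hle : Real.log (L / (2 * A)) ≤ Real.log (L / (1 + l)) :=
    Real.log_le_log hpos (by gcongr)
  set Q := Real.log (L / (1 + l))
  set y := Real.log (L / (2 * A)) / Real.log 2 with hy
  have hyQ : y ≤ 2 * Q := by
    rw [hy, div_le_iff₀ (by linarith)]
    nlinarith
  refine ⟨⌈y⌉₊, ?_, ?_⟩
  · rw [← div_le_iff₀ hA, ← Real.log_le_log_iff hpos (by positivity), Real.log_pow,
      ← div_le_iff₀ (by linarith)]
    exact Nat.le_ceil y
  · rcases le_total y 0 with h | h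
    · rw [Nat.ceil_eq_zero.2 h]; push_cast; linarith
    · linarith [Nat.ceil_lt_add_one h]

theorem IsHalaszClass.exists_integral_le_of_isRepelled (hκ : 0 < κ) {E₀ E C₀ : ℝ}
    (hE0 : 0 ≤ E) (hEE : E ≤ E₀) (hE1 : E ≤ 1) (hEκ : E ≤ κ) (hC₀ : 0 ≤ C₀) :
    ∃ K : ℝ, 0 < K ∧ ∀ f Λf : ℕ → ℂ, IsHalaszClass κ f Λf → ∀ A L T t₁ w : ℝ, 6 ≤ L → 1 ≤ A →
    2 * A ≤ L → 1 ≤ w → Real.log w ≤ L / 3 → Real.log w ≤ A → Real.log L ^ 2 ≤ A → 7 ≤ T →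
    L ^ (2 * E) ≤ T → IsRepelled κ E₀ C₀ L T t₁ f →
    ∫ v in (0:ℝ)..L, Real.exp (-v) *
      ‖incr f (cexp ((1 + t₁ * I) * Real.log w)) w (Real.exp v)‖ ≤
        K * (A ^ E * L ^ (κ - E)) * Real.log (L / (1 + Real.log w)) := by
  obtain ⟨K₁, hK₁, hinit⟩ := exists_integral_incr_le hκ
  obtain ⟨K₂, hK₂, hblock⟩ :=
    IsHalaszClass.exists_integral_block_le hκ.le hE0 hEE hE1 hEκ hC₀
  refine ⟨2 * (K₁ * 3 ^ κ) + 4 * K₂, by positivity, ?_⟩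
  intro f Λf h A L T t₁ w hL hA hAL hw hwL hwA hLA hT hET hrep
  have hl := Real.log_nonneg hw
  have hA0 : 0 < A := by linarith
  have hL0 : 0 < L := by linarith
  have hw0 : 0 < w := by linarith
  set c := cexp ((1 + t₁ * I) * Real.log w) with hc
  have hcn : ‖c‖ = w := by
    rw [hc, Complex.norm_exp]
    simp [Real.exp_log hw0]
  have hint := intervalIntegrable_exp_neg_mul_incr f hw hcn
  obtain ⟨n, hn, hnQ⟩ := exists_two_pow_mul_ge (A := A) hL hl hwL (by linarith)
  have hQ := log_two_le_log_div hL hl hwL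
  have hlog2 := Real.log_two_gt_d9
  set Q := Real.log (L / (1 + Real.log w))
  set B := A ^ E * L ^ (κ - E) with hB
  have hB0 : 0 < B := by positivity
  have h1 := hinit f h.isDominated w hw c hcn (2 * A) (by linarith)
  have h2 := integral_le_of_blocks (by linarith) hint (by positivity)
    (hblock f Λf h A L T t₁ w hA (by linarith) hw hwA hLA hT hET hrep) n L hAL hn le_rfl
  rw [← intervalIntegral.integral_add_adjacent_intervals (hint 0 (2 * A)) (hint (2 * A) L)]
  have h3 : (1 + 2 * A) ^ κ ≤ 3 ^ κ * B := by
    calc (1 + 2 * A) ^ κ ≤ (3 * A) ^ κ := by gcongr; linarith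
      _ = 3 ^ κ * (A ^ E * A ^ (κ - E)) := by
        rw [Real.mul_rpow (by norm_num) hA0.le, ← Real.rpow_add hA0, add_sub_cancel]
      _ ≤ _ := by
        rw [hB]
        gcongr
        linarith
  calc _ ≤ K₁ * (1 + 2 * A) ^ κ + n * (K₂ * B) := add_le_add h1 h2
    _ ≤ K₁ * (3 ^ κ * B) + (4 * Q) * (K₂ * B) := by gcongr
    _ ≤ K₁ * (3 ^ κ * B) * (2 * Q) + (4 * Q) * (K₂ * B) :=
      add_le_add (le_mul_of_one_le_right (by positivity) (by linarith)) le_rfl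
    _ = _ := by ring

theorem IsHalaszClass.exists_norm_incr_le_of_isRepelled (hκ : 0 < κ) {E₀ E C₀ : ℝ}
    (hE0 : 0 ≤ E) (hEE : E ≤ E₀) (hE1 : E ≤ 1) (hEκ : E ≤ κ) (hC₀ : 0 ≤ C₀) :
    ∃ K : ℝ, 0 < K ∧ ∀ f Λf : ℕ → ℂ, IsHalaszClass κ f Λf → ∀ L T t₁ w : ℝ, 6 ≤ L →
    1 ≤ Real.log L → 6 * Real.log L ^ 2 ≤ L → 1 ≤ w → Real.log w ≤ L / 3 → 7 ≤ T →
    L ^ (2 * E) ≤ T → IsRepelled κ E₀ C₀ L T t₁ f →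
    ‖incr f (cexp ((1 + t₁ * I) * Real.log w)) w (Real.exp L)‖ ≤ K * Real.exp L *
      (((Real.log w + Real.log L ^ 2) / L) ^ E * L ^ (κ - 1) *
        Real.log (L / (1 + Real.log w))) := by
  obtain ⟨K₁, hK₁, hI⟩ := IsHalaszClass.exists_integral_le_of_isRepelled hκ hE0 hEE hE1 hEκ hC₀
  obtain ⟨K₂, hK₂, hcmp⟩ := exists_mul_norm_incr_le hκ.le
  obtain ⟨K₃, hK₃, hsum⟩ := exists_sum_vonMangoldt_mul_incr_le hκ.le
  refine ⟨κ * K₃ * (K₁ + 6 * 2 ^ |κ - 1|) + K₂ * (4 * 2 ^ |κ - 1|), by positivity, ?_⟩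
  intro f Λf h L T t₁ w hL hlogL hlogL2 hw hwL hT hET hrep
  have hl := Real.log_nonneg hw
  have hL0 : 0 < L := by linarith
  have hw0 : 0 < w := by linarith
  set c := cexp ((1 + t₁ * I) * Real.log w) with hc
  have hcn : ‖c‖ = w := by
    rw [hc, Complex.norm_exp]
    simp [Real.exp_log hw0]
  set A := Real.log w + Real.log L ^ 2 with hAdef
  have hsq : Real.log L ≤ Real.log L ^ 2 := by nlinarith
  have hA : 1 ≤ A := by linarith
  have hA0 : 0 < A := by linarith
  have h1 := hI f Λf h A L T t₁ w hL hA (by linarith) hw hwL (by nlinarith) (by linarith)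
    hT hET hrep
  rw [← hc] at h1
  have hQ := log_two_le_log_div hL hl hwL
  have hlog2 := Real.log_two_gt_d9
  have hlog2' := Real.log_two_lt_d9
  set Q := Real.log (L / (1 + Real.log w))
  set B := A ^ E * L ^ (κ - E) with hB
  have hB0 : 0 < B := by positivity
  have hBQ : B ≤ B * (2 * Q) := le_mul_of_one_le_right hB0.le (by linarith)
  have hAB : A * L ^ (κ - 1) ≤ B := mul_rpow_sub_one_le hE1 hEκ hA0 (by linarith) le_rfl
  have hpow : (1 + L) ^ (κ - 1) ≤ 2 ^ |κ - 1| * L ^ (κ - 1) :=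
    rpow_le_rpow_abs_mul hL0 one_le_two (by linarith) (by linarith)
  have hlog : 1 + Real.log (1 + L) ≤ 3 * A := by
    have : Real.log (1 + L) ≤ Real.log 2 + Real.log L := by
      rw [← Real.log_mul (by norm_num) hL0.ne']
      exact Real.log_le_log (by linarith) (by linarith)
    linarith
  have hlog0 : 0 ≤ 1 + Real.log (1 + L) := by
    have := Real.log_nonneg (show (1:ℝ) ≤ 1 + L by linarith)
    linarith
  have hw2 : w ^ 2 ≤ Real.exp L := by
    rw [← Real.exp_log hw0, ← Real.exp_nat_mul]
    refine Real.exp_le_exp.2 ?_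
    push_cast; linarith
  have h2 := hsum f h.isDominated (Real.exp L) w hw hw2 c hcn
  rw [Real.log_exp] at h2
  have h3 := hcmp f h.isDominated w hw c hcn L (by linarith)
  have h4 := h.norm_incr_mul_log_le c hw (Real.exp_pos L).le
  have h5 : (1 + L) ^ (κ - 1) * (1 + Real.log (1 + L)) ≤ 6 * 2 ^ |κ - 1| * (B * Q) := by
    calc _ ≤ (2 ^ |κ - 1| * L ^ (κ - 1)) * (3 * A) := by gcongr
      _ = 3 * 2 ^ |κ - 1| * (A * L ^ (κ - 1)) := by ring
      _ ≤ 3 * 2 ^ |κ - 1| * (B * (2 * Q)) :=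
        mul_le_mul_of_nonneg_left (hAB.trans hBQ) (by positivity)
      _ = _ := by ring
  have h6 : (1 + Real.log w) * (1 + L) ^ (κ - 1) ≤ 4 * 2 ^ |κ - 1| * (B * Q) := by
    calc _ ≤ (2 * A) * (2 ^ |κ - 1| * L ^ (κ - 1)) := by gcongr; nlinarith
      _ = 2 * 2 ^ |κ - 1| * (A * L ^ (κ - 1)) := by ring
      _ ≤ 2 * 2 ^ |κ - 1| * (B * (2 * Q)) :=
        mul_le_mul_of_nonneg_left (hAB.trans hBQ) (by positivity)
      _ = _ := by ring
  have hBL : (A / L) ^ E * L ^ (κ - 1) = B / L := by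
    rw [Real.div_rpow hA0.le hL0.le, hB, show κ - 1 = (κ - E) + E - 1 by ring,
      Real.rpow_sub_one hL0.ne', Real.rpow_add hL0]
    have : L ^ E ≠ 0 := by positivity
    field_simp
  rw [hBL]
  have h7 : L * ‖incr f c w (Real.exp L)‖ ≤
      κ * (K₃ * Real.exp L * (K₁ * B * Q + 6 * 2 ^ |κ - 1| * (B * Q))) +
        K₂ * Real.exp L * (4 * 2 ^ |κ - 1| * (B * Q)) := by
    calc _ ≤ _ := h3
      _ ≤ κ * (K₃ * Real.exp L * (K₁ * B * Q + 6 * 2 ^ |κ - 1| * (B * Q))) +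
        K₂ * Real.exp L * (4 * 2 ^ |κ - 1| * (B * Q)) := by
        gcongr
        refine h4.trans ?_
        gcongr
        refine h2.trans ?_
        gcongr
  refine le_of_mul_le_mul_left (h7.trans_eq ?_) hL0
  field_simp

/-- The difference of the two twisted means, as an increment. -/
theorem norm_twisted_sub_eq (f : ℕ → ℂ) {x w : ℝ} (hx : 0 < x) (hw : 1 ≤ w) (t₁ : ℝ) :
    ‖(x : ℂ) ^ (-(1 + (t₁ : ℂ) * I)) * ∑ n ∈ Icc 1 ⌊x⌋₊, f n
      - ((x / w : ℝ) : ℂ) ^ (-(1 + (t₁ : ℂ) * I)) * ∑ n ∈ Icc 1 ⌊x / w⌋₊, f n‖ =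
      ‖incr f (cexp ((1 + t₁ * I) * Real.log w)) w x‖ / x := by
  have hw0 : 0 < w := by linarith
  have hx0 : (x : ℂ) ≠ 0 := by exact_mod_cast hx.ne'
  have hxw0 : ((x / w : ℝ) : ℂ) ≠ 0 := by exact_mod_cast (div_pos hx hw0).ne'
  have hkey : ((x / w : ℝ) : ℂ) ^ (-(1 + (t₁ : ℂ) * I)) =
      (x : ℂ) ^ (-(1 + (t₁ : ℂ) * I)) * cexp ((1 + t₁ * I) * Real.log w) := by
    rw [Complex.cpow_def_of_ne_zero hxw0, Complex.cpow_def_of_ne_zero hx0, ← Complex.exp_add,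
      ← Complex.ofReal_log (div_pos hx hw0).le, ← Complex.ofReal_log hx.le,
      Real.log_div hx.ne' hw0.ne']
    congr 1
    push_cast
    ring
  rw [hkey, mul_assoc, ← mul_sub, norm_mul, Complex.norm_cpow_eq_rpow_re_of_pos hx]
  have : (-(1 + (t₁ : ℂ) * I)).re = -1 := by simp
  rw [this, Real.rpow_neg_one, inv_mul_eq_div]
  rfl

theorem exists_large_log (κ : ℝ) (hκ : 0 < κ) : ∃ C : ℝ, 1 < C ∧ ∀ x : ℝ, C ≤ x →
    6 ≤ Real.log x ∧ 1 ≤ Real.log (Real.log x) ∧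
      6 * Real.log (Real.log x) ^ 2 ≤ Real.log x ∧ 7 ≤ Real.log x ^ κ := by
  have hlog := Real.tendsto_log_atTop
  have h1 := hlog.eventually_ge_atTop 6
  have h2 := (hlog.comp hlog).eventually_ge_atTop 1
  have h3 : ∀ᶠ y : ℝ in Filter.atTop, 6 * Real.log y ^ 2 ≤ y := by
    have := (Real.isLittleO_pow_log_id_atTop (n := 2)).bound (show (0:ℝ) < 1 / 6 by norm_num)
    filter_upwards [this, Filter.eventually_ge_atTop 0] with y hy hy0
    rw [Real.norm_of_nonneg (by positivity), id, Real.norm_of_nonneg hy0] at hy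
    linarith
  have h4 := ((tendsto_rpow_atTop hκ).comp hlog).eventually_ge_atTop 7
  obtain ⟨C, hC⟩ := Filter.eventually_atTop.1 (h1.and (h2.and ((hlog.eventually h3).and h4)))
  exact ⟨max C 2, by simp, fun x hx => hC x ((le_max_left _ _).trans hx)⟩

end Lipschitz

theorem lipschitz_theorem (κ : ℝ) (hκ : 0 < κ) :
    ∃ C : ℝ, 0 < C ∧ ∀ f Λf : ℕ → ℂ, IsHalaszClass κ f Λf → ∀ x : ℝ, C ≤ x →
    ∀ t₁ : ℝ, |t₁| ≤ Real.log x ^ κ →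
    (∀ t : ℝ, |t| ≤ Real.log x ^ κ →
      ‖Fser f (((1 + 1 / Real.log x : ℝ) : ℂ) + (t : ℂ) * Complex.I)‖ ≤
        ‖Fser f (((1 + 1 / Real.log x : ℝ) : ℂ) + (t₁ : ℂ) * Complex.I)‖) →
    ∀ w : ℝ, 1 ≤ w → w ≤ x ^ ((1 : ℝ) / 3) →
      (‖(x : ℂ) ^ (-(1 + (t₁ : ℂ) * Complex.I)) * ∑ n ∈ Finset.Icc 1 ⌊x⌋₊, f n
          - ((x / w : ℝ) : ℂ) ^ (-(1 + (t₁ : ℂ) * Complex.I)) *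
              ∑ n ∈ Finset.Icc 1 ⌊x / w⌋₊, f n‖ ≤
        C * ((Real.log w + Real.log (Real.log x) ^ 2) / Real.log x)
              ^ (min (κ * (1 - 2 / Real.pi)) 1)
          * Real.log x ^ (κ - 1)
          * Real.log (Real.log x / Real.log (Real.exp 1 * w)))
      ∧ ((∀ n : ℕ, ∃ r : ℝ, 0 ≤ r ∧ f n = (r : ℂ)) →
        ‖(x : ℂ) ^ (-(1 + (t₁ : ℂ) * Complex.I)) * ∑ n ∈ Finset.Icc 1 ⌊x⌋₊, f n
            - ((x / w : ℝ) : ℂ) ^ (-(1 + (t₁ : ℂ) * Complex.I)) *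
                ∑ n ∈ Finset.Icc 1 ⌊x / w⌋₊, f n‖ ≤
          C * ((Real.log w + Real.log (Real.log x) ^ 2) / Real.log x)
                ^ (min (κ * (1 - 1 / Real.pi)) 1)
            * Real.log x ^ (κ - 1)
            * Real.log (Real.log x / Real.log (Real.exp 1 * w))) := by

  obtain ⟨C₁, hC₁, hrep₁⟩ := exists_norm_LSeries_le_of_isMax hκ.le
  obtain ⟨C₂, hC₂, hrep₂⟩ := exists_norm_LSeries_le_of_isMax_nonneg hκ.le
  obtain ⟨C₃, hC₃, hlarge⟩ := exists_large_log κ hκ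
  have hpi := Real.pi_gt_three
  have hpi4 := Real.pi_le_four
  have hpi0 := Real.pi_pos
  have hq0 : 0 < 1 / Real.pi := by positivity
  have hq1 : 1 / Real.pi ≤ 1 / 2 := one_div_le_one_div_of_le two_pos (by linarith)
  have hq2 : 1 / 4 ≤ 1 / Real.pi := one_div_le_one_div_of_le hpi0 hpi4
  have hq : 2 / Real.pi = 2 * (1 / Real.pi) := by ring
  set q := 1 / Real.pi
  have hE₁0 : 0 ≤ min (κ * (1 - 2 / Real.pi)) 1 :=
    le_min (mul_nonneg hκ.le (by linarith)) zero_le_one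
  have hE₂0 : 0 ≤ min (κ * (1 - q)) 1 := le_min (mul_nonneg hκ.le (by linarith)) zero_le_one
  have hE₁κ : min (κ * (1 - 2 / Real.pi)) 1 ≤ κ := (min_le_left _ _).trans (by nlinarith)
  have hE₂κ : min (κ * (1 - q)) 1 ≤ κ := (min_le_left _ _).trans (by nlinarith)
  obtain ⟨K₁, hK₁, hb₁⟩ := IsHalaszClass.exists_norm_incr_le_of_isRepelled hκ hE₁0
    (min_le_left _ _) (min_le_right _ _) hE₁κ hC₁.le
  obtain ⟨K₂, hK₂, hb₂⟩ := IsHalaszClass.exists_norm_incr_le_of_isRepelled hκ hE₂0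
    (min_le_left _ _) (min_le_right _ _) hE₂κ hC₂.le
  refine ⟨C₃ + K₁ + K₂, by positivity, ?_⟩
  intro f Λf h x hx t₁ ht₁ hmax w hw hwx
  obtain ⟨hL6, hlogL, hlogL2, hL7⟩ := hlarge x (by linarith)
  have hx0 : 0 < x := by linarith
  have hw0 : 0 < w := by linarith
  have hL0 : 0 < Real.log x := by linarith
  have hwL : Real.log w ≤ Real.log x / 3 := by
    have := Real.log_le_log hw0 hwx
    rw [Real.log_rpow hx0] at this
    linarith
  have hlw : Real.log (Real.exp 1 * w) = 1 + Real.log w := by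
    rw [Real.log_mul (Real.exp_pos 1).ne' hw0.ne', Real.log_exp]
  have hmax' : ∀ t : ℝ, |t| ≤ Real.log x ^ κ → ‖LSeries f (vline (1 / Real.log x) t)‖ ≤
      ‖LSeries f (vline (1 / Real.log x) t₁)‖ := fun t ht => by
    have hne := vline_ne_zero (one_div_pos.2 hL0)
    rw [← Fser_eq_LSeries f (hne t), ← Fser_eq_LSeries f (hne t₁)]
    exact hmax t ht
  have hQ0 : 0 ≤ Real.log (Real.log x / (1 + Real.log w)) :=
    (Real.log_nonneg one_le_two).trans (log_two_le_log_div hL6 (Real.log_nonneg hw) hwL)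
  rw [hlw, norm_twisted_sub_eq f hx0 hw]
  have hA0 : 0 ≤ (Real.log w + Real.log (Real.log x) ^ 2) / Real.log x :=
    div_nonneg (add_nonneg (Real.log_nonneg hw) (sq_nonneg _)) hL0.le
  have hfinish : ∀ {K E : ℝ}, K ≤ C₃ + K₁ + K₂ →
      ‖incr f (cexp ((1 + t₁ * I) * Real.log w)) w (Real.exp (Real.log x))‖ ≤
        K * Real.exp (Real.log x) *
        (((Real.log w + Real.log (Real.log x) ^ 2) / Real.log x) ^ E * Real.log x ^ (κ - 1) *
          Real.log (Real.log x / (1 + Real.log w))) →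
      ‖incr f (cexp ((1 + t₁ * I) * Real.log w)) w x‖ / x ≤ (C₃ + K₁ + K₂) *
        ((Real.log w + Real.log (Real.log x) ^ 2) / Real.log x) ^ E * Real.log x ^ (κ - 1) *
          Real.log (Real.log x / (1 + Real.log w)) := fun {K E} hK hle => by
    rw [Real.exp_log hx0] at hle
    rw [div_le_iff₀ hx0]
    refine hle.trans ?_
    calc _ = K * (((Real.log w + Real.log (Real.log x) ^ 2) / Real.log x) ^ E *
          Real.log x ^ (κ - 1) * Real.log (Real.log x / (1 + Real.log w)) * x) := by ring
      _ ≤ (C₃ + K₁ + K₂) * (((Real.log w + Real.log (Real.log x) ^ 2) / Real.log x) ^ E *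
          Real.log x ^ (κ - 1) * Real.log (Real.log x / (1 + Real.log w)) * x) := by gcongr
      _ = _ := by ring
  have hL1 : 1 ≤ Real.log x := by linarith
  refine ⟨hfinish (by linarith) (hb₁ f Λf h (Real.log x) (Real.log x ^ κ) t₁ w hL6 hlogL hlogL2 hw
    hwL hL7 (Real.rpow_le_rpow_of_exponent_le hL1 ?_) ?_), fun hf => hfinish (by linarith)
    (hb₂ f Λf h (Real.log x) (Real.log x ^ (2 * κ)) t₁ w hL6 hlogL hlogL2 hw hwL
    (hL7.trans (Real.rpow_le_rpow_of_exponent_le hL1 (by linarith)))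
    (Real.rpow_le_rpow_of_exponent_le hL1 (by linarith)) ?_)⟩
  · have := min_le_left (κ * (1 - 2 / Real.pi)) 1
    nlinarith
  · intro t ht σ ρ h1 h2 h3 h4
    rw [show κ - κ * (1 - 2 / Real.pi) = κ * (2 / Real.pi) by ring]
    exact hrep₁ f Λf h (Real.log x) hL0 hlogL t₁ ht₁ hmax' t ht σ ρ h1 h2 h3 h4
  · intro t ht σ ρ h1 h2 h3 h4
    rw [show κ - κ * (1 - q) = κ * q by ring]
    exact hrep₂ f Λf h hf (Real.log x) hL0 hlogL t₁ ht₁ hmax' t ht σ ρ h1 h2 h3 h4
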